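/- Let Z be a nonnegative Λ-measurable process of class(D^Λ) and Z̄ its Λ-Snell envelope. Then for every Λ-stopping time S, E[Z̄_S] equals the supremum of E[Z_σ] over all divided stopping times σ = (T, W^−, W, W^+) with T ≥ S and T > S on W^−, and this supremum is attained by some such divided stopping time. In particular, the relaxed optimal stopping problem of maximizing E[Z_σ] over all divided stopping times σ has an optimal solution, with optimal value E[Z̄_0]. -/

import Mathlib

open MeasureTheory Filter Set Topology
open scoped NNReal ENNReal symmDiff Classical

noncomputable section

namespace Meyer

variable {Ω : Type*}

/-- The σ-field generated by a family of real-valued functions. -/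
def genBy {α : Type*} (C : Set (α → ℝ)) : MeasurableSpace α :=
  ⨆ f ∈ C, MeasurableSpace.comap f inferInstance

/-- A function is càdlàg: right-continuous with left limits. -/
def IsCadlag (f : ℝ≥0 → ℝ) : Prop :=
  (∀ t, Tendsto f (𝓝[≥] t) (𝓝 (f t))) ∧
  ∀ t : ℝ≥0, 0 < t → ∃ l, Tendsto f (𝓝[<] t) (𝓝 l)

/-- A Meyer-σ-field over `(Ω, mΩ)`: a σ-field on `Ω × [0,∞)` contained in the product
σ-field, generated by càdlàg processes, containing `{∅,Ω} × B([0,∞))` and stable under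
stopping at deterministic times. -/
structure IsMeyer (mΩ : MeasurableSpace Ω) (Λ : MeasurableSpace (Ω × ℝ≥0)) : Prop where
  le_prod : Λ ≤ @Prod.instMeasurableSpace Ω ℝ≥0 mΩ inferInstance
  gen_cadlag : ∃ C : Set (Ω × ℝ≥0 → ℝ),
    (∀ Z ∈ C, ∀ ω, IsCadlag fun t => Z (ω, t)) ∧ Λ = genBy C
  contains_borel : ∀ B : Set ℝ≥0, MeasurableSet B → MeasurableSet[Λ] (Set.univ ×ˢ B)
  stop_stable : ∀ Z : Ω × ℝ≥0 → ℝ, Measurable[Λ] Z → ∀ s : ℝ≥0,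
    Measurable[Λ] fun p => Z (p.1, min p.2 s)

/-- A `Λ`-stopping time: `[[S,∞[[ ∈ Λ`. -/
def IsStoppingTimeM (Λ : MeasurableSpace (Ω × ℝ≥0)) (S : Ω → ℝ≥0∞) : Prop :=
  MeasurableSet[Λ] {p : Ω × ℝ≥0 | S p.1 ≤ (p.2 : ℝ≥0∞)}

/-- The associated filtration `F^Λ_t := σ(Z_t : Z Λ-measurable)`. -/
def sigmaAt (Λ : MeasurableSpace (Ω × ℝ≥0)) (t : ℝ≥0) : MeasurableSpace Ω :=
  genBy {f : Ω → ℝ | ∃ Z : Ω × ℝ≥0 → ℝ, Measurable[Λ] Z ∧ f = fun ω => Z (ω, t)}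

/-- `F^Λ_∞`. -/
def sigmaInf (Λ : MeasurableSpace (Ω × ℝ≥0)) : MeasurableSpace Ω := ⨆ t : ℝ≥0, sigmaAt Λ t

/-- A process indexed by `[0,∞]` is `Λ`-measurable if its restriction to `Ω × [0,∞)`
is `Λ`-measurable and its value at `∞` is `F^Λ_∞`-measurable. -/
def MeasurableProcessE (Λ : MeasurableSpace (Ω × ℝ≥0)) (Z : Ω × ℝ≥0∞ → ℝ) : Prop :=
  Measurable[Λ] (fun p : Ω × ℝ≥0 => Z (p.1, (p.2 : ℝ≥0∞))) ∧
  Measurable[sigmaInf Λ] fun ω => Z (ω, ∞)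

/-- `F^Λ_S := σ(Z_S : Z a Λ-measurable process on [0,∞])`. -/
def sigmaAtTime (Λ : MeasurableSpace (Ω × ℝ≥0)) (S : Ω → ℝ≥0∞) : MeasurableSpace Ω :=
  genBy {f : Ω → ℝ | ∃ Z : Ω × ℝ≥0∞ → ℝ, MeasurableProcessE Λ Z ∧ f = fun ω => Z (ω, S ω)}

/-- `S_A`: equal to `S` on `A` and `∞` off `A`. -/
def restrictST (S : Ω → ℝ≥0∞) (A : Set Ω) : Ω → ℝ≥0∞ := fun ω => if ω ∈ A then S ω else ∞

/-- Evaluation of a process indexed by `[0,∞]` at a random time. -/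
def EvalAt (Z : Ω × ℝ≥0∞ → ℝ) (S : Ω → ℝ≥0∞) : Ω → ℝ := fun ω => Z (ω, S ω)

/-- Evaluation of a process indexed by `[0,∞)` at a (finite) random time. -/
def EvalAtF (Z : Ω × ℝ≥0 → ℝ) (S : Ω → ℝ≥0∞) : Ω → ℝ := fun ω => Z (ω, (S ω).toNNReal)

/-- Adaptedness of a process to a raw filtration. -/
def Adapted' (G : ℝ≥0 → MeasurableSpace Ω) (Z : Ω × ℝ≥0 → ℝ) : Prop :=
  ∀ t, Measurable[G t] fun ω => Z (ω, t)

/-- Predictable σ-field of a filtration: generated by continuous adapted processes. -/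
def predSF (G : ℝ≥0 → MeasurableSpace Ω) : MeasurableSpace (Ω × ℝ≥0) :=
  genBy {Z | (∀ ω, Continuous fun t => Z (ω, t)) ∧ Adapted' G Z}

/-- Optional σ-field of a filtration: generated by càdlàg adapted processes. -/
def optSF (G : ℝ≥0 → MeasurableSpace Ω) : MeasurableSpace (Ω × ℝ≥0) :=
  genBy {Z | (∀ ω, IsCadlag fun t => Z (ω, t)) ∧ Adapted' G Z}

/-- Classical stopping time of a raw filtration. -/
def IsStoppingTimeCl (G : ℝ≥0 → MeasurableSpace Ω) (T : Ω → ℝ≥0∞) : Prop :=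
  ∀ t : ℝ≥0, MeasurableSet[G t] {ω | T ω ≤ (t : ℝ≥0∞)}

/-- The right-continuous filtration `F^Λ_{t+}`. -/
def FplusLambda (Λ : MeasurableSpace (Ω × ℝ≥0)) (t : ℝ≥0) : MeasurableSpace Ω :=
  ⨅ (s : ℝ≥0) (_ : t < s), sigmaAt Λ s

/-- Two processes are indistinguishable. -/
def Indistinguishable {τ : Type*} [MeasurableSpace Ω] (P : Measure Ω)
    (X Y : Ω × τ → ℝ) : Prop :=
  P {ω | ∃ t, X (ω, t) ≠ Y (ω, t)} = 0

/-- `Λ` is `P`-complete: every product-measurable process indistinguishable from a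
`Λ`-measurable process is itself `Λ`-measurable. -/
def IsPCompleteM [mΩ : MeasurableSpace Ω] (P : Measure Ω)
    (Λ : MeasurableSpace (Ω × ℝ≥0)) : Prop :=
  ∀ Z Z' : Ω × ℝ≥0 → ℝ, Measurable Z → Measurable[Λ] Z' →
    Indistinguishable P Z Z' → Measurable[Λ] Z

/-- A raw filtration satisfies the usual conditions: monotone, sub-σ-fields of `mΩ`,
right-continuous and `P`-complete. -/
def UsualConditions [mΩ : MeasurableSpace Ω] (P : Measure Ω)
    (G : ℝ≥0 → MeasurableSpace Ω) : Prop :=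
  Monotone G ∧ (∀ t, G t ≤ mΩ) ∧
  (∀ t : ℝ≥0, G t = ⨅ (s : ℝ≥0) (_ : t < s), G s) ∧
  ∀ N : Set Ω, MeasurableSet N → P N = 0 → MeasurableSet[G 0] N

variable [mΩ : MeasurableSpace Ω]

/-- `Λ`-martingale (indexed by `[0,∞]`). -/
def IsMartingaleM (P : Measure Ω) (Λ : MeasurableSpace (Ω × ℝ≥0))
    (Z : Ω × ℝ≥0∞ → ℝ) : Prop :=
  MeasurableProcessE Λ Z ∧
  (∀ S, IsStoppingTimeM Λ S → Integrable (EvalAt Z S) P) ∧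
  ∀ S T : Ω → ℝ≥0∞, IsStoppingTimeM Λ S → IsStoppingTimeM Λ T → S ≤ T →
    EvalAt Z S =ᵐ[P] P[EvalAt Z T|sigmaAtTime Λ S]

/-- `Λ`-supermartingale (indexed by `[0,∞]`). -/
def IsSupermartingaleM (P : Measure Ω) (Λ : MeasurableSpace (Ω × ℝ≥0))
    (Z : Ω × ℝ≥0∞ → ℝ) : Prop :=
  MeasurableProcessE Λ Z ∧
  (∀ S, IsStoppingTimeM Λ S → Integrable (EvalAt Z S) P) ∧
  ∀ S T : Ω → ℝ≥0∞, IsStoppingTimeM Λ S → IsStoppingTimeM Λ T → S ≤ T →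
    P[EvalAt Z T|sigmaAtTime Λ S] ≤ᵐ[P] EvalAt Z S

/-- Class `(D^Λ)` for a process: uniform integrability of `{Z_T : T ∈ S^Λ}`. -/
def ClassD (P : Measure Ω) (Λ : MeasurableSpace (Ω × ℝ≥0)) (Z : Ω × ℝ≥0∞ → ℝ) : Prop :=
  UniformIntegrable (fun S : {S : Ω → ℝ≥0∞ // IsStoppingTimeM Λ S} => EvalAt Z S.1) 1 P

/-- Class `(D^Λ)` for a system. -/
def ClassDSys (P : Measure Ω) (Λ : MeasurableSpace (Ω × ℝ≥0))
    (ZS : (Ω → ℝ≥0∞) → Ω → ℝ) : Prop :=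
  UniformIntegrable (fun S : {S : Ω → ℝ≥0∞ // IsStoppingTimeM Λ S} => ZS S.1) 1 P

/-- `pY` is a `Λ`-projection of `Y` (processes indexed by `[0,∞]`). -/
def IsProjectionE (P : Measure Ω) (Λ : MeasurableSpace (Ω × ℝ≥0))
    (Y pY : Ω × ℝ≥0∞ → ℝ) : Prop :=
  MeasurableProcessE Λ pY ∧
  ∀ S, IsStoppingTimeM Λ S → (∀ ω, S ω < ∞) →
    EvalAt pY S =ᵐ[P] P[EvalAt Y S|sigmaAtTime Λ S]

/-- `pY` is a `Λ`-projection of `Y` (processes indexed by `[0,∞)`). -/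
def IsProjectionF (P : Measure Ω) (Λ : MeasurableSpace (Ω × ℝ≥0))
    (Y pY : Ω × ℝ≥0 → ℝ) : Prop :=
  Measurable[Λ] pY ∧
  ∀ S, IsStoppingTimeM Λ S → (∀ ω, S ω < ∞) →
    EvalAtF pY S =ᵐ[P] P[EvalAtF Y S|sigmaAtTime Λ S]

/-- Right-upper-semicontinuous envelope `Z^*` (with `Z^*_∞ := Z_∞`). -/
def rightLimsup (Z : Ω × ℝ≥0∞ → ℝ) (ω : Ω) (t : ℝ≥0∞) : ℝ :=
  if t = ∞ then Z (ω, ∞)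
  else limsup (fun s : ℝ≥0 => Z (ω, (s : ℝ≥0∞))) (𝓝[>] t.toNNReal)

/-- Right-lower-semicontinuous envelope `Z_*` (with `Z_{∞*} := Z_∞`). -/
def rightLiminf (Z : Ω × ℝ≥0∞ → ℝ) (ω : Ω) (t : ℝ≥0∞) : ℝ :=
  if t = ∞ then Z (ω, ∞)
  else liminf (fun s : ℝ≥0 => Z (ω, (s : ℝ≥0∞))) (𝓝[>] t.toNNReal)

/-- Left-upper-semicontinuous envelope `*Z` (with `*Z_0 := Z_0` and
`*Z_∞ := limsup_{t↑∞} Z_t`). -/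
def leftLimsup (Z : Ω × ℝ≥0∞ → ℝ) (ω : Ω) (t : ℝ≥0∞) : ℝ :=
  if t = 0 then Z (ω, 0)
  else if t = ∞ then limsup (fun s : ℝ≥0 => Z (ω, (s : ℝ≥0∞))) atTop
  else limsup (fun s : ℝ≥0 => Z (ω, (s : ℝ≥0∞))) (𝓝[<] t.toNNReal)

/-- Left-lower-semicontinuous envelope `_*Z`. -/
def leftLiminf (Z : Ω × ℝ≥0∞ → ℝ) (ω : Ω) (t : ℝ≥0∞) : ℝ :=
  if t = 0 then Z (ω, 0)
  else if t = ∞ then liminf (fun s : ℝ≥0 => Z (ω, (s : ℝ≥0∞))) atTop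
  else liminf (fun s : ℝ≥0 => Z (ω, (s : ℝ≥0∞))) (𝓝[<] t.toNNReal)

/-- `T` is `Λ`-accessible. -/
def IsAccessibleM [mΩ2 : MeasurableSpace Ω] (P : Measure Ω)
    (Λ : MeasurableSpace (Ω × ℝ≥0)) (T : Ω → ℝ≥0∞) : Prop :=
  ∃ Tn : ℕ → Ω → ℝ≥0∞, (∀ n, IsStoppingTimeM Λ (Tn n)) ∧
    P (⋃ n, {ω | Tn n ω = T ω ∧ T ω < ∞}) = P {ω | T ω < ∞}

/-- `T` is totally `Λ`-inaccessible. -/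
def IsTotallyInaccessibleM [mΩ2 : MeasurableSpace Ω] (P : Measure Ω)
    (Λ : MeasurableSpace (Ω × ℝ≥0)) (T : Ω → ℝ≥0∞) : Prop :=
  ∀ S, IsStoppingTimeM Λ S → P {ω | S ω = T ω ∧ T ω < ∞} = 0

/-- The σ-field `G_{T-}`: generated by `G_0` and the sets `A ∩ {t < T}`, `A ∈ G_t`. -/
def sigmaPre (G : ℝ≥0 → MeasurableSpace Ω) (T : Ω → ℝ≥0∞) : MeasurableSpace Ω :=
  MeasurableSpace.generateFrom
    ({A | MeasurableSet[G 0] A} ∪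
      {A | ∃ (t : ℝ≥0) (B : Set Ω), MeasurableSet[G t] B ∧ A = B ∩ {ω | (t : ℝ≥0∞) < T ω}})

/-- The σ-field `G_T` of a classical stopping time `T`. -/
def sigmaAtCl (G : ℝ≥0 → MeasurableSpace Ω) (T : Ω → ℝ≥0∞) : MeasurableSpace Ω :=
  MeasurableSpace.generateFrom
    {A | ∀ t : ℝ≥0, MeasurableSet[G t] (A ∩ {ω | T ω ≤ (t : ℝ≥0∞)})}

/-- A divided stopping time `σ = (T, W⁻, W, W⁺)`. -/
structure IsDividedST (Λ : MeasurableSpace (Ω × ℝ≥0)) (T : Ω → ℝ≥0∞)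
    (Wm W Wp : Set Ω) : Prop where
  stopping : IsStoppingTimeCl (FplusLambda Λ) T
  cover : Wm ∪ W ∪ Wp = Set.univ
  disj_mw : Wm ∩ W = ∅
  disj_mp : Wm ∩ Wp = ∅
  disj_wp : W ∩ Wp = ∅
  mem_m : MeasurableSet[sigmaPre (FplusLambda Λ) T] Wm
  m_pos : Wm ∩ {ω | T ω = 0} = ∅
  mem_w : MeasurableSet[sigmaAtTime Λ T] W
  mem_p : MeasurableSet[sigmaAtCl (FplusLambda Λ) T] Wp
  p_fin : Wp ∩ {ω | T ω = ∞} = ∅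
  pred_m : IsStoppingTimeM (predSF (FplusLambda Λ)) (restrictST T Wm)
  st_w : IsStoppingTimeM Λ (restrictST T W)

/-- The value `Z_σ` of a process at a divided stopping time. -/
def divEval (Z : Ω × ℝ≥0∞ → ℝ) (T : Ω → ℝ≥0∞) (Wm W Wp : Set Ω) : Ω → ℝ := fun ω =>
  if ω ∈ Wm then leftLimsup Z ω (T ω)
  else if ω ∈ W then Z (ω, T ω)
  else rightLimsup Z ω (T ω)

/-- `Zb` is the `Λ`-Snell envelope of the system `ZS`: a `Λ`-supermartingale which at
each `Λ`-stopping time `S` is (a version of) `ess sup_{T ∈ S^Λ, T ≥ S} E[Z(T) | F^Λ_S]`. -/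
def IsSnellSys (P : Measure Ω) (Λ : MeasurableSpace (Ω × ℝ≥0))
    (ZS : (Ω → ℝ≥0∞) → Ω → ℝ) (Zb : Ω × ℝ≥0∞ → ℝ) : Prop :=
  IsSupermartingaleM P Λ Zb ∧
  ∀ S, IsStoppingTimeM Λ S →
    (∀ T, IsStoppingTimeM Λ T → S ≤ T →
      P[ZS T|sigmaAtTime Λ S] ≤ᵐ[P] EvalAt Zb S) ∧
    ∀ U : Ω → ℝ,
      (∀ T, IsStoppingTimeM Λ T → S ≤ T → P[ZS T|sigmaAtTime Λ S] ≤ᵐ[P] U) →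
      EvalAt Zb S ≤ᵐ[P] U

/-- `Zb` is the `Λ`-Snell envelope of the process `Z`. -/
def IsSnellProc (P : Measure Ω) (Λ : MeasurableSpace (Ω × ℝ≥0))
    (Z Zb : Ω × ℝ≥0∞ → ℝ) : Prop :=
  IsSnellSys P Λ (fun S => EvalAt Z S) Zb

/-- An `S^Λ`-system. -/
def IsSystemM (P : Measure Ω) (Λ : MeasurableSpace (Ω × ℝ≥0))
    (ZS : (Ω → ℝ≥0∞) → Ω → ℝ) : Prop :=
  (∀ S T, IsStoppingTimeM Λ S → IsStoppingTimeM Λ T →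
    ∀ᵐ ω ∂P, S ω = T ω → ZS S ω = ZS T ω) ∧
  ∀ S, IsStoppingTimeM Λ S → Measurable[sigmaAtTime Λ S] (ZS S)

/-- An `S^Λ`-supermartingale system. -/
def IsSupermartingaleSystem (P : Measure Ω) (Λ : MeasurableSpace (Ω × ℝ≥0))
    (ZS : (Ω → ℝ≥0∞) → Ω → ℝ) : Prop :=
  IsSystemM P Λ ZS ∧ (∀ S, IsStoppingTimeM Λ S → Integrable (ZS S) P) ∧
  ∀ S T, IsStoppingTimeM Λ S → IsStoppingTimeM Λ T → S ≤ T →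
    P[ZS T|sigmaAtTime Λ S] ≤ᵐ[P] ZS S

/-- The process `Zb` aggregates the system `ZS`. -/
def Aggregates (P : Measure Ω) (Λ : MeasurableSpace (Ω × ℝ≥0))
    (Zb : Ω × ℝ≥0∞ → ℝ) (ZS : (Ω → ℝ≥0∞) → Ω → ℝ) : Prop :=
  ∀ S, IsStoppingTimeM Λ S → EvalAt Zb S =ᵐ[P] ZS S

/-- `pY` is the `F`-predictable projection of `Y` (with the convention `(^P Y)_∞ = 0`). -/
def IsPredProjE (P : Measure Ω) (G : ℝ≥0 → MeasurableSpace Ω)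
    (Y pY : Ω × ℝ≥0∞ → ℝ) : Prop :=
  MeasurableProcessE (predSF G) pY ∧ (∀ ω, pY (ω, ∞) = 0) ∧
  ∀ S, IsStoppingTimeM (predSF G) S → (∀ ω, S ω < ∞) →
    EvalAt pY S =ᵐ[P] P[EvalAt Y S|sigmaAtTime (predSF G) S]
section Helpers

set_option linter.unusedSectionVars false
variable {Λ : MeasurableSpace (Ω × ℝ≥0)}

theorem exists_compact_inner {X : Type*} [TopologicalSpace X] [PolishSpace X]
    [MeasurableSpace X] [BorelSpace X] (ν : Measure X) [IsFiniteMeasure ν]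
    (A : Set (X × ℝ≥0)) (hA : MeasurableSet A) (η : ℝ≥0∞) (hη : η ≠ 0) :
    ∃ K : Set (X × ℝ≥0), IsCompact K ∧ K ⊆ A ∧ ν (Prod.fst '' A) ≤ ν (Prod.fst '' K) + η := by
  rcases A.eq_empty_or_nonempty with rfl | hne
  · exact ⟨∅, isCompact_empty, subset_rfl, by simp⟩
  have hAn : AnalyticSet A := hA.analyticSet
  rw [AnalyticSet] at hAn
  rcases hAn with h | ⟨g, hg, hgA⟩
  · exact absurd h hne.ne_empty
  set h : (ℕ → ℕ) → X := fun x => (g x).1 with hh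
  have hc : Continuous h := continuous_fst.comp hg
  let C : ℕ → (ℕ → ℕ) → Set (ℕ → ℕ) := fun k n => {x | ∀ i < k, x i ≤ n i}
  let Q : ℕ → (ℕ → ℕ) → Prop := fun k n => ν (Prod.fst '' A) < ν (h '' C k n) + η
  have hA' : Prod.fst '' A = h '' univ := by
    rw [← hgA, image_univ, ← range_comp]; rfl
  have hQ0 : ∀ n, Q 0 n := by
    intro n
    have : C 0 n = univ := by ext x; simp [C]
    simp only [Q, this, hA']
    exact ENNReal.lt_add_right (measure_ne_top _ _) hη
  have hstep : ∀ k n, Q k n → ∃ m, Q (k+1) (Function.update n k m) := by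
    intro k n hq
    have hU : h '' C k n = ⋃ m, h '' C (k+1) (Function.update n k m) := by
      rw [← image_iUnion]
      congr 1
      ext x
      simp only [C, mem_ofPred_eq, mem_iUnion]
      constructor
      · intro hx
        refine ⟨x k, fun i hi => ?_⟩
        rcases Nat.lt_succ_iff_lt_or_eq.1 hi with h' | h'
        · rw [Function.update_of_ne h'.ne]; exact hx i h'
        · subst h'; simp
      · rintro ⟨m, hm⟩ i hi
        have := hm i (by omega)
        rwa [Function.update_of_ne hi.ne] at this
    have hmono : Monotone fun m => h '' C (k+1) (Function.update n k m) := by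
      intro m m' hmm
      apply image_mono
      intro x hx i hi
      refine (hx i hi).trans ?_
      by_cases hik : i = k
      · subst hik; simpa using hmm
      · simp [Function.update_of_ne hik]
    by_contra! hcon
    have : ν (h '' C k n) + η ≤ ν (Prod.fst '' A) := by
      rw [hU, hmono.measure_iUnion, ENNReal.iSup_add]
      exact iSup_le fun m => not_lt.1 (hcon m)
    exact absurd hq (not_lt.2 this)
  choose st hst using hstep
  let seq : ∀ k, {n : ℕ → ℕ // Q k n} := fun k => Nat.rec ⟨0, hQ0 0⟩
    (fun k p => ⟨Function.update p.1 k (st k p.1 p.2), hst k p.1 p.2⟩) k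
  let n : ℕ → ℕ := fun k => (seq (k+1)).1 k
  have hcoh : ∀ k i, i < k → (seq k).1 i = n i := by
    intro k
    induction k with
    | zero => intro i hi; omega
    | succ k ih =>
      intro i hi
      rcases Nat.lt_succ_iff_lt_or_eq.1 hi with h' | h'
      · rw [← ih i h']
        change Function.update (seq k).1 k _ i = _
        rw [Function.update_of_ne h'.ne]
      · subst h'; rfl
  have hQn : ∀ k, Q k n := by
    intro k
    have := (seq k).2
    have hCC : C k (seq k).1 = C k n := by
      ext x
      simp only [C, mem_ofPred_eq]
      refine forall₂_congr fun i hi => ?_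
      rw [hcoh k i hi]
    simpa only [Q, hCC] using this
  let Ci : Set (ℕ → ℕ) := univ.pi fun i => Iic (n i)
  have hCi : IsCompact Ci := isCompact_univ_pi fun i => (finite_Iic (n i)).isCompact
  refine ⟨g '' Ci, hCi.image hg, ?_, ?_⟩
  · rw [← hgA]; exact image_subset_range _ _
  have hK : Prod.fst '' (g '' Ci) = h '' Ci := by rw [image_image]
  rw [hK]
  have hopen : ∀ U, IsOpen U → h '' Ci ⊆ U → ∃ k, h '' C k n ⊆ U := by
    intro U hU hsub
    by_contra! hcon
    have : ∀ k, ∃ x ∈ C k n, h x ∉ U := by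
      intro k
      obtain ⟨y, ⟨x, hx, rfl⟩, hy⟩ := Set.not_subset.1 (hcon k)
      exact ⟨x, hx, hy⟩
    choose x hx hxU using this
    let y : ℕ → ℕ → ℕ := fun k i => min (x k i) (n i)
    have hy : ∀ k, y k ∈ Ci := fun k i _ => mem_Iic.2 (min_le_right _ _)
    obtain ⟨z, hz, φ, hφ, hlim⟩ := hCi.tendsto_subseq hy
    have hlim2 : Tendsto (x ∘ φ) atTop (𝓝 z) := by
      rw [tendsto_pi_nhds] at hlim ⊢
      intro i
      refine (hlim i).congr' ?_
      filter_upwards [eventually_gt_atTop i] with k hk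
      have : i < φ k := lt_of_lt_of_le hk (hφ.id_le k)
      simp only [Function.comp, y]
      exact min_eq_left (hx (φ k) i this)
    have h3 : Tendsto (fun k => h (x (φ k))) atTop (𝓝 (h z)) := (hc.tendsto z).comp hlim2
    have h4 := h3.eventually (hU.mem_nhds (hsub ⟨z, hz, rfl⟩))
    obtain ⟨k, hk⟩ := h4.exists
    exact hxU _ hk
  by_contra! hcon
  have hlt : ν (h '' Ci) + η < ν (Prod.fst '' A) := hcon
  obtain ⟨U, hUs, hUo, hUlt⟩ := (h '' Ci).exists_isOpen_lt_of_lt (μ := ν)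
    (ν (Prod.fst '' A) - η) (lt_tsub_iff_right.2 hlt)
  obtain ⟨k, hk⟩ := hopen U hUo hUs
  have h1 : ν (Prod.fst '' A) < ν U + η := lt_of_lt_of_le (hQn k) (by gcongr)
  have h2 := lt_tsub_iff_right.1 hUlt
  exact absurd h1 (not_lt.2 h2.le)

theorem exists_factor {Ω : Type*} (m : MeasurableSpace Ω) (A : Set (Ω × ℝ≥0))
    (hA : MeasurableSet[@Prod.instMeasurableSpace Ω ℝ≥0 m inferInstance] A) :
    ∃ (f : Ω → ℕ → ℕ) (A' : Set ((ℕ → ℕ) × ℝ≥0)), Measurable[m] f ∧ MeasurableSet A' ∧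
      A = {p | (f p.1, p.2) ∈ A'} := by
  have hgen : @Prod.instMeasurableSpace Ω ℝ≥0 m inferInstance
    = MeasurableSpace.generateFrom (image2 (· ×ˢ ·) {s : Set Ω | MeasurableSet s}
        {t : Set ℝ≥0 | MeasurableSet t}) := generateFrom_prod.symm
  rw [hgen] at hA
  induction A, hA using MeasurableSpace.generateFrom_induction with
  | hC t ht _ =>
    obtain ⟨E, hE, B, hB, rfl⟩ := ht
    refine ⟨fun ω _ => if ω ∈ E then 1 else 0, {x | x 0 = 1} ×ˢ B, ?_, ?_, ?_⟩
    · refine measurable_pi_lambda _ fun _ => ?_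
      exact Measurable.ite hE measurable_const measurable_const
    · refine MeasurableSet.prod ?_ hB
      exact measurableSet_eq_fun (measurable_pi_apply (0 : ℕ)) measurable_const
    · ext p; simp
  | empty => exact ⟨fun _ _ => 0, ∅, measurable_const, MeasurableSet.empty, by ext; simp⟩
  | compl t ht ih =>
    obtain ⟨f, A', hf, hA', rfl⟩ := ih
    exact ⟨f, A'ᶜ, hf, hA'.compl, by ext; simp⟩
  | iUnion s hs ih =>
    choose f A' hf hA' hs' using ih
    refine ⟨fun ω k => f k.unpair.1 ω k.unpair.2,
      ⋃ n, {p | ((fun j => p.1 (Nat.pair n j)), p.2) ∈ A' n}, ?_, ?_, ?_⟩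
    · refine measurable_pi_lambda _ fun k => ?_
      exact (measurable_pi_apply _).comp (hf _)
    · refine MeasurableSet.iUnion fun n => ?_
      have : Measurable fun p : (ℕ → ℕ) × ℝ≥0 => ((fun j => p.1 (Nat.pair n j)), p.2) := by
        refine Measurable.prodMk ?_ measurable_snd
        refine measurable_pi_lambda _ fun k => ?_
        exact (measurable_pi_apply _).comp measurable_fst
      exact this (hA' n)
    · ext p
      simp only [mem_iUnion, mem_ofPred_eq, Nat.unpair_pair]
      refine exists_congr fun n => ?_
      have := hs' n
      conv_lhs => rw [this]
      rfl

/-- Measurable selection. -/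
theorem exists_selection {Ω : Type*} (m : MeasurableSpace Ω) [mΩ : MeasurableSpace Ω]
    (P : Measure Ω) [IsFiniteMeasure P] (hm : m ≤ mΩ)
    (A : Set (Ω × ℝ≥0))
    (hA : MeasurableSet[@Prod.instMeasurableSpace Ω ℝ≥0 m inferInstance] A)
    (η : ℝ≥0∞) (hη : η ≠ 0) :
    ∃ (R : Ω → ℝ≥0) (E : Set Ω), Measurable[m] R ∧ MeasurableSet[m] E ∧
      (∀ ω ∈ E, (ω, R ω) ∈ A) ∧ P (Prod.fst '' A) ≤ P E + η := by
  obtain ⟨f, A', hf, hA', rfl⟩ := exists_factor m A hA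
  have hfm : Measurable f := hf.mono hm le_rfl
  obtain ⟨K, hK, hKA, hKm⟩ := exists_compact_inner (P.map f) A' hA' η hη
  have hproj : ∀ a : ℝ≥0, IsClosed (Prod.fst '' (K ∩ {p | p.2 ≤ a})) := fun a =>
    ((hK.inter_right (isClosed_le continuous_snd continuous_const)).image
      continuous_fst).isClosed
  have hKc : IsClosed (Prod.fst '' K) := (hK.image continuous_fst).isClosed
  let r : (ℕ → ℕ) → ℝ≥0 := fun x => sInf {t | (x, t) ∈ K}
  have hmem : ∀ x ∈ Prod.fst '' K, (x, r x) ∈ K := by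
    rintro x ⟨⟨x', t⟩, hxt, rfl⟩
    have hcl : IsClosed {t | (x', t) ∈ K} :=
      hK.isClosed.preimage (Continuous.prodMk_right x')
    exact hcl.csInf_mem ⟨t, hxt⟩ (OrderBot.bddBelow _)
  have hr : Measurable r := by
    refine measurable_of_Iic fun a => ?_
    have : r ⁻¹' Iic a = Prod.fst '' (K ∩ {p | p.2 ≤ a}) ∪ (Prod.fst '' K)ᶜ := by
      ext x
      simp only [mem_preimage, mem_Iic, mem_union, mem_compl_iff]
      constructor
      · intro h
        by_cases hx : x ∈ Prod.fst '' K
        · exact Or.inl ⟨(x, r x), ⟨hmem x hx, h⟩, rfl⟩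
        · exact Or.inr hx
      · rintro (⟨⟨x', t⟩, ⟨h1, h2⟩, rfl⟩ | h)
        · have h3 : sInf {t | (x', t) ∈ K} ≤ t :=
            csInf_le (OrderBot.bddBelow _) (show t ∈ {t | (x', t) ∈ K} from h1)
          exact h3.trans h2
        · have : {t | (x, t) ∈ K} = ∅ := by
            ext t; simp only [mem_ofPred_eq, mem_empty_iff_false, iff_false]
            exact fun ht => h ⟨_, ht, rfl⟩
          simp [r, this]
    rw [this]
    exact (hproj a).measurableSet.union hKc.measurableSet.compl
  refine ⟨fun ω => r (f ω), f ⁻¹' (Prod.fst '' K), hr.comp hf, hf hKc.measurableSet,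
    fun ω hω => hKA (hmem _ hω), ?_⟩
  have h1 : P (Prod.fst '' {p : Ω × ℝ≥0 | (f p.1, p.2) ∈ A'}) ≤ P.map f (Prod.fst '' A') := by
    have h2 : Prod.fst '' {p : Ω × ℝ≥0 | (f p.1, p.2) ∈ A'}
        ⊆ f ⁻¹' (toMeasurable (P.map f) (Prod.fst '' A')) := by
      rintro _ ⟨p, hp, rfl⟩
      exact subset_toMeasurable _ _ ⟨_, hp, rfl⟩
    refine (measure_mono h2).trans ?_
    rw [← Measure.map_apply hfm (measurableSet_toMeasurable _ _), measure_toMeasurable]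
  refine h1.trans (hKm.trans ?_)
  rw [Measure.map_apply hfm hKc.measurableSet]

/-- Measurable projection in a sub-sigma-field containing the null sets. -/
theorem measurableSet_proj {Ω : Type*} (m : MeasurableSpace Ω) [mΩ : MeasurableSpace Ω]
    (P : Measure Ω) [IsFiniteMeasure P] (hm : m ≤ mΩ)
    (hnull : ∀ N : Set Ω, P N = 0 → MeasurableSet[m] N) (A : Set (Ω × ℝ≥0))
    (hA : MeasurableSet[@Prod.instMeasurableSpace Ω ℝ≥0 m inferInstance] A) :
    MeasurableSet[m] (Prod.fst '' A) := by
  have hex := fun n : ℕ => exists_selection m P hm A hA ((n : ℝ≥0∞) + 1)⁻¹ (by simp)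
  choose R E hR hE hRE hP using hex
  have hsub : (⋃ n, E n) ⊆ Prod.fst '' A :=
    iUnion_subset fun n ω hω => ⟨_, hRE n ω hω, rfl⟩
  have hEm : MeasurableSet[m] (⋃ n, E n) := MeasurableSet.iUnion hE
  have hle : P (Prod.fst '' A) ≤ P (⋃ n, E n) := by
    refine ENNReal.le_of_forall_pos_le_add fun ε hε _ => ?_
    obtain ⟨n, hn⟩ := ENNReal.exists_inv_nat_lt (ENNReal.coe_pos.2 hε).ne'
    refine (hP n).trans ?_
    refine add_le_add (measure_mono (subset_iUnion _ n)) (le_trans ?_ hn.le)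
    exact ENNReal.inv_le_inv.2 le_self_add
  have h0 : P (Prod.fst '' A \ ⋃ n, E n) = 0 := by
    rw [measure_sdiff hsub (hm _ hEm).nullMeasurableSet (measure_ne_top _ _)]
    exact tsub_eq_zero_of_le hle
  have := hEm.union (hnull _ h0)
  rwa [union_sdiff_cancel hsub] at this

/-- Inner approximation in sigma-fields generated by real functions. -/
theorem inner_approx {α : Type*} (𝒢 : Set (α → ℝ)) (𝒦 : Set (Set α))
    (hUn : ∀ A ∈ 𝒦, ∀ B ∈ 𝒦, A ∪ B ∈ 𝒦) (hIn : ∀ A : ℕ → Set α, (∀ n, A n ∈ 𝒦) → ⋂ n, A n ∈ 𝒦)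
    (hcl : ∀ f ∈ 𝒢, ∀ F : Set ℝ, IsClosed F → f ⁻¹' F ∈ 𝒦)
    (hne : ∅ ∈ 𝒦) (huniv : univ ∈ 𝒦)
    (P : Measure Ω) [IsFiniteMeasure P] (φ : Ω → α)
    (hφ : ∀ f ∈ 𝒢, Measurable (fun ω => f (φ ω))) (hK : ∀ A ∈ 𝒦, MeasurableSet[genBy 𝒢] A)
    (B : Set α) (hB : MeasurableSet[genBy 𝒢] B) :
    ∀ η : ℝ≥0∞, η ≠ 0 → ∃ C ∈ 𝒦, C ⊆ B ∧ P (φ ⁻¹' (B \ C)) ≤ η := by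
  have hφm : @Measurable _ _ mΩ (genBy 𝒢) φ := by
    rw [measurable_iff_comap_le, genBy]
    simp only [MeasurableSpace.comap_iSup, MeasurableSpace.comap_comp, iSup_le_iff]
    intro f hf
    exact (hφ f hf).comap_le
  have hgen : genBy 𝒢 = MeasurableSpace.generateFrom
      {S | ∃ f ∈ 𝒢, ∃ F : Set ℝ, IsClosed F ∧ S = f ⁻¹' F} := by
    apply le_antisymm
    · refine iSup₂_le fun f hf => ?_
      rw [← measurable_iff_comap_le]
      refine @measurable_of_isClosed _ _ _ _ _ (_) _ fun F hF => ?_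
      exact MeasurableSpace.measurableSet_generateFrom ⟨f, hf, F, hF, rfl⟩
    · refine MeasurableSpace.generateFrom_le ?_
      rintro _ ⟨f, hf, F, hF, rfl⟩
      exact hK _ (hcl f hf F hF)
  have hfin : ∀ (A : ℕ → Set α), (∀ n, A n ∈ 𝒦) → ∀ N, ⋃ i < N, A i ∈ 𝒦 := by
    intro A hA N
    induction N with
    | zero => simpa using hne
    | succ N ih => rw [biUnion_lt_succ]; exact hUn _ ih _ (hA N)
  -- increasing unions
  have hlim : ∀ (U : Set α) (D : ℕ → Set α), (∀ n, D n ∈ 𝒦) → MeasurableSet[genBy 𝒢] U →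
      (⋃ n, D n) ⊆ U → ∀ δ η : ℝ≥0∞, η ≠ 0 → P (φ ⁻¹' (U \ ⋃ n, D n)) ≤ δ →
      ∃ C ∈ 𝒦, C ⊆ U ∧ P (φ ⁻¹' (U \ C)) ≤ δ + η := by
    intro U D hD hU hsub δ η hη hδ
    have hmeas : ∀ N, MeasurableSet[genBy 𝒢] (⋃ i < N, D i) := fun N => hK _ (hfin D hD N)
    have hant : Antitone fun N => φ ⁻¹' ((⋃ n, D n) \ ⋃ i < N, D i) := by
      intro N N' h
      refine preimage_mono (sdiff_subset_sdiff_right ?_)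
      exact biUnion_subset_biUnion_left fun i hi => lt_of_lt_of_le hi h
    have hD' : MeasurableSet[genBy 𝒢] (⋃ n, D n) := MeasurableSet.iUnion fun n => hK _ (hD n)
    have hemp : ⋂ N, φ ⁻¹' ((⋃ n, D n) \ ⋃ i < N, D i) = ∅ := by
      ext ω
      simp only [mem_iInter, mem_preimage, Set.mem_sdiff, mem_iUnion, mem_empty_iff_false, iff_false]
      intro h
      obtain ⟨n, hn⟩ := (h 0).1
      exact (h (n+1)).2 ⟨n, by omega, hn⟩
    have ht := tendsto_measure_iInter_atTop (μ := P)
      (fun N => (hφm (hD'.diff (hmeas N))).nullMeasurableSet) hant ⟨0, measure_ne_top _ _⟩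
    rw [hemp, measure_empty] at ht
    obtain ⟨N, hN⟩ := (ht.eventually_le_const (pos_iff_ne_zero.2 hη)).exists
    refine ⟨_, hfin D hD N, (iUnion₂_subset fun i _ => subset_iUnion D i).trans hsub, ?_⟩
    calc P (φ ⁻¹' (U \ ⋃ i < N, D i))
        ≤ P (φ ⁻¹' (U \ ⋃ n, D n) ∪ φ ⁻¹' ((⋃ n, D n) \ ⋃ i < N, D i)) := by
          apply measure_mono
          rw [← preimage_union]
          apply preimage_mono
          intro x hx
          by_cases h : x ∈ ⋃ n, D n
          · exact Or.inr ⟨h, hx.2⟩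
          · exact Or.inl ⟨hx.1, h⟩
      _ ≤ _ := (measure_union_le _ _).trans (add_le_add hδ hN)
  have hBg : MeasurableSet[genBy 𝒢] B := hB
  suffices H : (∀ η : ℝ≥0∞, η ≠ 0 → ∃ C ∈ 𝒦, C ⊆ B ∧ P (φ ⁻¹' (B \ C)) ≤ η) ∧
      (∀ η : ℝ≥0∞, η ≠ 0 → ∃ C ∈ 𝒦, C ⊆ Bᶜ ∧ P (φ ⁻¹' (Bᶜ \ C)) ≤ η) from H.1
  have hB2 : MeasurableSet[MeasurableSpace.generateFrom
      {S | ∃ f ∈ 𝒢, ∃ F : Set ℝ, IsClosed F ∧ S = f ⁻¹' F}] B := hgen ▸ hB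
  clear hB hBg
  induction B, hB2 using MeasurableSpace.generateFrom_induction with
  | hC t ht _ =>
    obtain ⟨f, hf, F, hF, rfl⟩ := ht
    refine ⟨fun η _ => ⟨_, hcl f hf F hF, subset_rfl, by simp⟩, fun η hη => ?_⟩
    obtain ⟨G, hGc, _, hGu, _⟩ := hF.isOpen_compl.exists_iUnion_isClosed
    have hU : (⋃ n, f ⁻¹' G n) = (f ⁻¹' F)ᶜ := by rw [← preimage_iUnion, hGu]; rfl
    obtain ⟨C, hC, hCs, hCP⟩ := hlim (f ⁻¹' F)ᶜ (fun n => f ⁻¹' G n)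
      (fun n => hcl f hf _ (hGc n)) (hK _ (hcl f hf F hF)).compl hU.subset 0 η hη
      (by rw [hU]; simp)
    exact ⟨C, hC, hCs, by simpa using hCP⟩
  | empty =>
    refine ⟨fun η _ => ⟨∅, hne, subset_rfl, by simp⟩, fun η hη => ?_⟩
    exact ⟨univ, huniv, by simp, by simp⟩
  | compl t ht ih => exact ⟨ih.2, by rw [compl_compl]; exact ih.1⟩
  | iUnion s hs ih =>
    refine ⟨fun η hη => ?_, fun η hη => ?_⟩
    · obtain ⟨δ, hδ, hδs⟩ := ENNReal.exists_pos_sum_of_countable (ENNReal.half_pos hη).ne' ℕ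
      choose C hC hCs hCP using fun n => (ih n).1 (δ n) (by simpa using (hδ n).ne')
      obtain ⟨C', hC', hCs', hCP'⟩ := hlim (⋃ n, s n) C hC
        (MeasurableSet.iUnion fun n => hgen ▸ hs n)
        (iUnion_mono hCs) (η/2) (η/2) (ENNReal.half_pos hη).ne' (by
          refine le_trans ?_ hδs.le
          calc P (φ ⁻¹' ((⋃ n, s n) \ ⋃ n, C n)) ≤ P (⋃ n, φ ⁻¹' (s n \ C n)) := by
                apply measure_mono
                rintro ω ⟨h1, h2⟩
                obtain ⟨n, hn⟩ := mem_iUnion.1 h1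
                exact mem_iUnion.2 ⟨n, hn, fun h => h2 (mem_iUnion.2 ⟨n, h⟩)⟩
            _ ≤ ∑' n, P (φ ⁻¹' (s n \ C n)) := measure_iUnion_le _
            _ ≤ _ := ENNReal.tsum_le_tsum hCP)
      exact ⟨C', hC', hCs', by rwa [ENNReal.add_halves] at hCP'⟩
    · obtain ⟨δ, hδ, hδs⟩ := ENNReal.exists_pos_sum_of_countable hη ℕ
      choose C hC hCs hCP using fun n => (ih n).2 (δ n) (by simpa using (hδ n).ne')
      refine ⟨⋂ n, C n, hIn C hC, ?_, ?_⟩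
      · rw [compl_iUnion]; exact iInter_mono hCs
      · refine le_trans ?_ hδs.le
        calc P (φ ⁻¹' ((⋃ n, s n)ᶜ \ ⋂ n, C n)) ≤ P (⋃ n, φ ⁻¹' ((s n)ᶜ \ C n)) := by
                apply measure_mono
                rintro ω ⟨h1, h2⟩
                obtain ⟨n, hn⟩ := not_forall.1 (fun h => h2 (mem_iInter.2 h))
                exact mem_iUnion.2 ⟨n, fun h => h1 (mem_iUnion.2 ⟨n, h⟩), hn⟩
            _ ≤ ∑' n, P (φ ⁻¹' ((s n)ᶜ \ C n)) := measure_iUnion_le _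
            _ ≤ _ := ENNReal.tsum_le_tsum hCP

theorem measurable_genBy {α : Type*} {C : Set (α → ℝ)} {f : α → ℝ} (hf : f ∈ C) :
    Measurable[genBy C] f := by
  rw [measurable_iff_comap_le]
  exact le_iSup₂ (f := fun f (_ : f ∈ C) => MeasurableSpace.comap f inferInstance) f hf

theorem genBy_le {α : Type*} {C : Set (α → ℝ)} {m : MeasurableSpace α}
    (h : ∀ f ∈ C, Measurable[m] f) : genBy C ≤ m :=
  iSup₂_le fun f hf => (h f hf).comap_le

theorem exists_dense_btwn {a b : ℝ≥0∞} (h : a < b) :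
    ∃ n, a < (TopologicalSpace.denseSeq ℝ≥0 n : ℝ≥0∞) ∧
      (TopologicalSpace.denseSeq ℝ≥0 n : ℝ≥0∞) < b := by
  obtain ⟨r, hr1, hr2⟩ := ENNReal.lt_iff_exists_nnreal_btwn.1 h
  obtain ⟨r₁, hra, hrb⟩ := ENNReal.lt_iff_exists_nnreal_btwn.1 hr2
  rw [ENNReal.coe_lt_coe] at hra
  obtain ⟨n, hn⟩ := (TopologicalSpace.denseRange_denseSeq ℝ≥0).exists_mem_open isOpen_Ioo
    (nonempty_Ioo.2 hra)
  exact ⟨n, hr1.trans (ENNReal.coe_lt_coe.2 hn.1), (ENNReal.coe_lt_coe.2 hn.2).trans hrb⟩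

/-- The dense sequence. -/
abbrev dq (n : ℕ) : ℝ≥0 := TopologicalSpace.denseSeq ℝ≥0 n

/-- Standing assumptions. -/
structure Good (Λ : MeasurableSpace (Ω × ℝ≥0)) : Prop where
  meyer : IsMeyer mΩ Λ

/-- Optional-type times: open stochastic interval in the field. -/
def OT (Λ : MeasurableSpace (Ω × ℝ≥0)) (D : Ω → ℝ≥0∞) : Prop :=
  MeasurableSet[Λ] {p : Ω × ℝ≥0 | D p.1 < (p.2 : ℝ≥0∞)}

theorem prog_aux {Ω : Type*} [m : MeasurableSpace Ω] (C : Set (Ω × ℝ≥0 → ℝ)) (q : ℝ≥0)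
    (hC : ∀ f ∈ C, ∀ ω, IsCadlag fun t => f (ω, t))
    (hm : ∀ f ∈ C, ∀ s ≤ q, Measurable fun ω => f (ω, s)) {B : Set (Ω × ℝ≥0)}
    (hB : MeasurableSet[genBy C] B) : MeasurableSet (B ∩ {p | p.2 < q}) := by
  let I : Set (Ω × ℝ≥0) := {p | p.2 < q}
  have hI : MeasurableSet I := measurable_snd measurableSet_Iio
  have hval : @Measurable _ _ _ (genBy C) (Subtype.val : I → Ω × ℝ≥0) := by
    rw [measurable_iff_comap_le, genBy]
    simp only [MeasurableSpace.comap_iSup, MeasurableSpace.comap_comp, iSup_le_iff]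
    intro f hf
    rw [← measurable_iff_comap_le]
    let g : ℕ → Ω × ℝ≥0 → ℝ := fun n p => f (p.1, min (((⌊(n+1) * p.2⌋₊ : ℝ≥0) + 1) / (n+1)) q)
    have hg : ∀ n, Measurable (g n) := by
      intro n
      have h1 : Measurable (fun x : Ω × ℕ => f (x.1, min (((x.2 : ℝ≥0) + 1) / (n+1)) q)) := by
        refine measurable_from_prod_countable_left fun k => ?_
        exact hm f hf (min (((k : ℝ≥0) + 1) / (n+1)) q) (min_le_right _ _)
      have h2 : Measurable (fun p : Ω × ℝ≥0 => (p.1, ⌊((n:ℝ≥0)+1) * p.2⌋₊)) :=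
        measurable_fst.prodMk (Nat.measurable_floor.comp (measurable_const.mul measurable_snd))
      exact h1.comp h2
    refine measurable_of_tendsto_metrizable (f := fun n (p : I) => g n p.1)
      (fun n => (hg n).comp measurable_subtype_coe) ?_
    rw [tendsto_pi_nhds]
    rintro ⟨⟨ω, s⟩, hs⟩
    have hs : s < q := hs
    have h3 := (hC f hf ω).1 s
    have h4 : Tendsto (fun n : ℕ => min (((⌊((n:ℝ≥0)+1) * s⌋₊ : ℝ≥0) + 1) / (n+1)) q) atTop
        (𝓝[≥] s) := by
      have hlow : ∀ n : ℕ, s ≤ ((⌊((n:ℝ≥0)+1) * s⌋₊ : ℝ≥0) + 1) / (n+1) := by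
        intro n
        rw [le_div_iff₀ (by positivity), mul_comm]
        exact (Nat.lt_floor_add_one _).le
      have hup : ∀ n : ℕ, ((⌊((n:ℝ≥0)+1) * s⌋₊ : ℝ≥0) + 1) / (n+1) ≤ s + 1 / (n+1) := by
        intro n
        have h0 : (0:ℝ≥0) < (n:ℝ≥0) + 1 := by positivity
        have e : (s + 1 / ((n:ℝ≥0)+1)) * ((n:ℝ≥0)+1) = ((n:ℝ≥0)+1) * s + 1 := by
          field_simp
        rw [div_le_iff₀ h0, e]
        gcongr
        exact Nat.floor_le (by positivity)
      refine tendsto_nhdsWithin_iff.2 ⟨?_, Eventually.of_forall fun n => le_min (hlow n) hs.le⟩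
      refine tendsto_of_tendsto_of_tendsto_of_le_of_le tendsto_const_nhds
        (h := fun n : ℕ => s + 1 / ((n:ℝ≥0)+1)) ?_ (fun n => le_min (hlow n) hs.le)
        (fun n => (min_le_left _ _).trans (hup n))
      simpa using tendsto_const_nhds.add (tendsto_one_div_add_atTop_nhds_zero_nat (𝕜 := ℝ≥0))
    exact h3.comp h4
  have := hI.subtype_image (hval hB)
  convert this using 1
  ext p
  simp [I, and_comm]


theorem meas_indicator {α : Type*} {m : MeasurableSpace α} {B : Set α} (hB : MeasurableSet[m] B) :
    Measurable[m] (B.indicator (fun _ => (1:ℝ))) :=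
  measurable_const.indicator hB

theorem Good.stop_set (h : Good Λ) {B : Set (Ω × ℝ≥0)} (hB : MeasurableSet[Λ] B) (s : ℝ≥0) :
    MeasurableSet[Λ] {p : Ω × ℝ≥0 | (p.1, min p.2 s) ∈ B} := by
  have h1 := h.meyer.stop_stable _ (meas_indicator hB) s
  have h2 := h1 (measurableSet_singleton (1:ℝ))
  convert h2 using 1
  ext p
  simp [indicator]

theorem Good.univ_prod (h : Good Λ) {B : Set ℝ≥0} (hB : MeasurableSet B) :
    MeasurableSet[Λ] {p : Ω × ℝ≥0 | p.2 ∈ B} := by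
  have := h.meyer.contains_borel B hB
  convert this using 1
  ext p; simp

theorem sigmaAt_eq_comap (q : ℝ≥0) :
    sigmaAt Λ q = MeasurableSpace.comap (fun ω => (ω, q)) Λ := by
  apply le_antisymm
  · refine genBy_le ?_
    rintro _ ⟨Z, hZ, rfl⟩
    exact hZ.comp (comap_measurable _)
  · rintro _ ⟨B, hB, rfl⟩
    have h1 : Measurable[sigmaAt Λ q] fun ω => (B.indicator (fun _ => (1:ℝ))) (ω, q) :=
      measurable_genBy ⟨_, meas_indicator hB, rfl⟩
    have h2 := h1 (measurableSet_singleton (1:ℝ))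
    convert h2 using 1
    ext p
    simp [indicator]

theorem sigmaAt_of_sec {B : Set (Ω × ℝ≥0)} (hB : MeasurableSet[Λ] B) (q : ℝ≥0) :
    MeasurableSet[sigmaAt Λ q] {ω | (ω, q) ∈ B} := by
  rw [sigmaAt_eq_comap]
  exact ⟨B, hB, rfl⟩

theorem Good.sigmaAt_iff (h : Good Λ) {q : ℝ≥0} {A : Set Ω} :
    MeasurableSet[sigmaAt Λ q] A ↔ MeasurableSet[Λ] {p : Ω × ℝ≥0 | p.1 ∈ A ∧ q ≤ p.2} := by
  constructor
  · intro hA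
    rw [sigmaAt_eq_comap] at hA
    obtain ⟨B, hB, rfl⟩ := hA
    convert (h.stop_set hB q).inter (h.univ_prod (measurableSet_Ici (a := q))) using 1
    ext p
    simp only [mem_preimage, mem_ofPred_eq, mem_inter_iff, mem_Ici]
    constructor
    · rintro ⟨h1, h2⟩; simpa [h2] using h1
    · rintro ⟨h1, h2⟩; simpa [h2] using h1
  · intro hA
    have := sigmaAt_of_sec hA q
    simpa using this

theorem Good.sigmaAt_mono (h : Good Λ) {q r : ℝ≥0} (hqr : q ≤ r) :
    sigmaAt Λ q ≤ sigmaAt Λ r := by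
  intro A hA
  rw [h.sigmaAt_iff] at hA ⊢
  convert hA.inter (h.univ_prod (measurableSet_Ici (a := r))) using 1
  ext p
  simp only [mem_ofPred_eq, mem_inter_iff, mem_Ici]
  constructor
  · rintro ⟨h1, h2⟩; exact ⟨⟨h1, hqr.trans h2⟩, h2⟩
  · rintro ⟨h1, h2⟩; exact ⟨h1.1, h2⟩

theorem Good.sigmaAt_le (h : Good Λ) (q : ℝ≥0) : sigmaAt Λ q ≤ mΩ := by
  rw [sigmaAt_eq_comap, ← measurable_iff_comap_le]
  exact (measurable_id.prodMk measurable_const).mono le_rfl h.meyer.le_prod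

theorem Good.of_fplus (h : Good Λ) {q : ℝ≥0} {A : Set Ω}
    (hA : ∀ s, q < s → MeasurableSet[sigmaAt Λ s] A) :
    MeasurableSet[Λ] {p : Ω × ℝ≥0 | p.1 ∈ A ∧ q < p.2} := by
  have : {p : Ω × ℝ≥0 | p.1 ∈ A ∧ q < p.2} =
      ⋃ n, {p : Ω × ℝ≥0 | q < dq n ∧ p.1 ∈ A ∧ dq n ≤ p.2} := by
    ext p
    simp only [mem_ofPred_eq, mem_iUnion]
    constructor
    · rintro ⟨h1, h2⟩
      obtain ⟨n, hn1, hn2⟩ := exists_dense_btwn (ENNReal.coe_lt_coe.2 h2)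
      exact ⟨n, ENNReal.coe_lt_coe.1 hn1, h1, (ENNReal.coe_lt_coe.1 hn2).le⟩
    · rintro ⟨n, h1, h2, h3⟩
      exact ⟨h2, h1.trans_le h3⟩
  rw [this]
  refine MeasurableSet.iUnion fun n => ?_
  by_cases hn : q < dq n
  · simpa [hn] using h.sigmaAt_iff.1 (hA _ hn)
  · simp [hn]

theorem measurableSet_fplus {q : ℝ≥0} {A : Set Ω} :
    MeasurableSet[FplusLambda Λ q] A ↔ ∀ s, q < s → MeasurableSet[sigmaAt Λ s] A := by
  unfold FplusLambda
  rw [MeasurableSpace.measurableSet_iInf]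
  simp only [MeasurableSpace.measurableSet_iInf]

theorem Good.gen (h : Good Λ) : ∃ C : Set (Ω × ℝ≥0 → ℝ),
    (∀ Z ∈ C, (∀ ω, IsCadlag fun t => Z (ω, t)) ∧ Measurable[Λ] Z) ∧ Λ = genBy C := by
  obtain ⟨C, hC, hCΛ⟩ := h.meyer.gen_cadlag
  refine ⟨C, fun Z hZ => ⟨hC Z hZ, ?_⟩, hCΛ⟩
  rw [hCΛ]
  exact measurable_genBy hZ

theorem Good.progressive (h : Good Λ) {B : Set (Ω × ℝ≥0)} (hB : MeasurableSet[Λ] B) (q : ℝ≥0) :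
    MeasurableSet[@Prod.instMeasurableSpace Ω ℝ≥0 (sigmaAt Λ q) inferInstance]
      (B ∩ {p | p.2 < q}) := by
  obtain ⟨C, hC, hCΛ⟩ := h.gen
  refine @prog_aux Ω (sigmaAt Λ q) C q (fun f hf => (hC f hf).1) (fun f hf s hs => ?_) B
    (hCΛ ▸ hB)
  have : Measurable[sigmaAt Λ s] fun ω => f (ω, s) := measurable_genBy ⟨f, (hC f hf).2, rfl⟩
  exact this.mono (h.sigmaAt_mono hs) le_rfl

/-- Projection hulls in a sub-sigma-field. -/
theorem exists_hull {Ω : Type*} (m : MeasurableSpace Ω) [mΩ : MeasurableSpace Ω]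
    (P : Measure Ω) [IsFiniteMeasure P] (hm : m ≤ mΩ) (A : Set (Ω × ℝ≥0))
    (hA : MeasurableSet[@Prod.instMeasurableSpace Ω ℝ≥0 m inferInstance] A) :
    ∃ E A' : Set Ω, MeasurableSet[m] E ∧ MeasurableSet[m] A' ∧ E ⊆ Prod.fst '' A ∧
      Prod.fst '' A ⊆ A' ∧ P (A' \ E) = 0 := by
  have hex := fun n : ℕ => @exists_selection Ω m m (P.trim hm) _ le_rfl A hA
    ((n : ℝ≥0∞) + 1)⁻¹ (by simp)
  choose R E hR hE hRE hP using hex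
  have hsub : (⋃ n, E n) ⊆ Prod.fst '' A :=
    iUnion_subset fun n ω hω => ⟨_, hRE n ω hω, rfl⟩
  have hEm : MeasurableSet[m] (⋃ n, E n) := MeasurableSet.iUnion hE
  have hAm : MeasurableSet[m] (@toMeasurable Ω m (P.trim hm) (Prod.fst '' A)) :=
    @measurableSet_toMeasurable Ω m _ _
  have hle : P.trim hm (Prod.fst '' A) ≤ P.trim hm (⋃ n, E n) := by
    refine ENNReal.le_of_forall_pos_le_add fun ε hε _ => ?_
    obtain ⟨n, hn⟩ := ENNReal.exists_inv_nat_lt (ENNReal.coe_pos.2 hε).ne'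
    refine (hP n).trans ?_
    refine add_le_add (measure_mono (subset_iUnion _ n)) (le_trans ?_ hn.le)
    exact ENNReal.inv_le_inv.2 le_self_add
  have hs2 : Prod.fst '' A ⊆ (@toMeasurable Ω m (P.trim hm) (Prod.fst '' A)) :=
    @subset_toMeasurable Ω m _ _
  refine ⟨_, _, hEm, hAm, hsub, hs2, ?_⟩
  rw [← trim_measurableSet_eq hm (hAm.diff hEm)]
  rw [@measure_sdiff Ω m _ _ _ (hsub.trans hs2) (@MeasurableSet.nullMeasurableSet Ω m _ _ hEm)
    (measure_ne_top _ _)]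
  rw [@measure_toMeasurable Ω m]
  exact tsub_eq_zero_of_le hle

theorem Good.OT_lt (h : Good Λ) {D : Ω → ℝ≥0∞} (hD : OT Λ D) {a q : ℝ≥0} (haq : a ≤ q) :
    MeasurableSet[sigmaAt Λ q] {ω | D ω < a} :=
  h.sigmaAt_mono haq _ (sigmaAt_of_sec hD a)

theorem Good.ST_le (h : Good Λ) {D : Ω → ℝ≥0∞} (hD : IsStoppingTimeM Λ D) {a q : ℝ≥0}
    (haq : a ≤ q) : MeasurableSet[sigmaAt Λ q] {ω | D ω ≤ a} :=
  h.sigmaAt_mono haq _ (sigmaAt_of_sec hD a)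

theorem Good.after_of_lt (h : Good Λ) {D : Ω → ℝ≥0∞} {A : Set Ω}
    (hD : ∀ q : ℝ≥0, MeasurableSet[sigmaAt Λ q] {ω | ω ∈ A ∧ D ω < q}) :
    MeasurableSet[Λ] {p : Ω × ℝ≥0 | p.1 ∈ A ∧ D p.1 < p.2} := by
  have : {p : Ω × ℝ≥0 | p.1 ∈ A ∧ D p.1 < p.2} =
      ⋃ n, {p : Ω × ℝ≥0 | p.1 ∈ {ω | ω ∈ A ∧ D ω < dq n} ∧ dq n ≤ p.2} := by
    ext p
    simp only [mem_ofPred_eq, mem_iUnion]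
    constructor
    · rintro ⟨h1, h2⟩
      obtain ⟨n, hn1, hn2⟩ := exists_dense_btwn h2
      exact ⟨n, ⟨h1, hn1⟩, (ENNReal.coe_lt_coe.1 hn2).le⟩
    · rintro ⟨n, ⟨h1, h2⟩, h3⟩
      exact ⟨h1, h2.trans_le (ENNReal.coe_le_coe.2 h3)⟩
  rw [this]
  exact MeasurableSet.iUnion fun n => h.sigmaAt_iff.1 (hD _)

theorem Good.OT_of_lt (h : Good Λ) {D : Ω → ℝ≥0∞}
    (hD : ∀ q : ℝ≥0, MeasurableSet[sigmaAt Λ q] {ω | D ω < q}) : OT Λ D := by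
  have := h.after_of_lt (D := D) (A := univ) (by simpa using hD)
  simpa [OT] using this

theorem Good.OT_of_ST (h : Good Λ) {D : Ω → ℝ≥0∞} (hD : IsStoppingTimeM Λ D) : OT Λ D := by
  refine h.OT_of_lt fun q => ?_
  have : {ω | D ω < q} = ⋃ n, {ω | dq n < q ∧ D ω ≤ dq n} := by
    ext ω
    simp only [mem_ofPred_eq, mem_iUnion]
    constructor
    · intro h1
      obtain ⟨n, hn1, hn2⟩ := exists_dense_btwn h1
      exact ⟨n, ENNReal.coe_lt_coe.1 hn2, hn1.le⟩
    · rintro ⟨n, h1, h2⟩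
      exact h2.trans_lt (ENNReal.coe_lt_coe.2 h1)
  rw [this]
  refine MeasurableSet.iUnion fun n => ?_
  by_cases hn : dq n < q
  · simpa [hn] using h.ST_le hD hn.le
  · simp [hn]

theorem Good.OT_meas (h : Good Λ) {D : Ω → ℝ≥0∞} (hD : OT Λ D) : Measurable D := by
  refine measurable_of_Iio fun a => ?_
  have : D ⁻¹' Iio a = ⋃ n, {ω | (dq n : ℝ≥0∞) < a ∧ D ω < dq n} := by
    ext ω
    simp only [mem_ofPred_eq, mem_iUnion, mem_preimage, mem_Iio]
    constructor
    · intro h1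
      obtain ⟨n, hn1, hn2⟩ := exists_dense_btwn h1
      exact ⟨n, hn2, hn1⟩
    · rintro ⟨n, h1, h2⟩
      exact h2.trans h1
  rw [this]
  refine MeasurableSet.iUnion fun n => ?_
  exact (MeasurableSet.const _).inter (h.sigmaAt_le _ _ (h.OT_lt hD le_rfl))

theorem Good.OT_iff_cl (h : Good Λ) {D : Ω → ℝ≥0∞} :
    IsStoppingTimeCl (FplusLambda Λ) D ↔ OT Λ D := by
  constructor
  · intro hD
    refine h.OT_of_lt fun q => ?_
    have : {ω | D ω < q} = ⋃ n, {ω | dq n < q ∧ D ω ≤ dq n} := by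
      ext ω
      simp only [mem_ofPred_eq, mem_iUnion]
      constructor
      · intro h1
        obtain ⟨n, hn1, hn2⟩ := exists_dense_btwn h1
        exact ⟨n, ENNReal.coe_lt_coe.1 hn2, hn1.le⟩
      · rintro ⟨n, h1, h2⟩
        exact h2.trans_lt (ENNReal.coe_lt_coe.2 h1)
    rw [this]
    refine MeasurableSet.iUnion fun n => ?_
    by_cases hn : dq n < q
    · simpa [hn] using measurableSet_fplus.1 (hD (dq n)) _ hn
    · simp [hn]
  · intro hD q
    rw [measurableSet_fplus]
    intro s hs
    have : {ω | D ω ≤ q} = ⋂ n, {ω | q < dq n → dq n ≤ s → D ω < dq n} := by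
      ext ω
      simp only [mem_ofPred_eq, mem_iInter]
      constructor
      · intro h1 n h2 h3
        exact h1.trans_lt (ENNReal.coe_lt_coe.2 h2)
      · intro h1
        by_contra hc
        push Not at hc
        obtain ⟨n, hn1, hn2⟩ := exists_dense_btwn (lt_min hc (ENNReal.coe_lt_coe.2 hs))
        have := h1 n (ENNReal.coe_lt_coe.1 hn1)
          (ENNReal.coe_lt_coe.1 (hn2.trans_le (min_le_right _ _))).le
        exact absurd (this.trans (hn2.trans_le (min_le_left _ _))) (lt_irrefl _)
    rw [this]
    refine MeasurableSet.iInter fun n => ?_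
    by_cases hn : q < dq n
    · by_cases hn' : dq n ≤ s
      · simpa [hn, hn'] using h.OT_lt hD hn'
      · simp [hn']
    · simp [hn]

theorem Good.OT_min_meas (h : Good Λ) {D : Ω → ℝ≥0∞} (hD : OT Λ D) (q : ℝ≥0) :
    Measurable[sigmaAt Λ q] fun ω => min (D ω) q := by
  refine measurable_of_Iio (mδ := sigmaAt Λ q) fun a => ?_
  by_cases ha : a ≤ q
  · lift a to ℝ≥0 using ne_top_of_le_ne_top ENNReal.coe_ne_top ha
    have : (fun ω => min (D ω) q) ⁻¹' Iio (a : ℝ≥0∞) = {ω | D ω < a} := by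
      ext ω
      simp only [mem_preimage, mem_Iio, min_lt_iff, mem_ofPred_eq, or_iff_left_iff_imp]
      intro h'
      exact absurd h' (not_lt.2 ha)
    rw [this]
    exact h.OT_lt hD (ENNReal.coe_le_coe.1 ha)
  · have : (fun ω => min (D ω) q) ⁻¹' Iio a = univ := by
      ext ω
      simp only [mem_preimage, mem_Iio, min_lt_iff, mem_univ, iff_true]
      exact Or.inr (not_le.1 ha)
    rw [this]
    exact MeasurableSet.univ

theorem Good.eval_prog (h : Good Λ) {D : Ω → ℝ≥0∞} (hD : OT Λ D) {B : Set (Ω × ℝ≥0)}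
    (hB : MeasurableSet[Λ] B) (q : ℝ≥0) :
    MeasurableSet[sigmaAt Λ q] {ω | (ω, (D ω).toNNReal) ∈ B ∧ D ω < q} := by
  have h1 := h.progressive hB q
  have h2 : @Measurable _ _ (sigmaAt Λ q) (@Prod.instMeasurableSpace Ω ℝ≥0 (sigmaAt Λ q) inferInstance)
      (fun ω => (ω, (min (D ω) q).toNNReal)) :=
    measurable_id.prodMk (ENNReal.measurable_toNNReal.comp (h.OT_min_meas hD q))
  have h3 := h2 h1
  convert h3 using 1
  ext ω
  simp only [mem_ofPred_eq, mem_preimage, mem_inter_iff]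
  by_cases hq : D ω < q
  · rw [min_eq_left hq.le]
    simp only [hq, and_true, iff_self_and]
    intro _
    rw [← ENNReal.coe_lt_coe, ENNReal.coe_toNNReal hq.ne_top]
    exact hq
  · rw [min_eq_right (not_lt.1 hq)]
    simp [hq]

theorem Good.after_eval (h : Good Λ) {D : Ω → ℝ≥0∞} (hD : OT Λ D) {B : Set (Ω × ℝ≥0)}
    (hB : MeasurableSet[Λ] B) :
    MeasurableSet[Λ] {p : Ω × ℝ≥0 | (p.1, (D p.1).toNNReal) ∈ B ∧ D p.1 < p.2} :=
  h.after_of_lt (A := {ω | (ω, (D ω).toNNReal) ∈ B}) fun q => h.eval_prog hD hB q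

/-- Debut of a random set. -/
def debut (B : Set (Ω × ℝ≥0)) (ω : Ω) : ℝ≥0∞ := ⨅ (s : ℝ≥0) (_ : (ω, s) ∈ B), (s : ℝ≥0∞)

theorem debut_lt_iff {B : Set (Ω × ℝ≥0)} {ω : Ω} {a : ℝ≥0∞} :
    debut B ω < a ↔ ∃ s : ℝ≥0, (ω, s) ∈ B ∧ (s : ℝ≥0∞) < a := by
  simp [debut, iInf_lt_iff]

theorem Good.exists_debut (h : Good Λ) (P : Measure Ω) [IsFiniteMeasure P] {B : Set (Ω × ℝ≥0)}
    (hB : MeasurableSet[Λ] B) :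
    ∃ D : Ω → ℝ≥0∞, OT Λ D ∧ (∀ ω, D ω ≤ debut B ω) ∧ ∀ᵐ ω ∂P, D ω = debut B ω := by
  have hex := fun n => exists_hull (sigmaAt Λ (dq n)) P (h.sigmaAt_le _) _ (h.progressive hB (dq n))
  choose E A hE hA hEs hAs hP using hex
  have hlt : ∀ (ω : Ω) (a : ℝ≥0∞), (⨅ (n : ℕ) (_ : ω ∈ A n), (dq n : ℝ≥0∞)) < a ↔
      ∃ n, ω ∈ A n ∧ (dq n : ℝ≥0∞) < a := by
    intro ω a
    simp [iInf_lt_iff]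
  refine ⟨fun ω => ⨅ (n : ℕ) (_ : ω ∈ A n), (dq n : ℝ≥0∞), ?_, ?_, ?_⟩
  · refine h.OT_of_lt fun q => ?_
    simp only [hlt]
    have : {ω | ∃ n, ω ∈ A n ∧ (dq n : ℝ≥0∞) < q} = ⋃ n, {ω | ω ∈ A n ∧ dq n < q} := by
      ext ω; simp
    rw [this]
    refine MeasurableSet.iUnion fun n => ?_
    by_cases hn : dq n < q
    · simpa [hn] using h.sigmaAt_mono hn.le _ (hA n)
    · simp [hn]
  · intro ω
    refine le_of_forall_gt fun a ha => ?_
    obtain ⟨s, hs, hsa⟩ := debut_lt_iff.1 ha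
    obtain ⟨n, hn1, hn2⟩ := exists_dense_btwn hsa
    exact (hlt ω a).2 ⟨n, hAs n ⟨(ω, s), ⟨hs, ENNReal.coe_lt_coe.1 hn1⟩, rfl⟩, hn2⟩
  · have h0 : P (⋃ n, A n \ E n) = 0 := measure_iUnion_null hP
    filter_upwards [measure_eq_zero_iff_ae_notMem.1 h0] with ω hω
    refine le_antisymm ?_ ?_
    · refine le_of_forall_gt fun a ha => ?_
      obtain ⟨s, hs, hsa⟩ := debut_lt_iff.1 ha
      obtain ⟨n, hn1, hn2⟩ := exists_dense_btwn hsa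
      exact (hlt ω a).2 ⟨n, hAs n ⟨(ω, s), ⟨hs, ENNReal.coe_lt_coe.1 hn1⟩, rfl⟩, hn2⟩
    · refine le_of_forall_gt fun a ha => ?_
      obtain ⟨n, hn, hna⟩ := (hlt ω a).1 ha
      have : ω ∈ E n := by
        by_contra hc
        exact hω (mem_iUnion.2 ⟨n, hn, hc⟩)
      obtain ⟨⟨ω', s⟩, ⟨h1, h2⟩, rfl⟩ := hEs n this
      exact debut_lt_iff.2 ⟨s, h1, lt_trans (ENNReal.coe_lt_coe.2 h2) hna⟩

theorem prod_comp_meas {Ω : Type*} [MeasurableSpace Ω] {R : Ω → ℝ≥0} (hR : Measurable R) :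
    Measurable fun ω => (ω, R ω) := measurable_id.prodMk hR

theorem Good.graph_meas (h : Good Λ) {R : Ω → ℝ≥0} (hR : Measurable R) :
    @Measurable _ _ mΩ Λ fun ω => (ω, R ω) :=
  (prod_comp_meas hR).mono le_rfl h.meyer.le_prod

/-- Section theorem. -/
theorem Good.section (h : Good Λ) (P : Measure Ω) [IsFiniteMeasure P] {B : Set (Ω × ℝ≥0)}
    (hB : MeasurableSet[Λ] B) {η : ℝ≥0∞} (hη : η ≠ 0) :
    ∃ D : Ω → ℝ≥0∞, IsStoppingTimeM Λ D ∧ (∀ ω (t : ℝ≥0), D ω = t → (ω, t) ∈ B) ∧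
      P {ω | (∃ t, (ω, t) ∈ B) ∧ D ω = ∞} ≤ η := by
  have hη2 : η / 2 ≠ 0 := (ENNReal.half_pos hη).ne'
  obtain ⟨R, E, hR, hE, hRE, hPE⟩ := exists_selection mΩ P le_rfl B (h.meyer.le_prod _ hB) (η / 2) hη2
  obtain ⟨G, hG, hGΛ⟩ := h.gen
  obtain ⟨C, ⟨hC, hCr⟩, hCB, hPC⟩ := inner_approx G
    {A | MeasurableSet[Λ] A ∧ ∀ ω t, (∃ᶠ s in 𝓝[>] t, (ω, s) ∈ A) → (ω, t) ∈ A}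
    (by
      rintro A ⟨hA1, hA2⟩ A' ⟨hA1', hA2'⟩
      refine ⟨hA1.union hA1', fun ω t hf => ?_⟩
      rcases frequently_or_distrib.1 hf with hf | hf
      · exact Or.inl (hA2 _ _ hf)
      · exact Or.inr (hA2' _ _ hf))
    (by
      intro A hA
      refine ⟨MeasurableSet.iInter fun n => (hA n).1, fun ω t hf => ?_⟩
      refine mem_iInter.2 fun n => (hA n).2 ω t (hf.mono fun s hs => mem_iInter.1 hs n))
    (by
      intro f hf F hF
      refine ⟨(hG f hf).2 hF.measurableSet, fun ω t hfr => ?_⟩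
      by_contra hc
      have h1 := ((hG f hf).1 ω).1 t
      have h2 : ∀ᶠ s in 𝓝[≥] t, f (ω, s) ∈ Fᶜ := h1 (hF.isOpen_compl.mem_nhds hc)
      have h3 : ∀ᶠ s in 𝓝[>] t, f (ω, s) ∈ Fᶜ := nhdsWithin_mono _ Ioi_subset_Ici_self h2
      exact hfr (h3.mono fun s hs hs' => hs hs'))
    ⟨MeasurableSet.empty, fun ω t hf => absurd hf (by simp)⟩
    ⟨MeasurableSet.univ, fun _ _ _ => mem_univ _⟩
    (P.restrict E) (fun ω => (ω, R ω)) (fun f hf => (hG f hf).2.comp (h.graph_meas hR))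
    (fun A hA => hGΛ ▸ hA.1) B (hGΛ ▸ hB) (η / 2) hη2
  obtain ⟨S, hS, hSle, hSae⟩ := h.exists_debut P hC
  have hatt : ∀ ω (t : ℝ≥0), debut C ω = t → (ω, t) ∈ C := by
    intro ω t ht
    by_contra hc
    refine hc (hCr ω t ?_)
    rw [frequently_iff]
    intro U hU
    obtain ⟨u, hu, hUu⟩ := (mem_nhdsGT_iff_exists_Ioo_subset' (a := t) (u' := t+1) (by simp)).1 hU
    have : debut C ω < u := by rw [ht]; exact ENNReal.coe_lt_coe.2 hu
    obtain ⟨s, hs, hsu⟩ := debut_lt_iff.1 this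
    have hts : t ≤ s := by
      by_contra hlt
      push Not at hlt
      have := debut_lt_iff.2 ⟨s, hs, ENNReal.coe_lt_coe.2 hlt⟩
      rw [ht] at this
      exact lt_irrefl _ this
    have hne : t ≠ s := fun hh => hc (hh ▸ hs)
    exact ⟨s, hUu ⟨lt_of_le_of_ne hts hne, ENNReal.coe_lt_coe.1 hsu⟩, hs⟩
  refine ⟨fun ω => if (ω, (S ω).toNNReal) ∈ C then S ω else ∞, ?_, ?_, ?_⟩
  · have : {p : Ω × ℝ≥0 | (if (p.1, (S p.1).toNNReal) ∈ C then S p.1 else ∞) ≤ (p.2 : ℝ≥0∞)} =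
        (C ∩ {p | S p.1 < p.2}ᶜ) ∪
          {p : Ω × ℝ≥0 | (p.1, (S p.1).toNNReal) ∈ C ∧ S p.1 < p.2} := by
      ext ⟨ω, t⟩
      simp only [mem_ofPred_eq, mem_union, mem_inter_iff, mem_compl_iff, not_lt]
      constructor
      · intro h1
        split_ifs at h1 with h2
        · rcases h1.eq_or_lt with h3 | h3
          · left
            rw [h3] at h2
            exact ⟨h2, h3.ge⟩
          · exact Or.inr ⟨h2, h3⟩
        · simp at h1
      · rintro (⟨h1, h2⟩ | ⟨h1, h2⟩)
        · have h3 : S ω = t := by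
            refine le_antisymm ((hSle ω).trans ?_) h2
            exact iInf₂_le t h1
          have h4 : (ω, (S ω).toNNReal) ∈ C := by rw [h3]; exact h1
          rw [if_pos h4]; exact h3.le
        · rw [if_pos h1]; exact h2.le
    unfold IsStoppingTimeM
    rw [this]
    exact (hC.inter hS.compl).union (h.after_eval hS hC)
  · intro ω t ht
    dsimp only at ht
    split_ifs at ht with h2
    · rw [ht] at h2; exact hCB h2
    · simp at ht
  · have hsub : {ω | (∃ t, (ω, t) ∈ B) ∧ (if (ω, (S ω).toNNReal) ∈ C then S ω else ∞) = ∞} ⊆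
        (Prod.fst '' B \ E) ∪ ((fun ω => (ω, R ω)) ⁻¹' (B \ C) ∩ E) ∪ {ω | S ω ≠ debut C ω} := by
      rintro ω ⟨⟨t, ht⟩, h2⟩
      by_cases hω : S ω = debut C ω
      · left
        by_cases hωE : ω ∈ E
        · right
          refine ⟨⟨hRE ω hωE, fun hc => ?_⟩, hωE⟩
          have h3 : S ω ≤ R ω := (hSle ω).trans (iInf₂_le (R ω) hc)
          have h4 : S ω ≠ ∞ := ne_top_of_le_ne_top ENNReal.coe_ne_top h3
          have h5 := hatt ω (S ω).toNNReal (by rw [ENNReal.coe_toNNReal h4, hω])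
          rw [if_pos h5] at h2
          exact h4 h2
        · left; exact ⟨⟨_, ht, rfl⟩, hωE⟩
      · right; exact hω
    refine (measure_mono hsub).trans ((measure_union_le _ _).trans ?_)
    have h0 : P {ω | S ω ≠ debut C ω} = 0 := hSae
    rw [h0, add_zero]
    refine (measure_union_le _ _).trans ?_
    rw [← ENNReal.add_halves η]
    refine add_le_add ?_ ?_
    · have hEs : E ⊆ Prod.fst '' B := fun ω hω => ⟨_, hRE ω hω, rfl⟩
      rw [measure_sdiff hEs hE.nullMeasurableSet (measure_ne_top _ _)]
      rw [tsub_le_iff_left]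
      exact hPE
    · rwa [Measure.restrict_apply' hE] at hPC

theorem Good.sigmaInf_le (h : Good Λ) : sigmaInf Λ ≤ mΩ := iSup_le fun q => h.sigmaAt_le q

theorem Good.eval_meas (h : Good Λ) {Z : Ω × ℝ≥0∞ → ℝ} (hZ : MeasurableProcessE Λ Z)
    {S : Ω → ℝ≥0∞} (hS : Measurable S) : Measurable (EvalAt Z S) := by
  have h1 : Measurable fun ω => Z (ω, ((S ω).toNNReal : ℝ≥0∞)) :=
    hZ.1.comp (h.graph_meas (ENNReal.measurable_toNNReal.comp hS))
  have h2 : Measurable fun ω => Z (ω, ∞) := hZ.2.mono h.sigmaInf_le le_rfl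
  have : EvalAt Z S = fun ω => if S ω = ∞ then Z (ω, ∞) else Z (ω, ((S ω).toNNReal : ℝ≥0∞)) := by
    ext ω
    simp only [EvalAt]
    split_ifs with h3
    · rw [h3]
    · rw [ENNReal.coe_toNNReal h3]
  rw [this]
  exact Measurable.ite (hS (measurableSet_singleton _)) h2 h1

theorem Good.sigmaAtTime_le (h : Good Λ) {S : Ω → ℝ≥0∞} (hS : Measurable S) :
    sigmaAtTime Λ S ≤ mΩ := by
  refine genBy_le ?_
  rintro _ ⟨Z, hZ, rfl⟩
  exact h.eval_meas hZ hS

theorem ST_min {S T : Ω → ℝ≥0∞} (hS : IsStoppingTimeM Λ S) (hT : IsStoppingTimeM Λ T) :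
    IsStoppingTimeM Λ fun ω => min (S ω) (T ω) := by
  unfold IsStoppingTimeM at *
  convert MeasurableSet.union hS hT using 1
  ext p; simp

theorem ST_max {S T : Ω → ℝ≥0∞} (hS : IsStoppingTimeM Λ S) (hT : IsStoppingTimeM Λ T) :
    IsStoppingTimeM Λ fun ω => max (S ω) (T ω) := by
  unfold IsStoppingTimeM at *
  convert MeasurableSet.inter hS hT using 1
  ext p; simp

theorem Good.ST_meas (h : Good Λ) {S : Ω → ℝ≥0∞} (hS : IsStoppingTimeM Λ S) : Measurable S :=
  h.OT_meas (h.OT_of_ST hS)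

theorem Good.after_atTime (h : Good Λ) {S : Ω → ℝ≥0∞} (hS : IsStoppingTimeM Λ S) {A : Set Ω}
    (hA : MeasurableSet[sigmaAtTime Λ S] A) :
    MeasurableSet[Λ] {p : Ω × ℝ≥0 | p.1 ∈ A ∧ S p.1 ≤ p.2} := by
  have key : ∀ Z : Ω × ℝ≥0∞ → ℝ, MeasurableProcessE Λ Z → ∀ B : Set ℝ, MeasurableSet B →
      MeasurableSet[Λ] {p : Ω × ℝ≥0 | Z (p.1, S p.1) ∈ B ∧ S p.1 ≤ p.2} := by
    intro Z hZ B hB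
    have hB' := hZ.1 hB
    have hO := h.OT_of_ST hS
    have h1 := h.after_eval hO hB'
    convert (MeasurableSet.inter hB' (MeasurableSet.diff hS hO)).union h1 using 1
    ext ⟨ω, t⟩
    simp only [mem_ofPred_eq, mem_preimage, mem_union, mem_inter_iff, Set.mem_sdiff, not_lt]
    constructor
    · rintro ⟨h1, h2⟩
      rcases h2.eq_or_lt with h3 | h3
      · left; rw [h3] at h1; exact ⟨h1, h2, h3.ge⟩
      · right; rw [ENNReal.coe_toNNReal h3.ne_top]; exact ⟨h1, h3⟩
    · rintro (⟨h1, h2, h3⟩ | ⟨h1, h2⟩)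
      · rw [le_antisymm h2 h3]; exact ⟨h1, le_rfl⟩
      · rw [ENNReal.coe_toNNReal h2.ne_top] at h1; exact ⟨h1, h2.le⟩
  let m : MeasurableSpace Ω :=
    { MeasurableSet' := fun A => MeasurableSet[Λ] {p : Ω × ℝ≥0 | p.1 ∈ A ∧ S p.1 ≤ p.2}
      measurableSet_empty := by simp
      measurableSet_compl := by
        intro A hA
        convert MeasurableSet.diff hS hA using 1
        ext p
        simp only [mem_ofPred_eq, Set.mem_sdiff, mem_compl_iff]
        tauto
      measurableSet_iUnion := by
        intro A hA
        convert MeasurableSet.iUnion hA using 1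
        ext p
        simp }
  have hle : sigmaAtTime Λ S ≤ m := by
    refine genBy_le ?_
    rintro _ ⟨Z, hZ, rfl⟩ B hB
    exact key Z hZ B hB
  exact hle A hA

theorem Good.ST_merge (h : Good Λ) {S T T' : Ω → ℝ≥0∞} (hS : IsStoppingTimeM Λ S)
    (hT : IsStoppingTimeM Λ T) (hT' : IsStoppingTimeM Λ T') (hST : S ≤ T) (hST' : S ≤ T')
    {A : Set Ω} (hA : MeasurableSet[sigmaAtTime Λ S] A) :
    IsStoppingTimeM Λ fun ω => if ω ∈ A then T ω else T' ω := by
  have h1 := h.after_atTime hS hA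
  have h2 := h.after_atTime hS hA.compl
  unfold IsStoppingTimeM at *
  convert (h1.inter hT).union (h2.inter hT') using 1
  ext p
  simp only [mem_ofPred_eq, mem_union, mem_inter_iff, mem_compl_iff]
  by_cases hp : p.1 ∈ A
  · simp only [hp, if_true, true_and, not_true_eq_false, false_and, or_false]
    exact ⟨fun h3 => ⟨(hST p.1).trans h3, h3⟩, fun h3 => h3.2⟩
  · simp only [hp, if_false, false_and, not_false_eq_true, true_and, false_or]
    exact ⟨fun h3 => ⟨(hST' p.1).trans h3, h3⟩, fun h3 => h3.2⟩

theorem ClassD.integrable {P : Measure Ω} {Z : Ω × ℝ≥0∞ → ℝ} (hD : ClassD P Λ Z)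
    {S : Ω → ℝ≥0∞} (hS : IsStoppingTimeM Λ S) : Integrable (EvalAt Z S) P :=
  memLp_one_iff_integrable.1 (hD.memLp ⟨S, hS⟩)

theorem le_liminf_of_eps {a : ℕ → ℝ≥0∞} {x : ℝ≥0∞}
    (hx : ∀ ε : ℝ≥0, 0 < ε → ∀ᶠ n in atTop, x ≤ a n + ε) : x ≤ liminf a atTop := by
  refine ENNReal.le_of_forall_pos_le_add fun ε hε _ => ?_
  rw [← tsub_le_iff_right]
  refine le_liminf_of_le (by isBoundedDefault) ?_
  filter_upwards [hx ε hε] with n hn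
  exact tsub_le_iff_right.2 hn

theorem Good.snell_value (h : Good Λ) (P : Measure Ω) [IsProbabilityMeasure P]
    {Z : Ω × ℝ≥0∞ → ℝ} (hpos : ∀ p, 0 ≤ Z p) (hD : ClassD P Λ Z) {Zb : Ω × ℝ≥0∞ → ℝ}
    (hZb : IsSnellProc P Λ Z Zb) {S : Ω → ℝ≥0∞} (hS : IsStoppingTimeM Λ S) :
    (∀ T, IsStoppingTimeM Λ T → S ≤ T → ∫ ω, EvalAt Z T ω ∂P ≤ ∫ ω, EvalAt Zb S ω ∂P) ∧
    ∃ T : ℕ → Ω → ℝ≥0∞, ∀ n, IsStoppingTimeM Λ (T n) ∧ S ≤ T n ∧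
      ∫ ω, EvalAt Zb S ω ∂P - (1/2)^n < ∫ ω, EvalAt Z (T n) ω ∂P := by
  have hle : sigmaAtTime Λ S ≤ mΩ := h.sigmaAtTime_le (h.ST_meas hS)
  have hZbi : Integrable (EvalAt Zb S) P := hZb.1.2.1 S hS
  have hub : ∀ T, IsStoppingTimeM Λ T → S ≤ T →
      ∫ ω, EvalAt Z T ω ∂P ≤ ∫ ω, EvalAt Zb S ω ∂P := by
    intro T hT hST
    rw [← integral_condExp hle]
    exact integral_mono_ae integrable_condExp hZbi ((hZb.2 S hS).1 T hT hST)
  refine ⟨hub, ?_⟩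
  let V : Set ℝ := {x | ∃ T, IsStoppingTimeM Λ T ∧ S ≤ T ∧ x = ∫ ω, EvalAt Z T ω ∂P}
  have hVb : BddAbove V := by
    refine ⟨∫ ω, EvalAt Zb S ω ∂P, ?_⟩
    rintro _ ⟨T, hT, hST, rfl⟩
    exact hub T hT hST
  have hVn : V.Nonempty := ⟨_, S, hS, le_rfl, rfl⟩
  have hV0 : 0 ≤ sSup V := (integral_nonneg fun ω => hpos _).trans (le_csSup hVb ⟨S, hS, le_rfl, rfl⟩)
  have hex : ∀ n : ℕ, ∃ T, IsStoppingTimeM Λ T ∧ S ≤ T ∧ sSup V - (1/2)^n < ∫ ω, EvalAt Z T ω ∂P := by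
    intro n
    obtain ⟨_, ⟨T, hT, hST, rfl⟩, hlt⟩ := exists_lt_of_lt_csSup hVn
      (show sSup V - (1/2)^n < sSup V by simp)
    exact ⟨T, hT, hST, hlt⟩
  suffices hkey : ∫ ω, EvalAt Zb S ω ∂P ≤ sSup V by
    choose T hT hST hlt using hex
    exact ⟨T, fun n => ⟨hT n, hST n, lt_of_le_of_lt (by linarith) (hlt n)⟩⟩
  choose T hT hST hlt using hex
  let ξ : (Ω → ℝ≥0∞) → Ω → ℝ := fun T => P[EvalAt Z T|sigmaAtTime Λ S]
  have hξm : ∀ T, Measurable[sigmaAtTime Λ S] (ξ T) := fun T =>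
    stronglyMeasurable_condExp.measurable
  have hξm' : ∀ T, Measurable (ξ T) := fun T => (hξm T).mono hle le_rfl
  have hξi : ∀ T, Integrable (ξ T) P := fun T => integrable_condExp
  let u : Ω → ℝ≥0∞ := fun ω => liminf (fun n => ENNReal.ofReal (ξ (T n) ω)) atTop
  have hum : Measurable u := Measurable.liminf fun n => (hξm' (T n)).ennreal_ofReal
  have hub2 : ∫⁻ ω, u ω ∂P ≤ ENNReal.ofReal (sSup V) := by
    refine (lintegral_liminf_le fun n => (hξm' (T n)).ennreal_ofReal).trans ?_
    refine liminf_le_of_frequently_le' (Frequently.of_forall fun n => ?_)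
    rw [← ofReal_integral_eq_lintegral_ofReal (hξi _)
      (condExp_nonneg (Eventually.of_forall fun ω => hpos _))]
    rw [integral_condExp hle]
    exact ENNReal.ofReal_le_ofReal (le_csSup hVb ⟨_, hT n, hST n, rfl⟩)
  have hutop : ∀ᵐ ω ∂P, u ω < ∞ := ae_lt_top hum (hub2.trans_lt ENNReal.ofReal_lt_top).ne
  have hmain : ∀ T', IsStoppingTimeM Λ T' → S ≤ T' → ξ T' ≤ᵐ[P] fun ω => (u ω).toReal := by
    intro T' hT' hST'
    have hdm : ∀ n, Measurable fun ω => ξ T' ω - ξ (T n) ω := fun n => (hξm' _).sub (hξm' _)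
    have hdi : ∀ n, Integrable (fun ω => ξ T' ω - ξ (T n) ω) P := fun n => (hξi _).sub (hξi _)
    have hn : ∀ n, ∫⁻ ω, ENNReal.ofReal (ξ T' ω - ξ (T n) ω) ∂P ≤ ENNReal.ofReal ((1/2)^n) := by
      intro n
      let A : Set Ω := {ω | ξ (T n) ω < ξ T' ω}
      have hA : MeasurableSet[sigmaAtTime Λ S] A := measurableSet_lt (hξm _) (hξm _)
      have hA' : MeasurableSet A := hle _ hA
      have hM := h.ST_merge hS hT' (hT n) hST' (hST n) hA
      have hMS : S ≤ fun ω => if ω ∈ A then T' ω else T n ω := by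
        intro ω; dsimp only; split_ifs
        · exact hST' ω
        · exact hST n ω
      have hJ := le_csSup hVb ⟨_, hM, hMS, rfl⟩
      have e1 : ∫⁻ ω, ENNReal.ofReal (ξ T' ω - ξ (T n) ω) ∂P
          = ∫⁻ ω in A, ENNReal.ofReal (ξ T' ω - ξ (T n) ω) ∂P := by
        rw [← lintegral_indicator hA']
        refine lintegral_congr fun ω => ?_
        by_cases hω : ω ∈ A
        · simp [hω]
        · have : ξ T' ω ≤ ξ (T n) ω := not_lt.1 hω
          simp [hω, ENNReal.ofReal_eq_zero, this]
      rw [e1, ← ofReal_integral_eq_lintegral_ofReal (hdi n).integrableOn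
        ((ae_restrict_iff' hA').2 (Eventually.of_forall fun ω hω => sub_nonneg.2 (le_of_lt hω)))]
      refine ENNReal.ofReal_le_ofReal ?_
      rw [integral_sub (hξi _).integrableOn (hξi _).integrableOn]
      rw [setIntegral_condExp hle (hD.integrable hT') hA,
        setIntegral_condExp hle (hD.integrable (hT n)) hA]
      have e2 : ∫ ω, EvalAt Z (fun ω => if ω ∈ A then T' ω else T n ω) ω ∂P =
          ∫ ω in A, EvalAt Z T' ω ∂P + ∫ ω in Aᶜ, EvalAt Z (T n) ω ∂P := by
        rw [← integral_add_compl hA' (hD.integrable hM)]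
        congr 1
        · refine setIntegral_congr_fun hA' fun ω hω => ?_
          simp [EvalAt, hω]
        · refine setIntegral_congr_fun hA'.compl fun ω hω => ?_
          have : ω ∉ A := hω
          simp [EvalAt, this]
      have e3 := integral_add_compl hA' (hD.integrable (hT n))
      have := hlt n
      linarith
    have hsum : ∫⁻ ω, ∑' n, ENNReal.ofReal (ξ T' ω - ξ (T n) ω) ∂P ≠ ∞ := by
      rw [lintegral_tsum fun n => (hdm n).ennreal_ofReal.aemeasurable]
      refine ne_top_of_le_ne_top ?_ (ENNReal.tsum_le_tsum hn)
      rw [← ENNReal.ofReal_tsum_of_nonneg (fun n => by positivity) summable_geometric_two]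
      exact ENNReal.ofReal_ne_top
    have hae := ae_lt_top' (AEMeasurable.tsum fun n =>
      (hdm n).ennreal_ofReal.aemeasurable) hsum
    filter_upwards [hae, hutop] with ω h1 h2
    have h3 := ENNReal.tendsto_atTop_zero_of_tsum_ne_top h1.ne
    have h4 : ENNReal.ofReal (ξ T' ω) ≤ u ω := by
      refine le_liminf_of_eps fun ε hε => ?_
      filter_upwards [h3.eventually_le_const (ENNReal.coe_pos.2 hε)] with n hn
      calc ENNReal.ofReal (ξ T' ω) = ENNReal.ofReal (ξ (T n) ω + (ξ T' ω - ξ (T n) ω)) := by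
            congr 1; ring
        _ ≤ _ := ENNReal.ofReal_add_le
        _ ≤ _ := by gcongr
    exact (ENNReal.ofReal_le_iff_le_toReal h2.ne).1 h4
  have hfin := (hZb.2 S hS).2 _ hmain
  calc ∫ ω, EvalAt Zb S ω ∂P ≤ ∫ ω, (u ω).toReal ∂P :=
        integral_mono_ae hZbi (integrable_toReal_of_lintegral_ne_top hum.aemeasurable
          (hub2.trans_lt ENNReal.ofReal_lt_top).ne) hfin
    _ = (∫⁻ ω, u ω ∂P).toReal := integral_toReal hum.aemeasurable hutop
    _ ≤ sSup V := ENNReal.toReal_le_of_le_ofReal hV0 hub2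

theorem Good.sigmaAt_le_fplus (h : Good Λ) (q : ℝ≥0) : sigmaAt Λ q ≤ FplusLambda Λ q :=
  fun _ hA => measurableSet_fplus.2 fun _ hs => h.sigmaAt_mono hs.le _ hA

theorem Good.fplus_le (h : Good Λ) {q r : ℝ≥0} (hqr : q < r) : FplusLambda Λ q ≤ sigmaAt Λ r :=
  fun _ hA => measurableSet_fplus.1 hA _ hqr

theorem Good.fplus_le_top (h : Good Λ) (q : ℝ≥0) : FplusLambda Λ q ≤ mΩ :=
  (h.fplus_le (lt_add_one q)).trans (h.sigmaAt_le _)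

theorem pred_sec {G : ℝ≥0 → MeasurableSpace Ω} {B : Set (Ω × ℝ≥0)}
    (hB : MeasurableSet[predSF G] B) (q : ℝ≥0) : MeasurableSet[G q] {ω | (ω, q) ∈ B} := by
  have : @Measurable _ _ (G q) (predSF G) (fun ω => (ω, q)) := by
    rw [measurable_iff_comap_le, predSF, genBy]
    simp only [MeasurableSpace.comap_iSup, MeasurableSpace.comap_comp, iSup_le_iff]
    intro f hf
    exact (hf.2 q).comap_le
  exact this hB

theorem Good.pred_open (h : Good Λ) {D : Ω → ℝ≥0∞} (hD : OT Λ D) :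
    MeasurableSet[predSF (FplusLambda Λ)] {p : Ω × ℝ≥0 | D p.1 < (p.2 : ℝ≥0∞)} := by
  let X : Ω × ℝ≥0 → ℝ := fun p => (p.2 : ℝ) - (min (D p.1) p.2).toReal
  have hX : Measurable[predSF (FplusLambda Λ)] X := by
    refine measurable_genBy ⟨fun ω => ?_, fun t => ?_⟩
    · refine NNReal.continuous_coe.sub ?_
      by_cases hω : D ω = ∞
      · simpa [hω] using NNReal.continuous_coe
      · have : (fun t : ℝ≥0 => (min (D ω) t).toReal) = fun t : ℝ≥0 => ((min (D ω).toNNReal t : ℝ≥0) : ℝ) := by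
          ext t
          lift D ω to ℝ≥0 using hω with d
          rw [← ENNReal.coe_min, ENNReal.coe_toReal, ENNReal.toNNReal_coe]
        simp only [this]
        fun_prop
    · have h1 := (h.OT_min_meas hD t).mono (h.sigmaAt_le_fplus t) le_rfl
      have h2 : Measurable[FplusLambda Λ t] fun ω => (min (D ω) t).toReal :=
        ENNReal.measurable_toReal.comp h1
      exact h2.const_sub (t:ℝ)
  have h2 := hX (measurableSet_Ioi (a := (0:ℝ)))
  convert h2 using 1
  ext ⟨ω, t⟩
  simp only [mem_ofPred_eq, mem_preimage, mem_Ioi, X, sub_pos]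
  have e : min (D ω) t ≠ ∞ := ne_top_of_le_ne_top ENNReal.coe_ne_top (min_le_right _ _)
  rw [← ENNReal.coe_toReal t, ENNReal.toReal_lt_toReal e ENNReal.coe_ne_top]
  simp

theorem meas_tsum_aux {α : Type*} [MeasurableSpace α] {X : ℕ → α → ℝ} (hX : ∀ n, Measurable (X n)) :
    Measurable fun a => ∑' n, (1/2:ℝ)^n * min (X n a) 1 :=
  Measurable.tsum fun n => measurable_const.mul ((hX n).min measurable_const)

theorem pred_closed_zero {G : ℝ≥0 → MeasurableSpace Ω} {X : ℕ → Ω × ℝ≥0 → ℝ}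
    (hc : ∀ n ω, Continuous fun t => X n (ω, t)) (ha : ∀ n, Adapted' G (X n))
    (h0 : ∀ n p, 0 ≤ X n p) : ∃ Y : Ω × ℝ≥0 → ℝ, (∀ ω, Continuous fun t => Y (ω, t)) ∧
      Adapted' G Y ∧ (∀ p, 0 ≤ Y p) ∧ ∀ p, Y p = 0 ↔ ∀ n, X n p = 0 := by
  have hb : ∀ n p, 0 ≤ (1/2:ℝ)^n * min (X n p) 1 := fun n p =>
    mul_nonneg (by positivity) (le_min (h0 n p) zero_le_one)
  have hb2 : ∀ n p, (1/2:ℝ)^n * min (X n p) 1 ≤ (1/2:ℝ)^n := fun n p =>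
    mul_le_of_le_one_right (by positivity) (min_le_right _ _)
  have hs : ∀ p, Summable fun n => (1/2:ℝ)^n * min (X n p) 1 := fun p =>
    Summable.of_nonneg_of_le (fun n => hb n p) (fun n => hb2 n p) summable_geometric_two
  refine ⟨fun p => ∑' n, (1/2:ℝ)^n * min (X n p) 1, fun ω => ?_, fun t => ?_,
    fun p => tsum_nonneg fun n => hb n p, fun p => ?_⟩
  · refine continuous_tsum (fun n => ?_) summable_geometric_two (fun n t => ?_)
    · exact continuous_const.mul ((hc n ω).min continuous_const)
    · rw [Real.norm_of_nonneg (hb n _)]; exact hb2 n _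
  · exact @meas_tsum_aux Ω (G t) _ fun n => ha n t
  · have e1 : (∑' n, (1/2:ℝ)^n * min (X n p) 1 = 0) ↔ ∀ n, (1/2:ℝ)^n * min (X n p) 1 = 0 := by
      constructor
      · intro h1
        have h2 := (hs p).hasSum
        rw [h1, hasSum_zero_iff_of_nonneg (fun n => hb n p)] at h2
        exact fun n => congrFun h2 n
      · intro h1
        simp only [h1, tsum_zero]
    rw [e1]
    refine forall_congr' fun n => ?_
    have h1 : ((1:ℝ)/2)^n ≠ 0 := by positivity
    rw [mul_eq_zero, or_iff_right h1]
    constructor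
    · intro h2
      rcases min_choice (X n p) 1 with h3 | h3 <;> rw [h3] at h2
      · exact h2
      · exact absurd h2 one_ne_zero
    · intro h2; rw [h2]; simp

theorem exists_dense_open {U : Set ℝ≥0} (hU : IsOpen U) (hne : U.Nonempty) : ∃ n, dq n ∈ U :=
  (TopologicalSpace.denseRange_denseSeq ℝ≥0).exists_mem_open hU hne

/-- Foretelling a predictable time. -/
theorem Good.foretell (h : Good Λ) (P : Measure Ω) [IsFiniteMeasure P] {T : Ω → ℝ≥0∞}
    (hT : IsStoppingTimeM (predSF (FplusLambda Λ)) T) (hTpos : ∀ ω, 0 < T ω) {η : ℝ≥0∞}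
    (hη : η ≠ 0) : ∃ D : ℕ → Ω → ℝ≥0∞, (∀ n, OT Λ (D n)) ∧ Monotone D ∧
      (∀ n ω, D n ω ≤ n) ∧ (∀ n ω, D n ω < ⨆ m, D m ω) ∧
      (∀ ω, (⨆ m, D m ω) = ∞ ∨ (⨆ m, D m ω) = T ω) ∧
      P {ω | T ω < ∞ ∧ (⨆ m, D m ω) = ∞} ≤ η := by
  have hTO : OT Λ T := h.OT_iff_cl.1 fun t => pred_sec hT t
  have hTm : Measurable T := h.OT_meas hTO
  have hgr : MeasurableSet[predSF (FplusLambda Λ)] {p : Ω × ℝ≥0 | T p.1 = p.2} := by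
    convert MeasurableSet.diff hT (h.pred_open hTO) using 1
    ext p
    simp only [mem_ofPred_eq, Set.mem_sdiff, not_lt]
    exact le_antisymm_iff
  have hfm : ∀ f : Ω × ℝ≥0 → ℝ, (∀ ω, Continuous fun t => f (ω, t)) → Adapted' (FplusLambda Λ) f →
      Measurable[Prod.instMeasurableSpace] f := by
    intro f hf1 hf2
    have := measurable_uncurry_of_continuous_of_measurable (u := fun t ω => f (ω, t))
      hf1 (fun t => (hf2 t).mono (h.fplus_le_top t) le_rfl)
    exact this.comp measurable_swap
  obtain ⟨C, ⟨X, hXc, hXa, hX0, hXC⟩, hCB, hPC⟩ := inner_approx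
    {Z | (∀ ω, Continuous fun t => Z (ω, t)) ∧ Adapted' (FplusLambda Λ) Z}
    {A : Set (Ω × ℝ≥0) | ∃ X : Ω × ℝ≥0 → ℝ, (∀ ω, Continuous fun t => X (ω, t)) ∧
      Adapted' (FplusLambda Λ) X ∧ (∀ p, 0 ≤ X p) ∧ ∀ p, p ∈ A ↔ X p = 0}
    (by
      rintro A ⟨X, h1, h2, h3, h4⟩ A' ⟨X', h1', h2', h3', h4'⟩
      refine ⟨fun p => X p * X' p, fun ω => (h1 ω).mul (h1' ω), fun t => (h2 t).mul (h2' t),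
        fun p => mul_nonneg (h3 p) (h3' p), fun p => ?_⟩
      rw [mul_eq_zero, mem_union, h4, h4'])
    (by
      intro A hA
      choose X h1 h2 h3 h4 using hA
      obtain ⟨Y, hY1, hY2, hY3, hY4⟩ := pred_closed_zero h1 h2 h3
      refine ⟨Y, hY1, hY2, hY3, fun p => ?_⟩
      rw [hY4, mem_iInter]
      exact forall_congr' fun n => h4 n p)
    (by
      rintro f ⟨hf1, hf2⟩ F hF
      rcases F.eq_empty_or_nonempty with rfl | hne
      · exact ⟨fun _ => 1, fun _ => continuous_const, fun _ => measurable_const,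
          fun _ => zero_le_one, fun p => by simp⟩
      · refine ⟨fun p => Metric.infDist (f p) F, fun ω => (Metric.continuous_infDist_pt F).comp (hf1 ω),
          fun t => (Metric.continuous_infDist_pt F).measurable.comp (hf2 t),
          fun p => Metric.infDist_nonneg, fun p => ?_⟩
        exact hF.mem_iff_infDist_zero hne)
    ⟨fun _ => 1, fun _ => continuous_const, fun _ => measurable_const,
          fun _ => zero_le_one, fun p => by simp⟩
    ⟨fun _ => 0, fun _ => continuous_const, fun _ => measurable_const,
          fun _ => le_rfl, fun p => by simp⟩
    (P.restrict {ω | T ω < ∞}) (fun ω => (ω, (T ω).toNNReal))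
    (fun f hf => (hfm f hf.1 hf.2).comp (prod_comp_meas (ENNReal.measurable_toNNReal.comp hTm)))
    (by
      rintro A ⟨X, h1, h2, h3, h4⟩
      have : Measurable[predSF (FplusLambda Λ)] X := measurable_genBy ⟨h1, h2⟩
      have := this (measurableSet_singleton 0)
      have e : A = X ⁻¹' {0} := by ext p; exact h4 p
      rw [e]; exact this)
    {p : Ω × ℝ≥0 | T p.1 = p.2} hgr η hη
  let c : ℕ → ℝ := fun n => 1 / ((n:ℝ) + 1)
  have hc0 : ∀ n, 0 < c n := fun n => by positivity
  have hcm : ∀ m n, m ≤ n → c n ≤ c m := fun m n hmn => Nat.one_div_le_one_div hmn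
  let d : ℕ → Ω → ℝ≥0∞ := fun n => debut {p : Ω × ℝ≥0 | X p < c n}
  let D : ℕ → Ω → ℝ≥0∞ := fun n ω => min (d n ω) n
  have hdm : ∀ m n, m ≤ n → ∀ ω, d m ω ≤ d n ω := by
    intro m n hmn ω
    refine le_of_forall_gt fun a ha => ?_
    obtain ⟨s, hs, hsa⟩ := debut_lt_iff.1 ha
    exact debut_lt_iff.2 ⟨s, lt_of_lt_of_le hs (hcm m n hmn), hsa⟩
  have hDm : Monotone D := fun m n hmn ω => min_le_min (hdm m n hmn ω) (by exact_mod_cast hmn)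
  have hdO : ∀ n, OT Λ (d n) := by
    intro n
    refine h.OT_of_lt fun q => ?_
    have : {ω | d n ω < q} = ⋃ k, {ω | dq k < q ∧ X (ω, dq k) < c n} := by
      ext ω
      simp only [mem_ofPred_eq, mem_iUnion, d, debut_lt_iff]
      constructor
      · rintro ⟨s, hs, hsq⟩
        obtain ⟨k, hk⟩ := exists_dense_open (U := {t | t < q ∧ X (ω, t) < c n})
          (isOpen_Iio.inter (isOpen_lt (hXc ω) continuous_const)) ⟨s, ENNReal.coe_lt_coe.1 hsq, hs⟩
        exact ⟨k, hk⟩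
      · rintro ⟨k, h1, h2⟩
        exact ⟨dq k, h2, ENNReal.coe_lt_coe.2 h1⟩
    rw [this]
    refine MeasurableSet.iUnion fun k => ?_
    by_cases hk : dq k < q
    · simp only [hk, true_and]
      exact h.fplus_le hk _ (measurableSet_lt (hXa (dq k)) measurable_const)
    · simp [hk]
  have hDO : ∀ n, OT Λ (D n) := by
    intro n
    refine h.OT_of_lt fun q => ?_
    simp only [D, min_lt_iff]
    by_cases hn : (n : ℝ≥0∞) < q
    · simp [hn]
    · simpa [hn] using h.OT_lt (hdO n) le_rfl
  have hfin : ∀ ω, (⨆ m, D m ω) ≠ ∞ → T ω = (⨆ m, D m ω) ∧ X (ω, (⨆ m, D m ω).toNNReal) = 0 := by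
    intro ω hω
    set e := (⨆ m, D m ω).toNNReal with he
    have hee : (⨆ m, D m ω) = e := (ENNReal.coe_toNNReal hω).symm
    have hX : X (ω, e) = 0 := by
      by_contra hne
      have hgt : 0 < X (ω, e) := lt_of_le_of_ne (hX0 _) (Ne.symm hne)
      -- neighbourhood where X is large
      have hU : ∀ᶠ t in 𝓝 e, X (ω, e) / 2 < X (ω, t) :=
        (hXc ω).continuousAt.eventually (lt_mem_nhds (half_lt_self hgt))
      obtain ⟨n1, hn1⟩ := exists_nat_one_div_lt (half_pos hgt)
      obtain ⟨δ, hδ, hball⟩ := Metric.eventually_nhds_iff.1 hU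
      -- for n large, d n <= e and d n > e - δ
      have hlim : Tendsto (fun m => D m ω) atTop (𝓝 (e : ℝ≥0∞)) := by
        rw [← hee]; exact tendsto_atTop_iSup fun m n hmn => hDm hmn ω
      have hcont : ∀ᶠ m in atTop, ∃ s : ℝ≥0, D m ω = s ∧ dist s e < δ / 2 := by
        have h1 : Tendsto (fun m => (D m ω).toNNReal) atTop (𝓝 e) := by
          have := (ENNReal.tendsto_toNNReal ENNReal.coe_ne_top).comp hlim
          simpa [Function.comp_def] using this
        filter_upwards [Metric.tendsto_nhds.1 h1 (δ/2) (half_pos hδ)] with m hm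
        refine ⟨_, (ENNReal.coe_toNNReal ?_).symm, hm⟩
        exact ne_top_of_le_ne_top (ENNReal.natCast_ne_top m) (min_le_right _ _)
      obtain ⟨n2, hn2⟩ := exists_nat_gt (e : ℝ)
      obtain ⟨m, ⟨s, hs, hsd⟩, hm1, hm2⟩ := (hcont.and ((eventually_ge_atTop n1).and
        (eventually_ge_atTop n2))).exists
      have hle : D m ω ≤ e := by rw [← hee]; exact le_iSup (fun m => D m ω) m
      have hme : (e : ℝ≥0∞) < m := by
        have h1 : e < (n2 : ℝ≥0) := by exact_mod_cast hn2
        calc (e : ℝ≥0∞) < n2 := by exact_mod_cast h1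
          _ ≤ m := by exact_mod_cast hm2
      have hd : d m ω = s := by
        rw [← hs]
        rcases min_choice (d m ω) (m:ℝ≥0∞) with h1 | h1
        · exact h1.symm
        · exact absurd (h1 ▸ hle : (m:ℝ≥0∞) ≤ e) (not_le.2 hme)
      have hlt : d m ω < ((s + ⟨δ/2, (half_pos hδ).le⟩ : ℝ≥0) : ℝ≥0∞) := by
        rw [hd]
        refine ENNReal.coe_lt_coe.2 (lt_add_of_pos_right _ ?_)
        exact half_pos hδ
      obtain ⟨r, hr, hrs⟩ := debut_lt_iff.1 hlt
      have hsr : s ≤ r := by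
        rw [← ENNReal.coe_le_coe, ← hd]
        exact iInf₂_le r hr
      have hrs' := ENNReal.coe_lt_coe.1 hrs
      have hr2 : X (ω, e) / 2 < X (ω, r) := by
        refine hball ?_
        have : dist r s < δ / 2 := by
          rw [NNReal.dist_eq, abs_of_nonneg (by simpa using hsr)]
          have : (r:ℝ) < s + δ/2 := by exact_mod_cast hrs'
          linarith
        linarith [dist_triangle r s e]
      have hr' : X (ω, r) < c m := hr
      have := hcm n1 m hm1
      have hn1' : c n1 < X (ω, e) / 2 := hn1
      linarith
    refine ⟨?_, hX⟩
    have h5 : (ω, e) ∈ C := (hXC _).2 hX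
    rw [hee]
    exact hCB h5
  refine ⟨D, hDO, hDm, fun n ω => min_le_right _ _, ?_, ?_, ?_⟩
  · intro n ω
    refine lt_of_le_of_ne (le_iSup (fun m => D m ω) n) fun heq => ?_
    have hne : (⨆ m, D m ω) ≠ ∞ := by
      rw [← heq]; exact ne_top_of_le_ne_top (ENNReal.natCast_ne_top n) (min_le_right _ _)
    obtain ⟨hT1, hX1⟩ := hfin ω hne
    set e := (⨆ m, D m ω).toNNReal with he
    have hee : (⨆ m, D m ω) = e := (ENNReal.coe_toNNReal hne).symm
    have hepos : 0 < e := by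
      have := hTpos ω
      rw [hT1, hee] at this
      exact_mod_cast this
    have hde : (e : ℝ≥0∞) ≤ d n ω := by rw [← hee, ← heq]; exact min_le_left _ _
    have hU : ∀ᶠ t in 𝓝 e, X (ω, t) < c n :=
      (hXc ω).continuousAt.eventually (gt_mem_nhds (by show X (ω, e) < c n; rw [hX1]; exact hc0 n))
    obtain ⟨l, hl, hl2⟩ := exists_Ioc_subset_of_mem_nhds hU ⟨0, hepos⟩
    obtain ⟨r, hr1, hr2⟩ := exists_between hl
    have : d n ω ≤ r := iInf₂_le r (hl2 ⟨hr1, hr2.le⟩)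
    exact absurd (hde.trans this) (not_le.2 (ENNReal.coe_lt_coe.2 hr2))
  · intro ω
    by_cases hne : (⨆ m, D m ω) = ∞
    · exact Or.inl hne
    · exact Or.inr (hfin ω hne).1.symm
  · rw [Measure.restrict_apply' (measurableSet_lt hTm measurable_const)] at hPC
    refine le_trans (measure_mono ?_) hPC
    rintro ω ⟨h1, h2⟩
    refine ⟨⟨(ENNReal.coe_toNNReal h1.ne).symm, fun h3 => ?_⟩, h1⟩
    have h4 : X (ω, (T ω).toNNReal) = 0 := (hXC _).1 h3
    have h5 : (⨆ m, D m ω) ≤ T ω := by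
      refine iSup_le fun m => (min_le_left _ _).trans ?_
      rw [← ENNReal.coe_toNNReal h1.ne]
      refine iInf₂_le (T ω).toNNReal ?_
      show X (ω, (T ω).toNNReal) < c m
      rw [h4]; exact hc0 m
    rw [h2, top_le_iff] at h5
    exact h1.ne h5

theorem Good.sec_levels (h : Good Λ) (P : Measure Ω) [IsFiniteMeasure P] {z : Ω × ℝ≥0 → ℝ≥0∞}
    (hz : Measurable[Λ] z) {D : Ω → ℝ≥0∞} {E : Set Ω} {H : ℕ → Set Ω} (hD : OT Λ D)
    (hE : MeasurableSet[Λ] {p : Ω × ℝ≥0 | p.1 ∈ E ∧ D p.1 < p.2}) (n : ℕ)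
    (hH : ∀ j < n, MeasurableSet[Λ] {p : Ω × ℝ≥0 | p.1 ∈ H j ∧ D p.1 < p.2})
    {η : ℝ≥0∞} (hη : η ≠ 0) : ∃ τ : Ω → ℝ≥0∞, IsStoppingTimeM Λ τ ∧
      (∀ ω, τ ω ≠ ∞ → ω ∈ E ∧ D ω < τ ω ∧
        ∀ j < n, ω ∈ H j → (dq j : ℝ≥0∞) ≤ z (ω, (τ ω).toNNReal)) ∧
      P {ω | ω ∈ E ∧ D ω < ∞ ∧ (∀ j < n, ω ∈ H j → ∃ s : ℝ≥0, D ω < s ∧ (dq j : ℝ≥0∞) ≤ z (ω, s)) ∧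
        τ ω = ∞} ≤ η := by
  let B : Set (Ω × ℝ≥0) := {p | (p.1 ∈ E ∧ D p.1 < p.2) ∧ ∀ j < n, p.1 ∈ H j → (dq j : ℝ≥0∞) ≤ z p}
  have hB : MeasurableSet[Λ] B := by
    have : B = {p | p.1 ∈ E ∧ D p.1 < p.2} ∩ ⋂ j, ⋂ (_ : j < n),
        ({p | p.1 ∈ H j ∧ D p.1 < p.2}ᶜ ∪ {p | (dq j : ℝ≥0∞) ≤ z p}) := by
      ext p
      simp only [B, mem_ofPred_eq, mem_inter_iff, mem_iInter, mem_union, mem_compl_iff]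
      constructor
      · rintro ⟨h1, h2⟩
        exact ⟨h1, fun j hj => by
          by_cases h3 : p.1 ∈ H j
          · exact Or.inr (h2 j hj h3)
          · exact Or.inl fun h4 => h3 h4.1⟩
      · rintro ⟨h1, h2⟩
        exact ⟨h1, fun j hj h3 => (h2 j hj).resolve_left fun h4 => h4 ⟨h3, h1.2⟩⟩
    rw [this]
    exact MeasurableSet.inter hE (MeasurableSet.iInter fun j => MeasurableSet.iInter fun hj =>
      (hH j hj).compl.union (measurableSet_le measurable_const hz))
  obtain ⟨τ, h1, h2, h3⟩ := h.section P hB hη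
  refine ⟨τ, h1, fun ω hω => ?_, le_trans (measure_mono ?_) h3⟩
  · have h4 := h2 ω (τ ω).toNNReal (ENNReal.coe_toNNReal hω).symm
    have h5 : (D ω < ((τ ω).toNNReal : ℝ≥0∞)) := h4.1.2
    rw [ENNReal.coe_toNNReal hω] at h5
    exact ⟨h4.1.1, h5, h4.2⟩
  · rintro ω ⟨h4, h5, h6, h7⟩
    refine ⟨?_, h7⟩
    let J := (Finset.range n).filter fun j => ω ∈ H j
    rcases J.eq_empty_or_nonempty with hJ | hJ
    · obtain ⟨k, hk, -⟩ := exists_dense_btwn h5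
      refine ⟨dq k, ⟨⟨h4, hk⟩, fun j hj hjH => ?_⟩⟩
      have : j ∈ J := Finset.mem_filter.2 ⟨Finset.mem_range.2 hj, hjH⟩
      rw [hJ] at this; exact absurd this (Finset.notMem_empty _)
    · obtain ⟨i, hi, hmax⟩ := Finset.exists_max_image J dq hJ
      rw [Finset.mem_filter, Finset.mem_range] at hi
      obtain ⟨s, hs1, hs2⟩ := h6 i hi.1 hi.2
      refine ⟨s, ⟨⟨h4, hs1⟩, fun j hj hjH => ?_⟩⟩
      exact (ENNReal.coe_le_coe.2 (hmax j (Finset.mem_filter.2 ⟨Finset.mem_range.2 hj, hjH⟩))).trans hs2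

theorem Good.clmem (h : Good Λ) {T : Ω → ℝ≥0∞} (hT : OT Λ T) {A : Set Ω}
    (hA : MeasurableSet[sigmaAtCl (FplusLambda Λ) T] A) :
    MeasurableSet[Λ] {p : Ω × ℝ≥0 | p.1 ∈ A ∧ T p.1 < p.2} := by
  refine h.after_of_lt fun q => ?_
  induction A, hA using MeasurableSpace.generateFrom_induction with
  | hC A hA _ =>
    have : {ω | ω ∈ A ∧ T ω < q} = ⋃ k, ⋃ (_ : dq k < q), (A ∩ {ω | T ω ≤ dq k}) := by
      ext ω
      simp only [mem_ofPred_eq, mem_iUnion, mem_inter_iff]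
      constructor
      · rintro ⟨h1, h2⟩
        obtain ⟨k, hk, hk2⟩ := exists_dense_btwn h2
        exact ⟨k, ENNReal.coe_lt_coe.1 hk2, h1, hk.le⟩
      · rintro ⟨k, hk, h1, h2⟩
        exact ⟨h1, h2.trans_lt (ENNReal.coe_lt_coe.2 hk)⟩
    rw [this]
    exact MeasurableSet.iUnion fun k => MeasurableSet.iUnion fun hk => h.fplus_le hk _ (hA _)
  | empty => simp
  | compl A _ hA =>
    have : {ω | ω ∈ Aᶜ ∧ T ω < q} = {ω | T ω < q} \ {ω | ω ∈ A ∧ T ω < q} := by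
      ext ω; simp only [mem_ofPred_eq, mem_compl_iff, Set.mem_sdiff]; tauto
    rw [this]
    exact MeasurableSet.diff (h.OT_lt hT le_rfl) hA
  | iUnion f _ hf =>
    have : {ω | ω ∈ ⋃ i, f i ∧ T ω < q} = ⋃ i, {ω | ω ∈ f i ∧ T ω < q} := by
      ext ω; simp
    rw [this]
    exact MeasurableSet.iUnion hf

theorem Good.lt_after (h : Good Λ) {K D : Ω → ℝ≥0∞} (hK : OT Λ K) (hD : OT Λ D) :
    MeasurableSet[Λ] {p : Ω × ℝ≥0 | p.1 ∈ {ω | K ω ≤ D ω} ∧ D p.1 < p.2} := by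
  refine h.after_of_lt fun q => ?_
  have : {ω | ω ∈ {ω | K ω ≤ D ω} ∧ D ω < q} = {ω | min (K ω) q ≤ min (D ω) q} ∩ {ω | D ω < q} := by
    ext ω
    simp only [mem_ofPred_eq, mem_inter_iff]
    refine and_congr_left fun h1 => ?_
    rw [min_eq_left h1.le, min_le_iff, or_iff_left (not_le.2 h1)]
  rw [this]
  exact (measurableSet_le (h.OT_min_meas hK q) (h.OT_min_meas hD q)).inter (h.OT_lt hD le_rfl)

theorem Good.right_time (h : Good Λ) (P : Measure Ω) [IsFiniteMeasure P] {z : Ω × ℝ≥0 → ℝ≥0∞}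
    (hz : Measurable[Λ] z) {T : Ω → ℝ≥0∞} {W : Set Ω} (hT : OT Λ T)
    (hW : MeasurableSet[Λ] {p : Ω × ℝ≥0 | p.1 ∈ W ∧ T p.1 < p.2}) (n : ℕ)
    {η : ℝ≥0∞} (hη : η ≠ 0) : ∃ τ : Ω → ℝ≥0∞, IsStoppingTimeM Λ τ ∧
      (∀ ω, τ ω ≠ ∞ → ω ∈ W ∧ T ω < τ ω) ∧
      P {ω | ω ∈ W ∧ T ω < ∞ ∧ (τ ω = ∞ ∨ ∃ j < n, (dq j : ℝ≥0∞) <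
        limsup (fun s => z (ω, s)) (𝓝[>] (T ω).toNNReal) ∧ z (ω, (τ ω).toNNReal) < dq j)} ≤ η := by
  have hB : ∀ j, MeasurableSet[Λ] {p : Ω × ℝ≥0 | T p.1 < p.2 ∧ (dq j : ℝ≥0∞) ≤ z p} := fun j =>
    MeasurableSet.inter hT (measurableSet_le measurable_const hz)
  choose K hK1 hK2 hK3 using fun j => h.exists_debut P (hB j)
  obtain ⟨τ, h1, h2, h3⟩ := h.sec_levels P hz hT hW n (H := fun j => {ω | K j ω ≤ T ω})
    (fun j _ => h.lt_after (hK1 j) hT) hη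
  refine ⟨τ, h1, fun ω hω => ⟨(h2 ω hω).1, (h2 ω hω).2.1⟩, le_trans (measure_mono_ae ?_) h3⟩
  filter_upwards [ae_all_iff.2 hK3] with ω hω
  rintro ⟨h4, h5, h6⟩
  have h7 : τ ω = ∞ := by
    by_contra hne
    obtain ⟨j, hj, hj1, hj2⟩ := h6.resolve_left hne
    refine absurd hj2 (not_lt.2 ((h2 ω hne).2.2 j hj ?_))
    show K j ω ≤ T ω
    refine (hK2 j ω).trans (le_of_forall_gt fun a ha => ?_)
    have hf := frequently_lt_of_lt_limsup (by isBoundedDefault) hj1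
    have hev : ∀ᶠ s : ℝ≥0 in 𝓝[>] (T ω).toNNReal, T ω < s ∧ (s : ℝ≥0∞) < a := by
      have e1 : ∀ᶠ s : ℝ≥0 in 𝓝[>] (T ω).toNNReal, (s : ℝ≥0∞) < a := by
        refine mem_nhdsWithin_of_mem_nhds ?_
        refine ENNReal.continuous_coe.continuousAt.eventually (gt_mem_nhds ?_)
        rwa [ENNReal.coe_toNNReal h5.ne]
      filter_upwards [e1, self_mem_nhdsWithin] with s hs1 hs2
      refine ⟨?_, hs1⟩
      rw [← ENNReal.coe_toNNReal h5.ne]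
      exact ENNReal.coe_lt_coe.2 hs2
    obtain ⟨s, hs1, hs2, hs3⟩ := (hf.and_eventually hev).exists
    exact debut_lt_iff.2 ⟨s, ⟨hs2, hs1.le⟩, hs3⟩
  refine ⟨h4, h5, fun j hj hjH => ?_, h7⟩
  have h8 : debut {p : Ω × ℝ≥0 | T p.1 < p.2 ∧ (dq j : ℝ≥0∞) ≤ z p} ω < ∞ := by
    rw [← hω j]; exact lt_of_le_of_lt hjH h5
  obtain ⟨s, hs, -⟩ := debut_lt_iff.1 h8
  exact ⟨s, hs⟩

theorem approx_iSup (P : Measure Ω) [IsFiniteMeasure P] {𝒜 : ℕ → MeasurableSpace Ω} (hm : Monotone 𝒜)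
    (hle : ∀ n, 𝒜 n ≤ mΩ) {A : Set Ω} (hA : MeasurableSet[⨆ n, 𝒜 n] A) {η : ℝ≥0∞} (hη : η ≠ 0) :
    ∃ N A', MeasurableSet[𝒜 N] A' ∧ P (A ∆ A') ≤ η := by
  have hle' : (⨆ n, 𝒜 n) ≤ mΩ := iSup_le hle
  have hd := @Measure.MeasureDense.of_generateFrom_isSetAlgebra_finite Ω (⨆ n, 𝒜 n) (P.trim hle')
    {s | ∃ n, MeasurableSet[𝒜 n] s} _
    ⟨⟨0, @MeasurableSet.empty _ (𝒜 0)⟩, fun s ⟨n, hs⟩ => ⟨n, @MeasurableSet.compl _ _ (𝒜 n) hs⟩,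
      fun s t ⟨n, hs⟩ ⟨k, ht⟩ => ⟨max n k, @MeasurableSet.union _ (𝒜 (max n k)) _ _
        (hm (le_max_left n k) _ hs) (hm (le_max_right n k) _ ht)⟩⟩
    (MeasurableSpace.measurableSpace_iSup_eq 𝒜)
  have hη' : min η 1 ≠ ∞ := ne_top_of_le_ne_top ENNReal.one_ne_top (min_le_right _ _)
  have hη0 : 0 < min η 1 := lt_min (pos_iff_ne_zero.2 hη) zero_lt_one
  obtain ⟨t, ⟨N, ht⟩, hlt⟩ := @Measure.MeasureDense.approx Ω (⨆ n, 𝒜 n) _ _ hd A hA (@measure_ne_top _ (⨆ n, 𝒜 n) _ _ A) _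
    (ENNReal.toReal_pos hη0.ne' hη')
  refine ⟨N, t, ht, ?_⟩
  have hts : MeasurableSet[⨆ n, 𝒜 n] t := le_iSup 𝒜 N _ ht
  rw [trim_measurableSet_eq hle' (@MeasurableSet.symmDiff _ (⨆ n, 𝒜 n) _ _ hA hts),
    ENNReal.ofReal_toReal hη'] at hlt
  exact hlt.le.trans (min_le_left _ _)

/-- Events known strictly after `D`. -/
def afterSF {D : Ω → ℝ≥0∞} (hD : OT Λ D) : MeasurableSpace Ω where
  MeasurableSet' A := MeasurableSet[mΩ] A ∧ MeasurableSet[Λ] {p : Ω × ℝ≥0 | p.1 ∈ A ∧ D p.1 < p.2}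
  measurableSet_empty := by simp
  measurableSet_compl A hA := by
    refine ⟨hA.1.compl, ?_⟩
    have : {p : Ω × ℝ≥0 | p.1 ∈ Aᶜ ∧ D p.1 < p.2} =
        {p : Ω × ℝ≥0 | D p.1 < p.2} \ {p : Ω × ℝ≥0 | p.1 ∈ A ∧ D p.1 < p.2} := by
      ext p; simp only [mem_ofPred_eq, mem_compl_iff, Set.mem_sdiff]; tauto
    rw [this]
    exact MeasurableSet.diff hD hA.2
  measurableSet_iUnion f hf := by
    refine ⟨MeasurableSet.iUnion fun i => (hf i).1, ?_⟩
    have : {p : Ω × ℝ≥0 | p.1 ∈ ⋃ i, f i ∧ D p.1 < p.2} =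
        ⋃ i, {p : Ω × ℝ≥0 | p.1 ∈ f i ∧ D p.1 < p.2} := by
      ext p; simp
    rw [this]
    exact MeasurableSet.iUnion fun i => (hf i).2

theorem afterSF_mono {D D' : Ω → ℝ≥0∞} (hD : OT Λ D) (hD' : OT Λ D') (hle : ∀ ω, D ω ≤ D' ω) :
    afterSF hD ≤ afterSF hD' := by
  rintro A ⟨h1, h2⟩
  refine ⟨h1, ?_⟩
  have : {p : Ω × ℝ≥0 | p.1 ∈ A ∧ D' p.1 < p.2} =
      {p : Ω × ℝ≥0 | p.1 ∈ A ∧ D p.1 < p.2} ∩ {p : Ω × ℝ≥0 | D' p.1 < p.2} := by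
    ext p; simp only [mem_ofPred_eq, mem_inter_iff]
    constructor
    · rintro ⟨h1, h2⟩; exact ⟨⟨h1, (hle _).trans_lt h2⟩, h2⟩
    · rintro ⟨h1, h2⟩; exact ⟨h1.1, h2⟩
  rw [this]
  exact MeasurableSet.inter h2 hD'

theorem Good.afterSF_of_fplus (h : Good Λ) {D : Ω → ℝ≥0∞} (hD : OT Λ D) {q : ℝ≥0} {B : Set Ω}
    (hB : MeasurableSet[FplusLambda Λ q] B) : MeasurableSet[afterSF hD] (B ∩ {ω | (q:ℝ≥0∞) < D ω}) := by
  refine ⟨(h.fplus_le_top q _ hB).inter (measurableSet_lt measurable_const (h.OT_meas hD)), ?_⟩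
  refine h.after_of_lt fun r => ?_
  by_cases hqr : q < r
  · have : {ω | ω ∈ B ∩ {ω | (q:ℝ≥0∞) < D ω} ∧ D ω < r} =
        B ∩ {ω | (q:ℝ≥0∞) < min (D ω) r} ∩ {ω | D ω < r} := by
      ext ω
      simp only [mem_ofPred_eq, mem_inter_iff, lt_min_iff, ENNReal.coe_lt_coe]
      tauto
    rw [this]
    exact ((h.fplus_le hqr _ hB).inter (measurableSet_lt measurable_const (h.OT_min_meas hD r))).inter
      (h.OT_lt hD le_rfl)
  · have : {ω | ω ∈ B ∩ {ω | (q:ℝ≥0∞) < D ω} ∧ D ω < r} = ∅ := by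
      ext ω
      simp only [mem_ofPred_eq, mem_inter_iff, mem_empty_iff_false, iff_false]
      rintro ⟨⟨-, h1⟩, h2⟩
      exact hqr (ENNReal.coe_lt_coe.1 (h1.trans h2))
    rw [this]
    exact @MeasurableSet.empty _ (sigmaAt Λ r)

theorem OT_max {S T : Ω → ℝ≥0∞} (hS : OT Λ S) (hT : OT Λ T) : OT Λ fun ω => max (S ω) (T ω) := by
  have : {p : Ω × ℝ≥0 | max (S p.1) (T p.1) < (p.2:ℝ≥0∞)} = {p | S p.1 < p.2} ∩ {p | T p.1 < p.2} := by
    ext p; simp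
  unfold OT
  rw [this]
  exact MeasurableSet.inter hS hT

/-- The filter of left neighbourhoods (of `∞` if needed). -/
def leftF (t : ℝ≥0∞) : Filter ℝ≥0 := if t = ∞ then atTop else 𝓝[<] t.toNNReal

theorem leftF_ev {a t : ℝ≥0∞} (h : a < t) : ∀ᶠ s : ℝ≥0 in leftF t, a < s ∧ (s:ℝ≥0∞) < t := by
  unfold leftF
  split_ifs with ht
  · rw [ht] at h ⊢
    filter_upwards [eventually_gt_atTop a.toNNReal] with s hs
    refine ⟨?_, ENNReal.coe_lt_top⟩
    rw [← ENNReal.coe_toNNReal h.ne]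
    exact ENNReal.coe_lt_coe.2 hs
  · have e1 : ∀ᶠ s : ℝ≥0 in 𝓝[<] t.toNNReal, a < (s : ℝ≥0∞) := by
      refine mem_nhdsWithin_of_mem_nhds ?_
      refine ENNReal.continuous_coe.continuousAt.eventually (lt_mem_nhds ?_)
      rwa [ENNReal.coe_toNNReal ht]
    filter_upwards [e1, self_mem_nhdsWithin] with s hs1 hs2
    refine ⟨hs1, ?_⟩
    rw [← ENNReal.coe_toNNReal ht]
    exact ENNReal.coe_lt_coe.2 hs2

theorem Good.left_time (h : Good Λ) (P : Measure Ω) [IsFiniteMeasure P] {z : Ω × ℝ≥0 → ℝ≥0∞}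
    (hz : Measurable[Λ] z) {S T : Ω → ℝ≥0∞} {Wm : Set Ω} (hS : OT Λ S) (hT : OT Λ T)
    (hWm : MeasurableSet[sigmaPre (FplusLambda Λ) T] Wm)
    (hp : IsStoppingTimeM (predSF (FplusLambda Λ)) (restrictST T Wm))
    (hpos : ∀ ω ∈ Wm, T ω ≠ 0) (hST : ∀ ω ∈ Wm, S ω < T ω) (n : ℕ)
    {η : ℝ≥0∞} (hη : η ≠ 0) : ∃ τ : Ω → ℝ≥0∞, IsStoppingTimeM Λ τ ∧ (∀ ω, S ω ≤ τ ω) ∧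
      P {ω | (τ ω ≠ ∞ ∧ ω ∉ Wm) ∨ (ω ∈ Wm ∧ (τ ω = ∞ ∨ ∃ j < n, (dq j : ℝ≥0∞) <
        limsup (fun s => z (ω, s)) (leftF (T ω)) ∧ z (ω, (τ ω).toNNReal) < dq j))} ≤ η := by
  have hη3 : η / 3 ≠ 0 := by simp [ENNReal.div_eq_zero_iff, hη]
  obtain ⟨D, hD1, hD2, hD3, hD4, hD5, hD6⟩ := h.foretell P hp (fun ω => by
    unfold restrictST
    split_ifs with hω
    · exact pos_iff_ne_zero.2 (hpos ω hω)
    · exact ENNReal.zero_lt_top) hη3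
  let D' : ℕ → Ω → ℝ≥0∞ := fun m ω => max (D m ω) (S ω)
  have hD' : ∀ m, OT Λ (D' m) := fun m => OT_max (hD1 m) hS
  have hD'm : ∀ m k, m ≤ k → ∀ ω, D' m ω ≤ D' k ω := fun m k hmk ω => max_le_max (hD2 hmk ω) le_rfl
  let U : Ω → ℝ≥0∞ := fun ω => ⨆ m, D' m ω
  let 𝒢 : ℕ → MeasurableSpace Ω := fun m => afterSF (hD' m)
  have h𝒢m : Monotone 𝒢 := fun m k hmk => afterSF_mono _ _ (hD'm m k hmk)
  have h𝒢le : ∀ m, 𝒢 m ≤ mΩ := fun m A hA => hA.1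
  have hU1 : ∀ (q : ℝ≥0) B, MeasurableSet[FplusLambda Λ q] B →
      MeasurableSet[⨆ m, 𝒢 m] (B ∩ {ω | (q:ℝ≥0∞) < U ω}) := by
    intro q B hB
    have : B ∩ {ω | (q:ℝ≥0∞) < U ω} = ⋃ m, (B ∩ {ω | (q:ℝ≥0∞) < D' m ω}) := by
      ext ω
      simp [U, lt_iSup_iff]
    rw [this]
    exact MeasurableSet.iUnion fun m => le_iSup 𝒢 m _ (h.afterSF_of_fplus (hD' m) hB)
  -- times before
  have hdk : ∀ (m : ℕ) (a : ℝ≥0), MeasurableSet[⨆ m, 𝒢 m] {ω | D m ω < a} := by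
    intro m a
    refine le_iSup 𝒢 m _ ⟨measurableSet_lt (h.OT_meas (hD1 m)) measurable_const, ?_⟩
    refine h.after_of_lt fun q => ?_
    have : {ω | ω ∈ {ω | D m ω < a} ∧ D' m ω < q} = {ω | D m ω < (min a q : ℝ≥0)} ∩ {ω | D' m ω < q} := by
      ext ω
      simp only [mem_ofPred_eq, mem_inter_iff, ENNReal.coe_min, lt_min_iff, D', max_lt_iff]
      tauto
    rw [this]
    exact (h.OT_lt (hD1 m) (min_le_right _ _)).inter (h.OT_lt (hD' m) le_rfl)
  have hDfin : MeasurableSet[⨆ m, 𝒢 m] {ω | (⨆ m, D m ω) < ∞} := by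
    have : {ω | (⨆ m, D m ω) < ∞} = ⋃ k : ℕ, ⋂ m, {ω | D m ω < ((k : ℝ≥0) : ℝ≥0∞)} := by
      ext ω
      simp only [mem_ofPred_eq, mem_iUnion, mem_iInter]
      constructor
      · intro h1
        obtain ⟨k, hk⟩ := ENNReal.exists_nat_gt h1.ne
        exact ⟨k, fun m => (le_iSup (fun m => D m ω) m).trans_lt (by simpa using hk)⟩
      · rintro ⟨k, hk⟩
        exact lt_of_le_of_lt (iSup_le fun m => (hk m).le) ENNReal.coe_lt_top
    rw [this]
    exact MeasurableSet.iUnion fun k => MeasurableSet.iInter fun m => hdk m k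
  have hTU : ∀ ω, T ω = ∞ → U ω = ∞ := by
    intro ω hω
    have h1 : (⨆ m, D m ω) = ∞ := by
      rcases hD5 ω with h1 | h1
      · exact h1
      · rw [h1]; unfold restrictST; rw [hω]; simp
    refine top_le_iff.1 ?_
    rw [← h1]
    exact iSup_mono fun m => le_max_left _ _
  have hTc : ∀ q : ℝ≥0, MeasurableSet[FplusLambda Λ q] {ω | (q:ℝ≥0∞) < T ω} := fun q => by
    have := (h.OT_iff_cl.2 hT q).compl
    convert this using 1
    ext ω; simp
  have hTinf : MeasurableSet[⨆ m, 𝒢 m] {ω | T ω = ∞} := by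
    have : {ω | T ω = ∞} = ⋂ k : ℕ, ({ω | (((k:ℝ≥0)):ℝ≥0∞) < T ω} ∩ {ω | ((k:ℝ≥0):ℝ≥0∞) < U ω}) := by
      ext ω
      simp only [mem_ofPred_eq, mem_iInter, mem_inter_iff]
      constructor
      · intro h1 k
        rw [h1, hTU ω h1]; simp
      · intro h1
        by_contra hne
        obtain ⟨k, hk⟩ := ENNReal.exists_nat_gt hne
        exact absurd (h1 k).1 (not_lt.2 (by simpa using hk.le))
    rw [this]
    exact MeasurableSet.iInter fun k => hU1 _ _ (hTc _)
  have hpre : MeasurableSet[⨆ m, 𝒢 m] (Wm ∩ {ω | T ω = ∞}) := by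
    have key : ∀ A, MeasurableSet[sigmaPre (FplusLambda Λ) T] A →
        MeasurableSet[⨆ m, 𝒢 m] (A ∩ {ω | T ω = ∞}) := by
      intro A hA
      induction A, hA using MeasurableSpace.generateFrom_induction with
      | hC A hA _ =>
        rcases hA with hA | ⟨q, B, hB, rfl⟩
        · have : A ∩ {ω | T ω = ∞} = (A ∩ {ω | ((0:ℝ≥0):ℝ≥0∞) < U ω}) ∩ {ω | T ω = ∞} := by
            ext ω
            simp only [mem_inter_iff, mem_ofPred_eq]
            constructor
            · rintro ⟨h1, h2⟩; exact ⟨⟨h1, by rw [hTU ω h2]; exact ENNReal.coe_lt_top⟩, h2⟩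
            · rintro ⟨⟨h1, -⟩, h2⟩; exact ⟨h1, h2⟩
          rw [this]
          exact MeasurableSet.inter (hU1 0 A hA) hTinf
        · have : B ∩ {ω | (q:ℝ≥0∞) < T ω} ∩ {ω | T ω = ∞} = (B ∩ {ω | (q:ℝ≥0∞) < U ω}) ∩ {ω | T ω = ∞} := by
            ext ω
            simp only [mem_inter_iff, mem_ofPred_eq]
            constructor
            · rintro ⟨⟨h1, -⟩, h2⟩; exact ⟨⟨h1, by rw [hTU ω h2]; exact ENNReal.coe_lt_top⟩, h2⟩
            · rintro ⟨⟨h1, -⟩, h2⟩; exact ⟨⟨h1, by rw [h2]; exact ENNReal.coe_lt_top⟩, h2⟩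
          rw [this]
          exact MeasurableSet.inter (hU1 q B hB) hTinf
      | empty => simp
      | compl A _ hA =>
        have : Aᶜ ∩ {ω | T ω = ∞} = {ω | T ω = ∞} \ (A ∩ {ω | T ω = ∞}) := by
          ext ω; simp only [mem_inter_iff, mem_compl_iff, Set.mem_sdiff]; tauto
        rw [this]
        exact MeasurableSet.diff hTinf hA
      | iUnion f _ hf =>
        rw [iUnion_inter]
        exact MeasurableSet.iUnion hf
    exact key Wm hWm
  let E : Set Ω := {ω | (⨆ m, D m ω) < ∞} ∪ (Wm ∩ {ω | T ω = ∞})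
  have hE : MeasurableSet[⨆ m, 𝒢 m] E := MeasurableSet.union hDfin hpre
  have hEW : ∀ ω ∈ E, ω ∈ Wm ∧ U ω = T ω ∧ ∀ m, D' m ω < U ω := by
    rintro ω (h1 | ⟨h1, h2⟩)
    · have h1 : (⨆ m, D m ω) < ∞ := h1
      have h3 := (hD5 ω).resolve_left h1.ne
      have h4 : ω ∈ Wm := by
        by_contra h4
        rw [h3] at h1
        simp [restrictST, h4] at h1
      have h5 : (⨆ m, D m ω) = T ω := by rw [h3]; simp [restrictST, h4]
      have hU : U ω = T ω := by
        refine le_antisymm (iSup_le fun m => max_le ?_ (hST ω h4).le) ?_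
        · rw [← h5]; exact le_iSup (fun m => D m ω) m
        · rw [← h5]; exact iSup_mono fun m => le_max_left _ _
      refine ⟨h4, hU, fun m => ?_⟩
      rw [hU]
      exact max_lt (h5 ▸ hD4 m ω) (hST ω h4)
    · have h2 : T ω = ∞ := h2
      refine ⟨h1, by rw [h2, hTU ω h2], fun m => ?_⟩
      rw [hTU ω h2]
      exact max_lt ((hD3 m ω).trans_lt (ENNReal.natCast_lt_top m)) (h2 ▸ hST ω h1)
  -- levels
  have hB : ∀ m j, MeasurableSet[Λ] {p : Ω × ℝ≥0 | D' m p.1 < p.2 ∧ (dq j : ℝ≥0∞) ≤ z p} := fun m j =>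
    MeasurableSet.inter (hD' m) (measurableSet_le measurable_const hz)
  choose K hK1 hK2 hK3 using fun m j => h.exists_debut P (hB m j)
  let H : ℕ → Set Ω := fun j => {ω | ∀ m, K m j ω < U ω}
  have hH : ∀ j, MeasurableSet[⨆ m, 𝒢 m] (H j) := by
    intro j
    have : H j = ⋂ m, ⋃ k, ({ω | K m j ω < dq k} ∩ {ω | (dq k : ℝ≥0∞) < U ω}) := by
      ext ω
      simp only [H, mem_ofPred_eq, mem_iInter, mem_iUnion, mem_inter_iff]
      refine forall_congr' fun m => ⟨fun h1 => ?_, fun ⟨k, h1, h2⟩ => h1.trans h2⟩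
      exact exists_dense_btwn h1
    rw [this]
    exact MeasurableSet.iInter fun m => MeasurableSet.iUnion fun k => hU1 _ _
      (h.sigmaAt_le_fplus _ _ (h.OT_lt (hK1 m j) le_rfl))
  let G : ℕ → Set Ω := fun j => Nat.casesOn j E H
  have hG : ∀ j, MeasurableSet[⨆ m, 𝒢 m] (G j) := by
    rintro (_ | j)
    · exact hE
    · exact hH j
  have hηn : η / 3 / (n + 1 : ℕ) ≠ 0 := by
    rw [Ne, ENNReal.div_eq_zero_iff]
    push Not
    exact ⟨hη3, ENNReal.natCast_ne_top _⟩
  choose M G' hG'1 hG'2 using fun j => approx_iSup P h𝒢m h𝒢le (hG j) hηn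
  let N := (Finset.range (n+1)).sup M
  have hMN : ∀ j < n + 1, M j ≤ N := fun j hj => Finset.le_sup (f := M) (Finset.mem_range.2 hj)
  have hG'3 : ∀ j < n + 1, MeasurableSet[𝒢 N] (G' j) := fun j hj => h𝒢m (hMN j hj) _ (hG'1 j)
  obtain ⟨τ, hτ1, hτ2, hτ3⟩ := h.sec_levels P hz (hD' N) (hG'3 0 (Nat.succ_pos n)).2 n
    (H := fun j => G' (j+1)) (fun j hj => (hG'3 (j+1) (Nat.succ_lt_succ hj)).2) hη3
  refine ⟨τ, hτ1, fun ω => ?_, ?_⟩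
  · by_cases hω : τ ω = ∞
    · rw [hω]; exact le_top
    · exact (le_max_right _ _).trans (hτ2 ω hω).2.1.le
  have hsd : P (⋃ j ∈ Finset.range (n+1), G j ∆ G' j) ≤ η / 3 := by
    refine (measure_biUnion_finset_le _ _).trans ((Finset.sum_le_sum fun j _ => hG'2 j).trans ?_)
    rw [Finset.sum_const, Finset.card_range, nsmul_eq_mul]
    exact ENNReal.mul_div_le
  have htot : P (({ω | restrictST T Wm ω < ∞ ∧ (⨆ m, D m ω) = ∞} ∪
      (⋃ j ∈ Finset.range (n+1), G j ∆ G' j)) ∪ {ω | ω ∈ G' 0 ∧ D' N ω < ∞ ∧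
      (∀ j < n, ω ∈ G' (j+1) → ∃ s : ℝ≥0, D' N ω < s ∧ (dq j : ℝ≥0∞) ≤ z (ω, s)) ∧ τ ω = ∞}) ≤ η := by
    refine (measure_union_le _ _).trans ((add_le_add ((measure_union_le _ _).trans
      (add_le_add hD6 hsd)) hτ3).trans ?_)
    rw [ENNReal.add_thirds]
  refine le_trans (measure_mono_ae ?_) htot
  filter_upwards [ae_all_iff.2 fun m => ae_all_iff.2 (hK3 m)] with ω hω hbad
  by_contra hnot
  have hnot : ω ∉ (({ω | restrictST T Wm ω < ∞ ∧ (⨆ m, D m ω) = ∞} ∪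
      (⋃ j ∈ Finset.range (n+1), G j ∆ G' j)) ∪ {ω | ω ∈ G' 0 ∧ D' N ω < ∞ ∧
      (∀ j < n, ω ∈ G' (j+1) → ∃ s : ℝ≥0, D' N ω < s ∧ (dq j : ℝ≥0∞) ≤ z (ω, s)) ∧ τ ω = ∞}) := hnot
  simp only [mem_union, not_or] at hnot
  obtain ⟨⟨n1, n2⟩, n3⟩ := hnot
  have n2' : ∀ j < n + 1, (ω ∈ G j ↔ ω ∈ G' j) := by
    intro j hj
    by_contra hc
    refine n2 (mem_biUnion (Finset.mem_coe.2 (Finset.mem_range.2 hj)) ?_)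
    rw [Set.mem_symmDiff]; tauto
  have hEG : ω ∈ E ↔ ω ∈ G' 0 := n2' 0 (Nat.succ_pos n)
  have hHG : ∀ j < n, (ω ∈ H j ↔ ω ∈ G' (j+1)) := fun j hj => n2' (j+1) (Nat.succ_lt_succ hj)
  rcases hbad with ⟨b1, b2⟩ | ⟨b1, b2⟩
  · exact b2 (hEW ω (hEG.2 (hτ2 ω b1).1)).1
  · have hωE : ω ∈ E := by
      by_contra hc
      have c1 : ¬ (⨆ m, D m ω) < ∞ := fun c => hc (Or.inl c)
      have c2 : T ω ≠ ∞ := fun c => hc (Or.inr ⟨b1, c⟩)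
      refine n1 ⟨?_, ?_⟩
      · simpa [restrictST, b1] using lt_top_iff_ne_top.2 c2
      · simpa using c1
    obtain ⟨-, hUT, hlt⟩ := hEW ω hωE
    rcases b2 with b2 | ⟨j, hj, hj1, hj2⟩
    · refine n3 ⟨hEG.1 hωE, (hlt N).trans_le le_top, fun j hj hjG => ?_, b2⟩
      have h8 := ((hHG j hj).2 hjG) N
      rw [hω N j] at h8
      obtain ⟨s, hs, -⟩ := debut_lt_iff.1 h8
      exact ⟨s, hs⟩
    · by_cases hne : τ ω = ∞
      · refine n3 ⟨hEG.1 hωE, (hlt N).trans_le le_top, fun j hj hjG => ?_, hne⟩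
        have h8 := ((hHG j hj).2 hjG) N
        rw [hω N j] at h8
        obtain ⟨s, hs, -⟩ := debut_lt_iff.1 h8
        exact ⟨s, hs⟩
      · refine absurd hj2 (not_lt.2 ((hτ2 ω hne).2.2 j hj ((hHG j hj).1 fun m => ?_)))
        rw [hω m j]
        have hf := frequently_lt_of_lt_limsup (by isBoundedDefault) hj1
        obtain ⟨s, hs1, hs2, hs3⟩ := (hf.and_eventually (leftF_ev (hUT ▸ hlt m))).exists
        exact debut_lt_iff.2 ⟨s, ⟨hs2, hs1.le⟩, hUT ▸ hs3⟩

/-- Extended-valued version of `divEval`. -/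
def limE (Z : Ω × ℝ≥0∞ → ℝ) (T : Ω → ℝ≥0∞) (Wm W : Set Ω) (ω : Ω) : ℝ≥0∞ :=
  if ω ∈ Wm then limsup (fun s : ℝ≥0 => ENNReal.ofReal (Z (ω, s))) (leftF (T ω))
  else if ω ∈ W then ENNReal.ofReal (Z (ω, T ω))
  else limsup (fun s : ℝ≥0 => ENNReal.ofReal (Z (ω, s))) (𝓝[>] (T ω).toNNReal)

theorem limsup_ofReal_aux {f : Filter ℝ≥0} [f.NeBot] {x : ℝ≥0 → ℝ} (hx : ∀ s, 0 ≤ x s)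
    (hfin : limsup (fun s => ENNReal.ofReal (x s)) f ≠ ∞) :
    limsup x f = (limsup (fun s => ENNReal.ofReal (x s)) f).toReal := by
  obtain ⟨b, hb1, hb2⟩ := exists_between (lt_top_iff_ne_top.2 hfin)
  have hev : ∀ᶠ s in f, ENNReal.ofReal (x s) ≤ b :=
    (eventually_lt_of_limsup_lt hb1 (by isBoundedDefault)).mono fun s hs => hs.le
  rw [← ENNReal.limsup_toReal_eq hb2.ne hev]
  congr 1
  ext s
  rw [ENNReal.toReal_ofReal (hx s)]

theorem divEval_eq {Z : Ω × ℝ≥0∞ → ℝ} (hpos : ∀ p, 0 ≤ Z p) {T : Ω → ℝ≥0∞} {Wm W Wp : Set Ω}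
    (hσ : IsDividedST Λ T Wm W Wp) {ω : Ω} (hfin : limE Z T Wm W ω ≠ ∞) :
    divEval Z T Wm W Wp ω = (limE Z T Wm W ω).toReal := by
  unfold divEval
  unfold limE at hfin ⊢
  split_ifs at hfin ⊢ with h1 h2
  · have hT0 : T ω ≠ 0 := fun h0 => by
      have : ω ∈ Wm ∩ {ω | T ω = 0} := ⟨h1, h0⟩
      rw [hσ.m_pos] at this; exact this
    unfold leftLimsup
    rw [if_neg hT0]
    unfold leftF at hfin ⊢
    split_ifs at hfin ⊢ with h3
    · exact limsup_ofReal_aux (fun s => hpos _) hfin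
    · have : (𝓝[<] (T ω).toNNReal).NeBot := by
        refine nhdsLT_neBot_of_exists_lt ⟨0, ?_⟩
        exact ENNReal.toNNReal_pos hT0 h3
      exact limsup_ofReal_aux (fun s => hpos _) hfin
  · rw [ENNReal.toReal_ofReal (hpos _)]
  · have hp : ω ∈ Wp := by
      have : ω ∈ Wm ∪ W ∪ Wp := hσ.cover ▸ mem_univ ω
      rcases this with (h | h) | h
      · exact absurd h h1
      · exact absurd h h2
      · exact h
    have hT : T ω ≠ ∞ := fun h0 => by
      have : ω ∈ Wp ∩ {ω | T ω = ∞} := ⟨hp, h0⟩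
      rw [hσ.p_fin] at this; exact this
    unfold rightLimsup
    rw [if_neg hT]
    exact limsup_ofReal_aux (fun s => hpos _) hfin

theorem Good.approx_time (h : Good Λ) (P : Measure Ω) [IsFiniteMeasure P] {Z : Ω × ℝ≥0∞ → ℝ}
    (hZm : MeasurableProcessE Λ Z) {S : Ω → ℝ≥0∞} (hS : IsStoppingTimeM Λ S)
    {T : Ω → ℝ≥0∞} {Wm W Wp : Set Ω} (hσ : IsDividedST Λ T Wm W Wp)
    (hST : ∀ ω, S ω ≤ T ω) (hSm : ∀ ω ∈ Wm, S ω < T ω) (n : ℕ) {η : ℝ≥0∞} (hη : η ≠ 0) :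
    ∃ ρ, IsStoppingTimeM Λ ρ ∧ S ≤ ρ ∧ P {ω | ∃ j < n, (dq j : ℝ≥0∞) < limE Z T Wm W ω ∧
      ENNReal.ofReal (EvalAt Z ρ ω) < dq j} ≤ η := by
  have hT : OT Λ T := h.OT_iff_cl.1 hσ.stopping
  have hz : Measurable[Λ] fun p : Ω × ℝ≥0 => ENNReal.ofReal (Z (p.1, (p.2 : ℝ≥0∞))) :=
    ENNReal.measurable_ofReal.comp hZm.1
  have hη2 : η / 2 ≠ 0 := by simp [ENNReal.div_eq_zero_iff, hη]
  obtain ⟨τp, p1, p2, p3⟩ := h.right_time P hz hT (h.clmem hT hσ.mem_p) n hη2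
  obtain ⟨τm, m1, m2, m3⟩ := h.left_time P hz (h.OT_of_ST hS) hT hσ.mem_m hσ.pred_m
    (fun ω hω h0 => by
      have : ω ∈ Wm ∩ {ω | T ω = 0} := ⟨hω, h0⟩
      rw [hσ.m_pos] at this; exact this) hSm n hη2
  have hmw : ∀ ω ∈ Wm, ω ∉ W := fun ω h1 h2 => by
    have : ω ∈ Wm ∩ W := ⟨h1, h2⟩
    rw [hσ.disj_mw] at this; exact this
  have hmp : ∀ ω ∈ Wm, ω ∉ Wp := fun ω h1 h2 => by
    have : ω ∈ Wm ∩ Wp := ⟨h1, h2⟩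
    rw [hσ.disj_mp] at this; exact this
  have hwp : ∀ ω ∈ W, ω ∉ Wp := fun ω h1 h2 => by
    have : ω ∈ W ∩ Wp := ⟨h1, h2⟩
    rw [hσ.disj_wp] at this; exact this
  have hpT : ∀ ω ∈ Wp, T ω < ∞ := fun ω h1 => lt_top_iff_ne_top.2 fun h0 => by
    have : ω ∈ Wp ∩ {ω | T ω = ∞} := ⟨h1, h0⟩
    rw [hσ.p_fin] at this; exact this
  refine ⟨_, ST_min hσ.st_w (ST_min p1 m1), fun ω => le_min ?_ (le_min ?_ (m2 ω)), ?_⟩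
  · unfold restrictST
    split_ifs
    · exact hST ω
    · exact le_top
  · by_cases h1 : τp ω = ∞
    · rw [h1]; exact le_top
    · exact (hST ω).trans (p2 ω h1).2.le
  refine le_trans (measure_mono ?_) ((measure_union_le _ _).trans ((add_le_add p3 m3).trans
    (ENNReal.add_halves η).le))
  rintro ω ⟨j, hj, hj1, hj2⟩
  by_contra hnot
  rw [mem_union, not_or] at hnot
  obtain ⟨n1, n2⟩ := hnot
  rw [mem_ofPred_eq, not_or] at n2
  replace hj2 : ENNReal.ofReal (Z (ω, min (restrictST T W ω) (min (τp ω) (τm ω)))) < dq j := hj2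
  unfold limE at hj1
  have hτm : ω ∉ Wm → τm ω = ∞ := fun h1 => by
    by_contra h2; exact n2.1 ⟨h2, h1⟩
  have hτp : ω ∉ Wp → τp ω = ∞ := fun h1 => by
    by_contra h2; exact h1 (p2 ω h2).1
  by_cases hm : ω ∈ Wm
  · rw [if_pos hm] at hj1
    have e1 : restrictST T W ω = ∞ := if_neg (hmw ω hm)
    rw [e1, hτp (hmp ω hm)] at hj2
    simp only [le_top, inf_of_le_right] at hj2
    have n3 : τm ω ≠ ∞ := fun h3 => n2.2 ⟨hm, Or.inl h3⟩
    exact n2.2 ⟨hm, Or.inr ⟨j, hj, hj1, by rwa [ENNReal.coe_toNNReal n3]⟩⟩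
  · rw [if_neg hm] at hj1
    by_cases hw : ω ∈ W
    · rw [if_pos hw] at hj1
      have e1 : restrictST T W ω = T ω := if_pos hw
      rw [e1, hτp (hwp ω hw), hτm hm] at hj2
      simp only [le_top, inf_of_le_left] at hj2
      exact lt_asymm hj1 hj2
    · rw [if_neg hw] at hj1
      have hp : ω ∈ Wp := by
        have : ω ∈ Wm ∪ W ∪ Wp := hσ.cover ▸ mem_univ ω
        rcases this with (h | h) | h
        · exact absurd h hm
        · exact absurd h hw
        · exact h
      have e1 : restrictST T W ω = ∞ := if_neg hw
      rw [e1, hτm hm] at hj2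
      simp only [le_top, inf_of_le_right, inf_of_le_left] at hj2
      have n3 : τp ω ≠ ∞ := fun h3 => n1 ⟨hp, hpT ω hp, Or.inl h3⟩
      exact n1 ⟨hp, hpT ω hp, Or.inr ⟨j, hj, hj1, by rwa [ENNReal.coe_toNNReal n3]⟩⟩

theorem Good.upper (h : Good Λ) (P : Measure Ω) [IsProbabilityMeasure P] {Z : Ω × ℝ≥0∞ → ℝ}
    (hZm : MeasurableProcessE Λ Z) (hpos : ∀ p, 0 ≤ Z p) (hD : ClassD P Λ Z) {Zb : Ω × ℝ≥0∞ → ℝ}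
    (hZb : IsSnellProc P Λ Z Zb) {S : Ω → ℝ≥0∞} (hS : IsStoppingTimeM Λ S)
    {T : Ω → ℝ≥0∞} {Wm W Wp : Set Ω} (hσ : IsDividedST Λ T Wm W Wp)
    (hST : ∀ ω, S ω ≤ T ω) (hSm : ∀ ω ∈ Wm, S ω < T ω) :
    ∃ g : Ω → ℝ≥0∞, Measurable g ∧ (∀ᵐ ω ∂P, limE Z T Wm W ω ≤ g ω) ∧
      ∫⁻ ω, g ω ∂P ≤ ENNReal.ofReal (∫ ω, EvalAt Zb S ω ∂P) := by
  have hn0 : ∀ n : ℕ, ((1/2 : ℝ≥0∞))^n ≠ 0 := fun n => pow_ne_zero _ (by simp)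
  choose ρ h1 h2 h3 using fun n => h.approx_time P hZm hS hσ hST hSm n (hn0 n)
  have hm : ∀ n, Measurable fun ω => ENNReal.ofReal (EvalAt Z (ρ n) ω) := fun n =>
    ENNReal.measurable_ofReal.comp (h.eval_meas hZm (h.ST_meas (h1 n)))
  refine ⟨fun ω => liminf (fun n => ENNReal.ofReal (EvalAt Z (ρ n) ω)) atTop, .liminf hm, ?_, ?_⟩
  · have hsum : (∑' n, P {ω | ∃ j < n, (dq j : ℝ≥0∞) < limE Z T Wm W ω ∧
        ENNReal.ofReal (EvalAt Z (ρ n) ω) < dq j}) ≠ ∞ := by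
      refine ne_top_of_le_ne_top ?_ (ENNReal.tsum_le_tsum h3)
      rw [ENNReal.tsum_geometric]
      simp
    filter_upwards [ae_eventually_notMem hsum] with ω hω
    refine le_of_forall_lt fun a ha => ?_
    obtain ⟨b, hab, hb⟩ := exists_between ha
    obtain ⟨j, hj1, hj2⟩ := exists_dense_btwn hb
    refine (hab.trans hj1).trans_le (le_liminf_of_le (by isBoundedDefault) ?_)
    filter_upwards [hω, eventually_gt_atTop j] with n hn hnj
    by_contra hlt
    exact hn ⟨j, hnj, hj2, not_le.1 hlt⟩
  · refine (lintegral_liminf_le hm).trans ?_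
    have hle : ∀ n, ∫⁻ ω, ENNReal.ofReal (EvalAt Z (ρ n) ω) ∂P ≤
        ENNReal.ofReal (∫ ω, EvalAt Zb S ω ∂P) := fun n => by
      rw [← ofReal_integral_eq_lintegral_ofReal (hD.integrable (h1 n)) (ae_of_all _ fun ω => hpos _)]
      exact ENNReal.ofReal_le_ofReal ((h.snell_value P hpos hD hZb hS).1 _ (h1 n) (h2 n))
    exact (liminf_le_liminf (Eventually.of_forall hle)).trans (by simp)

theorem Good.upper_int (h : Good Λ) (P : Measure Ω) [IsProbabilityMeasure P] {Z : Ω × ℝ≥0∞ → ℝ}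
    (hZm : MeasurableProcessE Λ Z) (hpos : ∀ p, 0 ≤ Z p) (hD : ClassD P Λ Z) {Zb : Ω × ℝ≥0∞ → ℝ}
    (hZb : IsSnellProc P Λ Z Zb) {S : Ω → ℝ≥0∞} (hS : IsStoppingTimeM Λ S)
    {T : Ω → ℝ≥0∞} {Wm W Wp : Set Ω} (hσ : IsDividedST Λ T Wm W Wp)
    (hST : ∀ ω, S ω ≤ T ω) (hSm : ∀ ω ∈ Wm, S ω < T ω) :
    ∫ ω, divEval Z T Wm W Wp ω ∂P ≤ ∫ ω, EvalAt Zb S ω ∂P := by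
  obtain ⟨g, g1, g2, g3⟩ := h.upper P hZm hpos hD hZb hS hσ hST hSm
  have hv : 0 ≤ ∫ ω, EvalAt Zb S ω ∂P :=
    (integral_nonneg fun ω => hpos _).trans ((h.snell_value P hpos hD hZb hS).1 S hS le_rfl)
  have hfin : ∫⁻ ω, g ω ∂P ≠ ∞ := ne_top_of_le_ne_top ENNReal.ofReal_ne_top g3
  have hlt := ae_lt_top g1 hfin
  have hae : ∀ᵐ ω ∂P, divEval Z T Wm W Wp ω = (limE Z T Wm W ω).toReal := by
    filter_upwards [hlt, g2] with ω h1 h2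
    exact divEval_eq hpos hσ (h2.trans_lt h1).ne
  calc ∫ ω, divEval Z T Wm W Wp ω ∂P ≤ ∫ ω, (g ω).toReal ∂P := by
        refine integral_mono_of_nonneg ?_ (integrable_toReal_of_lintegral_ne_top g1.aemeasurable hfin) ?_
        · filter_upwards [hae] with ω h1
          rw [h1]; exact ENNReal.toReal_nonneg
        · filter_upwards [hae, hlt, g2] with ω h1 h2 h3
          rw [h1]
          exact ENNReal.toReal_mono h2.ne h3
    _ = (∫⁻ ω, g ω ∂P).toReal := integral_toReal g1.aemeasurable hlt
    _ ≤ _ := by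
        refine (ENNReal.toReal_mono ENNReal.ofReal_ne_top g3).trans ?_
        rw [ENNReal.toReal_ofReal hv]

theorem Good.afterSF_le (h : Good Λ) {K D : Ω → ℝ≥0∞} (hK : OT Λ K) (hD : OT Λ D) :
    MeasurableSet[afterSF hD] {ω | K ω ≤ D ω} :=
  ⟨measurableSet_le (h.OT_meas hK) (h.OT_meas hD), h.lt_after hK hD⟩

theorem Good.afterSF_ge (h : Good Λ) {K D : Ω → ℝ≥0∞} (hK : OT Λ K) (hD : OT Λ D) :
    MeasurableSet[afterSF hD] {ω | D ω ≤ K ω} := by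
  refine ⟨measurableSet_le (h.OT_meas hD) (h.OT_meas hK), ?_⟩
  refine h.after_of_lt fun q => ?_
  have : {ω | ω ∈ {ω | D ω ≤ K ω} ∧ D ω < q} = {ω | min (D ω) q ≤ min (K ω) q} ∩ {ω | D ω < q} := by
    ext ω
    simp only [mem_ofPred_eq, mem_inter_iff]
    refine and_congr_left fun h1 => ?_
    rw [min_eq_left h1.le, le_min_iff, and_iff_left h1.le]
  rw [this]
  exact (measurableSet_le (h.OT_min_meas hD q) (h.OT_min_meas hK q)).inter (h.OT_lt hD le_rfl)

theorem Good.atCl_of_afterSF (h : Good Λ) {D : Ω → ℝ≥0∞} (hD : OT Λ D) {A : Set Ω}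
    (hA : MeasurableSet[afterSF hD] A) : MeasurableSet[sigmaAtCl (FplusLambda Λ) D] A := by
  refine MeasurableSpace.measurableSet_generateFrom fun t => measurableSet_fplus.2 fun s hs => ?_
  have h1 : MeasurableSet[sigmaAt Λ s] {ω | ω ∈ A ∧ D ω < s} := sigmaAt_of_sec hA.2 s
  have h2 : MeasurableSet[sigmaAt Λ s] {ω | D ω ≤ t} :=
    h.fplus_le hs _ (h.OT_iff_cl.2 hD t)
  have : A ∩ {ω | D ω ≤ t} = {ω | ω ∈ A ∧ D ω < s} ∩ {ω | D ω ≤ t} := by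
    ext ω
    simp only [mem_inter_iff, mem_ofPred_eq]
    constructor
    · rintro ⟨a, b⟩; exact ⟨⟨a, b.trans_lt (ENNReal.coe_lt_coe.2 hs)⟩, b⟩
    · rintro ⟨⟨a, -⟩, b⟩; exact ⟨a, b⟩
  rw [this]
  exact MeasurableSet.inter h1 h2

theorem meas_ind_aux {α : Type*} [MeasurableSpace α] {A : Set α} (hA : MeasurableSet A) :
    Measurable (A.indicator (fun _ => (1:ℝ))) := measurable_const.indicator hA

theorem mem_atTime {B : Set (Ω × ℝ≥0∞)} (h1 : MeasurableSet[Λ] {p : Ω × ℝ≥0 | (p.1, (p.2:ℝ≥0∞)) ∈ B})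
    (h2 : MeasurableSet[sigmaInf Λ] {ω | (ω, (∞:ℝ≥0∞)) ∈ B}) (R : Ω → ℝ≥0∞) :
    MeasurableSet[sigmaAtTime Λ R] {ω | (ω, R ω) ∈ B} := by
  have hm : Measurable[sigmaAtTime Λ R] fun ω => B.indicator (fun _ => (1:ℝ)) (ω, R ω) :=
    measurable_genBy ⟨B.indicator (fun _ => (1:ℝ)),
      ⟨@meas_ind_aux _ Λ _ h1, @meas_ind_aux _ (sigmaInf Λ) _ h2⟩, rfl⟩
  have h3 := hm (measurableSet_singleton (1:ℝ))
  have e : {ω | (ω, R ω) ∈ B} = (fun ω => B.indicator (fun _ => (1:ℝ)) (ω, R ω)) ⁻¹' {1} := by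
    ext ω
    simp only [mem_ofPred_eq, mem_preimage, mem_singleton_iff]
    by_cases hb : (ω, R ω) ∈ B <;> simp [hb]
  rw [e]; exact h3

theorem Good.inf_lt (h : Good Λ) {D : Ω → ℝ≥0∞} (hD : OT Λ D) : MeasurableSet[sigmaInf Λ] {ω | D ω < ∞} := by
  have : {ω | D ω < ∞} = ⋃ k : ℕ, {ω | D ω < ((k:ℝ≥0) : ℝ≥0∞)} := by
    ext ω
    simp only [mem_ofPred_eq, mem_iUnion]
    constructor
    · intro h1
      obtain ⟨k, hk⟩ := ENNReal.exists_nat_gt h1.ne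
      exact ⟨k, by simpa using hk⟩
    · rintro ⟨k, hk⟩
      exact hk.trans_le le_top
  rw [this]
  exact MeasurableSet.iUnion fun k => le_iSup (sigmaAt Λ) (k:ℝ≥0) _ (h.OT_lt hD le_rfl)

/-- The divided time built from a sequence. -/
theorem Good.divided (h : Good Λ) {S : Ω → ℝ≥0∞} {T : ℕ → Ω → ℝ≥0∞} (hT : ∀ k, IsStoppingTimeM Λ (T k))
    (hST : ∀ k, S ≤ T k) {Rn : ℕ → Ω → ℝ≥0∞} {R : Ω → ℝ≥0∞} (hRn : ∀ n ω, Rn n ω = ⨅ m, T (n + m) ω)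
    (hR : ∀ ω, R ω = ⨆ n, Rn n ω) :
    IsDividedST Λ R {ω | ∀ n, Rn n ω < R ω} {ω | (∃ n, R ω ≤ Rn n ω) ∧ ∀ n, ∃ k, n ≤ k ∧ T k ω = R ω}
      {ω | (∃ n, R ω ≤ Rn n ω) ∧ ¬ ∀ n, ∃ k, n ≤ k ∧ T k ω = R ω} ∧ (∀ ω, S ω ≤ R ω) ∧
      (∀ ω, (∀ n, Rn n ω < R ω) → S ω < R ω) := by
  have hTO : ∀ k, OT Λ (T k) := fun k => h.OT_of_ST (hT k)
  have hRnO : ∀ n, OT Λ (Rn n) := by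
    intro n
    have : {p : Ω × ℝ≥0 | Rn n p.1 < (p.2:ℝ≥0∞)} = ⋃ m, {p | T (n+m) p.1 < p.2} := by
      ext p
      simp [hRn, iInf_lt_iff]
    unfold OT
    rw [this]
    exact MeasurableSet.iUnion fun m => hTO _
  have hRO : OT Λ R := by
    refine h.OT_iff_cl.1 fun t => ?_
    have : {ω | R ω ≤ t} = ⋂ n, {ω | Rn n ω ≤ t} := by
      ext ω; simp [hR]
    rw [this]
    exact MeasurableSet.iInter fun n => h.OT_iff_cl.2 (hRnO n) t
  have hRnR : ∀ n ω, Rn n ω ≤ R ω := fun n ω => by rw [hR]; exact le_iSup (fun n => Rn n ω) n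
  have hRnT : ∀ n k ω, n ≤ k → Rn n ω ≤ T k ω := fun n k ω hnk => by
    rw [hRn]
    obtain ⟨m, rfl⟩ := Nat.exists_eq_add_of_le hnk
    exact iInf_le (fun m => T (n+m) ω) m
  have hSR : ∀ n ω, S ω ≤ Rn n ω := fun n ω => by
    rw [hRn]; exact le_iInf fun m => hST _ ω
  -- sets known after R
  have aP : MeasurableSet[afterSF hRO] {ω | ∃ n, R ω ≤ Rn n ω} := by
    have : {ω | ∃ n, R ω ≤ Rn n ω} = ⋃ n, {ω | R ω ≤ Rn n ω} := by ext ω; simp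
    rw [this]
    exact MeasurableSet.iUnion fun n => h.afterSF_ge (hRnO n) hRO
  have aQ : MeasurableSet[afterSF hRO] {ω | ∀ n, ∃ k, n ≤ k ∧ T k ω = R ω} := by
    have : {ω | ∀ n, ∃ k, n ≤ k ∧ T k ω = R ω} =
        ⋂ n, ⋃ k, ⋃ (_ : n ≤ k), ({ω | T k ω ≤ R ω} ∩ {ω | R ω ≤ T k ω}) := by
      ext ω; simp only [mem_ofPred_eq, mem_iInter, mem_iUnion, mem_inter_iff, exists_prop, le_antisymm_iff]
    rw [this]
    exact MeasurableSet.iInter fun n => MeasurableSet.iUnion fun k => MeasurableSet.iUnion fun _ =>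
      MeasurableSet.inter (h.afterSF_le (hTO k) hRO) (h.afterSF_ge (hTO k) hRO)
  let B : Set (Ω × ℝ≥0∞) := {p | (∃ n, ¬ Rn n p.1 < p.2) ∧ ∀ n, ∃ k, n ≤ k ∧ T k p.1 = p.2}
  have hBΛ : MeasurableSet[Λ] {p : Ω × ℝ≥0 | (p.1, (p.2:ℝ≥0∞)) ∈ B} := by
    have : {p : Ω × ℝ≥0 | (p.1, (p.2:ℝ≥0∞)) ∈ B} = (⋃ n, {p : Ω × ℝ≥0 | Rn n p.1 < p.2}ᶜ) ∩
        ⋂ n, ⋃ k, ⋃ (_ : n ≤ k), ({p : Ω × ℝ≥0 | T k p.1 ≤ p.2} \ {p | T k p.1 < p.2}) := by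
      ext p
      simp only [B, mem_ofPred_eq, mem_inter_iff, mem_iUnion, mem_iInter, mem_compl_iff, Set.mem_sdiff,
        not_lt, exists_prop, le_antisymm_iff]
    rw [this]
    exact MeasurableSet.inter (MeasurableSet.iUnion fun n => MeasurableSet.compl (hRnO n))
      (MeasurableSet.iInter fun n => MeasurableSet.iUnion fun k => MeasurableSet.iUnion fun _ =>
        MeasurableSet.diff (hT k) (hTO k))
  have hBinf : MeasurableSet[sigmaInf Λ] {ω | (ω, (∞:ℝ≥0∞)) ∈ B} := by
    have : {ω | (ω, (∞:ℝ≥0∞)) ∈ B} = (⋃ n, {ω | Rn n ω < ∞}ᶜ) ∩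
        ⋂ n, ⋃ k, ⋃ (_ : n ≤ k), {ω | T k ω < ∞}ᶜ := by
      ext p
      simp only [B, mem_ofPred_eq, mem_inter_iff, mem_iUnion, mem_iInter, mem_compl_iff,
        not_lt, exists_prop, top_le_iff]
    rw [this]
    exact MeasurableSet.inter (MeasurableSet.iUnion fun n => MeasurableSet.compl (h.inf_lt (hRnO n)))
      (MeasurableSet.iInter fun n => MeasurableSet.iUnion fun k => MeasurableSet.iUnion fun _ =>
        MeasurableSet.compl (h.inf_lt (hTO k)))
  have hBR : ∀ ω t, (ω, t) ∈ B → R ω = t := by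
    rintro ω t ⟨⟨n, hn⟩, h2⟩
    refine le_antisymm ?_ ((not_lt.1 hn).trans (hRnR n ω))
    rw [hR]
    refine iSup_le fun m => ?_
    obtain ⟨k, hk, hk2⟩ := h2 m
    exact (hRnT m k ω hk).trans hk2.le
  refine ⟨⟨h.OT_iff_cl.2 hRO, ?_, ?_, ?_, ?_, ?_, ?_, ?_, ?_, ?_, ?_, ?_⟩,
    fun ω => (hSR 0 ω).trans (hRnR 0 ω), fun ω hω => (hSR 0 ω).trans_lt (hω 0)⟩
  · ext ω
    simp only [mem_union, mem_ofPred_eq, mem_univ, iff_true]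
    by_cases h1 : ∃ n, R ω ≤ Rn n ω
    · by_cases h2 : ∀ n, ∃ k, n ≤ k ∧ T k ω = R ω
      · exact Or.inl (Or.inr ⟨h1, h2⟩)
      · exact Or.inr ⟨h1, h2⟩
    · push Not at h1
      exact Or.inl (Or.inl h1)
  · ext ω
    simp only [mem_inter_iff, mem_ofPred_eq, mem_empty_iff_false, iff_false]
    rintro ⟨h1, ⟨n, h2⟩, -⟩
    exact absurd (h1 n) (not_lt.2 h2)
  · ext ω
    simp only [mem_inter_iff, mem_ofPred_eq, mem_empty_iff_false, iff_false]
    rintro ⟨h1, ⟨n, h2⟩, -⟩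
    exact absurd (h1 n) (not_lt.2 h2)
  · ext ω
    simp only [mem_inter_iff, mem_ofPred_eq, mem_empty_iff_false, iff_false]
    rintro ⟨⟨-, h1⟩, -, h2⟩
    exact h2 h1
  · have : {ω | ∀ n, Rn n ω < R ω} = ⋂ n, ⋃ k, ({ω | Rn n ω ≤ dq k} ∩ {ω | (dq k:ℝ≥0∞) < R ω}) := by
      ext ω
      simp only [mem_ofPred_eq, mem_iInter, mem_iUnion, mem_inter_iff]
      refine forall_congr' fun n => ⟨fun h1 => ?_, fun ⟨k, h1, h2⟩ => h1.trans_lt h2⟩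
      obtain ⟨k, hk, hk2⟩ := exists_dense_btwn h1
      exact ⟨k, hk.le, hk2⟩
    rw [this]
    refine MeasurableSet.iInter fun n => MeasurableSet.iUnion fun k => ?_
    exact MeasurableSpace.measurableSet_generateFrom (Or.inr ⟨dq k, _, h.OT_iff_cl.2 (hRnO n) _, rfl⟩)
  · ext ω
    simp only [mem_inter_iff, mem_ofPred_eq, mem_empty_iff_false, iff_false]
    rintro ⟨h1, h2⟩
    have := h1 0
    rw [h2] at this
    exact not_lt_zero this
  · have := mem_atTime hBΛ hBinf R
    convert this using 1
    ext ω
    simp [B]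
  · exact h.atCl_of_afterSF hRO (MeasurableSet.inter aP (MeasurableSet.compl aQ))
  · ext ω
    simp only [mem_inter_iff, mem_ofPred_eq, mem_empty_iff_false, iff_false]
    rintro ⟨⟨⟨n, h1⟩, h2⟩, h3⟩
    refine h2 fun m => ⟨max m n, le_max_left _ _, ?_⟩
    rw [h3] at h1 ⊢
    exact top_le_iff.1 (h1.trans (hRnT n _ ω (le_max_right _ _)))
  · let Q : ℕ → Ω → ℝ≥0∞ := fun n ω => if Rn n ω < R ω then Rn n ω else ∞
    have hQ : ∀ n, OT Λ (Q n) := by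
      intro n
      refine h.OT_of_lt fun q => ?_
      have : {ω | Q n ω < q} = {ω | min (Rn n ω) q < min (R ω) q} := by
        ext ω
        simp only [mem_ofPred_eq, Q]
        split_ifs with h1
        · constructor
          · intro h2
            rw [min_eq_left h2.le]
            exact lt_min h1 h2
          · intro h2
            by_contra h3
            rw [min_eq_right (not_lt.1 h3)] at h2
            exact absurd h2 (not_lt.2 (min_le_right _ _))
        · simp only [not_top_lt, false_iff, not_lt]
          exact min_le_min (not_lt.1 h1) le_rfl
      rw [this]
      exact measurableSet_lt (h.OT_min_meas (hRnO n) q) (h.OT_min_meas hRO q)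
    have : {p : Ω × ℝ≥0 | restrictST R {ω | ∀ n, Rn n ω < R ω} p.1 ≤ (p.2:ℝ≥0∞)} =
        ⋂ n, {p | Q n p.1 < p.2} := by
      ext ⟨ω, t⟩
      simp only [mem_ofPred_eq, mem_iInter, restrictST, Q]
      constructor
      · intro h1 n
        split_ifs at h1 with h2
        · rw [if_pos (h2 n)]
          exact (h2 n).trans_le h1
        · exact absurd h1 (by simp)
      · intro h1
        have h2 : ∀ n, Rn n ω < R ω := fun n => by
          by_contra h3
          have h4 := h1 n
          rw [if_neg h3] at h4
          exact not_top_lt h4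
        rw [if_pos h2, hR]
        refine iSup_le fun n => ?_
        have h4 := h1 n
        rw [if_pos (h2 n)] at h4
        exact h4.le
    unfold IsStoppingTimeM
    rw [this]
    exact MeasurableSet.iInter fun n => h.pred_open (hQ n)
  · have := MeasurableSet.union hBΛ (MeasurableSet.inter aP aQ : MeasurableSet[afterSF hRO] _).2
    unfold IsStoppingTimeM
    convert this using 1
    ext ⟨ω, t⟩
    simp only [mem_ofPred_eq, mem_union, restrictST, mem_inter_iff]
    constructor
    · intro h1
      split_ifs at h1 with h2
      · rcases h1.lt_or_eq with h3 | h3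
        · exact Or.inr ⟨h2, h3⟩
        · refine Or.inl ?_
          rw [← h3]
          obtain ⟨⟨n, a⟩, b⟩ := h2
          exact ⟨⟨n, not_lt.2 a⟩, b⟩
      · exact absurd h1 (by simp)
    · rintro (h1 | ⟨h1, h2⟩)
      · have h3 := hBR ω t h1
        obtain ⟨⟨n, a⟩, b⟩ := h1
        have h4 : (∃ n, R ω ≤ Rn n ω) ∧ ∀ n, ∃ k, n ≤ k ∧ T k ω = R ω :=
          ⟨⟨n, by rw [h3]; exact not_lt.1 a⟩, by rw [h3]; exact b⟩
        rw [if_pos h4, h3]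
      · rw [if_pos h1]; exact h2.le

/-- Running minima of a sequence of random times. -/
def runMin (T : ℕ → Ω → ℝ≥0∞) (n : ℕ) : ℕ → Ω → ℝ≥0∞
  | 0 => T n
  | m+1 => fun ω => min (runMin T n m ω) (T (n+(m+1)) ω)

theorem runMin_ST {T : ℕ → Ω → ℝ≥0∞} (hT : ∀ k, IsStoppingTimeM Λ (T k)) (n m : ℕ) :
    IsStoppingTimeM Λ (runMin T n m) := by
  induction m with
  | zero => exact hT n
  | succ m ih => exact ST_min ih (hT _)

theorem runMin_ge {T : ℕ → Ω → ℝ≥0∞} {n m : ℕ} {ω : Ω} {x : ℝ≥0∞} (hT : ∀ k, n ≤ k → x ≤ T k ω) :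
    x ≤ runMin T n m ω := by
  induction m with
  | zero => exact hT n le_rfl
  | succ m ih => exact le_min ih (hT _ (by omega))

theorem runMin_anti (T : ℕ → Ω → ℝ≥0∞) (n : ℕ) (ω : Ω) : Antitone fun m => runMin T n m ω :=
  antitone_nat_of_succ_le fun _ => min_le_left _ _

theorem runMin_le (T : ℕ → Ω → ℝ≥0∞) (n m : ℕ) (ω : Ω) : runMin T n m ω ≤ T (n+m) ω := by
  cases m with
  | zero => exact le_rfl
  | succ m => exact min_le_right _ _

theorem runMin_mem (T : ℕ → Ω → ℝ≥0∞) (n m : ℕ) (ω : Ω) : ∃ k, n ≤ k ∧ runMin T n m ω = T k ω := by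
  induction m with
  | zero => exact ⟨n, le_rfl, rfl⟩
  | succ m ih =>
    obtain ⟨k, hk, e⟩ := ih
    rcases le_total (runMin T n m ω) (T (n+(m+1)) ω) with hle | hle
    · exact ⟨k, hk, by rw [← e]; exact min_eq_left hle⟩
    · exact ⟨_, by omega, min_eq_right hle⟩

theorem runMin_value (P : Measure Ω) [IsProbabilityMeasure P] {Z : Ω × ℝ≥0∞ → ℝ}
    (hD : ClassD P Λ Z) {S : Ω → ℝ≥0∞} {v : ℝ}
    (hv : ∀ T, IsStoppingTimeM Λ T → S ≤ T → ∫ ω, EvalAt Z T ω ∂P ≤ v)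
    {T : ℕ → Ω → ℝ≥0∞} (hT : ∀ n, IsStoppingTimeM Λ (T n)) (hST : ∀ n, S ≤ T n)
    (hTv : ∀ n, v - (1/2)^n < ∫ ω, EvalAt Z (T n) ω ∂P) (n m : ℕ) :
    v - 2 * (1/2)^n + (1/2)^(n+m) ≤ ∫ ω, EvalAt Z (runMin T n m) ω ∂P := by
  induction m with
  | zero =>
    have := hTv n
    simp only [runMin, add_zero]
    linarith
  | succ m ih =>
    have h1 := hTv (n+(m+1))
    have hmin := runMin_ST hT n (m+1)
    have hmax : IsStoppingTimeM Λ fun ω => max (runMin T n m ω) (T (n+(m+1)) ω) :=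
      ST_max (runMin_ST hT n m) (hT _)
    have h2 := hv _ hmax fun ω => (hST (n+(m+1)) ω).trans (le_max_right _ _)
    have h3 : ∫ ω, EvalAt Z (runMin T n (m+1)) ω ∂P +
        ∫ ω, EvalAt Z (fun ω => max (runMin T n m ω) (T (n+(m+1)) ω)) ω ∂P =
        ∫ ω, EvalAt Z (runMin T n m) ω ∂P + ∫ ω, EvalAt Z (T (n+(m+1))) ω ∂P := by
      rw [← integral_add (hD.integrable hmin) (hD.integrable hmax),
        ← integral_add (hD.integrable (runMin_ST hT n m)) (hD.integrable (hT _))]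
      congr 1
      ext ω
      simp only [EvalAt, runMin]
      rcases le_total (runMin T n m ω) (T (n+(m+1)) ω) with hle | hle
      · rw [min_eq_left hle, max_eq_right hle]
      · rw [min_eq_right hle, max_eq_left hle, add_comm]
    have h4 : ((1:ℝ)/2)^(n+m) = 2 * (1/2)^(n+(m+1)) := by
      rw [← add_assoc, pow_succ]; ring
    linarith

theorem tendsto_leftF {u : ℕ → ℝ≥0∞} {t : ℝ≥0∞} (h1 : ∀ᶠ n in atTop, u n < t)
    (h2 : ∀ a < t, ∀ᶠ n in atTop, a < u n) :
    Tendsto (fun n => (u n).toNNReal) atTop (leftF t) := by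
  unfold leftF
  split_ifs with ht
  · subst ht
    refine tendsto_atTop.2 fun b => ?_
    filter_upwards [h1, h2 b ENNReal.coe_lt_top] with n hn1 hn2
    rw [← ENNReal.toNNReal_coe b]
    exact ENNReal.toNNReal_mono hn1.ne hn2.le
  · have hu : Tendsto u atTop (𝓝 t) := by
      refine tendsto_order.2 ⟨h2, fun a ha => ?_⟩
      filter_upwards [h1] with n hn using hn.trans ha
    refine tendsto_nhdsWithin_iff.2 ⟨(ENNReal.tendsto_toNNReal ht).comp hu, ?_⟩
    filter_upwards [h1] with n hn
    exact ENNReal.toNNReal_strict_mono ht hn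

theorem limsup_comp_le {u : ℕ → ℝ≥0} {f : Filter ℝ≥0} (hu : Tendsto u atTop f) (x : ℝ≥0 → ℝ≥0∞) :
    limsup (fun n => x (u n)) atTop ≤ limsup x f := by
  have : limsup (fun n => x (u n)) atTop = limsup x (map u atTop) := by
    simp [limsup, map_map, Function.comp_def]
  rw [this]
  exact limsup_le_limsup_of_le hu

theorem reverse_fatou (h : Good Λ) (P : Measure Ω) [IsProbabilityMeasure P] {Z : Ω × ℝ≥0∞ → ℝ}
    (hZm : MeasurableProcessE Λ Z) (hpos : ∀ p, 0 ≤ Z p) (hD : ClassD P Λ Z)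
    {ρ : ℕ → Ω → ℝ≥0∞} (hρ : ∀ n, IsStoppingTimeM Λ (ρ n)) {v : ℝ}
    (hv : ∀ n, v - 2 * (1/2)^n ≤ ∫ ω, EvalAt Z (ρ n) ω ∂P) :
    ENNReal.ofReal v ≤ ∫⁻ ω, limsup (fun n => ENNReal.ofReal (Z (ω, ρ n ω))) atTop ∂P := by
  have hm : ∀ n, Measurable fun ω => ENNReal.ofReal (Z (ω, ρ n ω)) := fun n =>
    ENNReal.measurable_ofReal.comp (h.eval_meas hZm (h.ST_meas (hρ n)))
  refine ENNReal.le_of_forall_pos_le_add fun ε hε _ => ?_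
  obtain ⟨C, hC⟩ := UniformIntegrable.spec one_ne_zero ENNReal.one_ne_top hD
    (ε := (ε/2 : ℝ≥0)) (by positivity)
  have hC' : ∀ n, ∫⁻ ω, ENNReal.ofReal (Z (ω, ρ n ω)) ∂P ≤
      ∫⁻ ω, min (ENNReal.ofReal (Z (ω, ρ n ω))) C ∂P + (ε/2 : ℝ≥0) := fun n => by
    have := hC ⟨ρ n, hρ n⟩
    rw [eLpNorm_one_eq_lintegral_enorm, ENNReal.ofReal_coe_nnreal] at this
    refine le_trans ?_ (add_le_add le_rfl this)
    rw [← lintegral_add_left ((hm n).min measurable_const)]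
    refine lintegral_mono fun ω => ?_
    by_cases hc : C ≤ ‖EvalAt Z (ρ n) ω‖₊
    · have e : ‖({x | C ≤ ‖EvalAt Z (ρ n) x‖₊}.indicator (EvalAt Z (ρ n))) ω‖ₑ =
          ENNReal.ofReal (Z (ω, ρ n ω)) := by
        rw [indicator_of_mem (by exact hc)]; exact Real.enorm_of_nonneg (hpos _)
      simp only [e]
      exact le_add_self
    · refine le_trans ?_ le_self_add
      refine le_min le_rfl ?_
      have e : ‖EvalAt Z (ρ n) ω‖ₑ = ENNReal.ofReal (Z (ω, ρ n ω)) :=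
        Real.enorm_of_nonneg (hpos _)
      rw [← e]
      exact ENNReal.coe_le_coe.2 (not_le.1 hc).le
  have hev : ∀ᶠ n : ℕ in atTop, 2 * (1/2 : ℝ)^n ≤ (ε/2 : ℝ≥0) := by
    have : Tendsto (fun n : ℕ => 2 * (1/2 : ℝ)^n) atTop (𝓝 (2 * 0)) :=
      (tendsto_pow_atTop_nhds_zero_of_lt_one (by norm_num) (by norm_num)).const_mul _
    rw [mul_zero] at this
    exact (this.eventually_lt_const (by positivity)).mono fun n hn => hn.le
  have hev2 : ∀ᶠ n : ℕ in atTop, ENNReal.ofReal v - ε ≤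
      ∫⁻ ω, min (ENNReal.ofReal (Z (ω, ρ n ω))) C ∂P := by
    filter_upwards [hev] with n hn
    rw [tsub_le_iff_right]
    have h1 : v ≤ ∫ ω, EvalAt Z (ρ n) ω ∂P + (ε/2 : ℝ≥0) := by linarith [hv n]
    calc ENNReal.ofReal v ≤ ENNReal.ofReal (∫ ω, EvalAt Z (ρ n) ω ∂P) + (ε/2 : ℝ≥0) := by
          refine (ENNReal.ofReal_le_ofReal h1).trans ?_
          refine ENNReal.ofReal_add_le.trans ?_
          rw [ENNReal.ofReal_coe_nnreal]
      _ = ∫⁻ ω, ENNReal.ofReal (Z (ω, ρ n ω)) ∂P + (ε/2 : ℝ≥0) := by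
          rw [ofReal_integral_eq_lintegral_ofReal (hD.integrable (hρ n)) (ae_of_all _ fun ω => hpos _)]
          rfl
      _ ≤ (∫⁻ ω, min (ENNReal.ofReal (Z (ω, ρ n ω))) C ∂P + (ε/2 : ℝ≥0)) + (ε/2 : ℝ≥0) := by
          gcongr; exact hC' n
      _ = _ := by
          rw [add_assoc, ← ENNReal.coe_add, add_halves]
  rw [← tsub_le_iff_right]
  calc ENNReal.ofReal v - ε ≤ limsup (fun n => ∫⁻ ω, min (ENNReal.ofReal (Z (ω, ρ n ω))) C ∂P) atTop :=
        le_limsup_of_frequently_le hev2.frequently (by isBoundedDefault)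
    _ ≤ ∫⁻ ω, limsup (fun n => min (ENNReal.ofReal (Z (ω, ρ n ω))) C) atTop ∂P :=
        limsup_lintegral_le (fun _ => (C : ℝ≥0∞)) (fun n => (hm n).min measurable_const)
          (fun n => ae_of_all _ fun ω => min_le_right _ _) (by simp)
    _ ≤ _ := lintegral_mono fun ω => limsup_le_limsup (Eventually.of_forall fun n => min_le_left _ _)

/-- The event on which the `m`-th running minimum is not yet a good approximation. -/
def badSet (T : ℕ → Ω → ℝ≥0∞) (Rn : ℕ → Ω → ℝ≥0∞) (R : Ω → ℝ≥0∞) (n m : ℕ) : Set Ω :=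
  {ω | (Rn n ω < R ω ∧ R ω ≤ runMin T n m ω) ∨
    ((∃ k, runMin T n k ω = Rn n ω) ∧ runMin T n m ω ≠ Rn n ω) ∨
    (Rn n ω < ∞ ∧ Rn n ω + ((n:ℝ≥0∞)+1)⁻¹ < runMin T n m ω)}

theorem bad_choose (P : Measure Ω) [IsProbabilityMeasure P] {T Rn : ℕ → Ω → ℝ≥0∞}
    {R : Ω → ℝ≥0∞} (hT : ∀ n m, Measurable (runMin T n m))
    (hRn : ∀ n ω, Rn n ω = ⨅ m, T (n+m) ω) (hR : ∀ ω, R ω = ⨆ n, Rn n ω) (n : ℕ) :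
    ∃ m, P (badSet T Rn R n m) ≤ (1/2)^n := by
  have hinf : ∀ n ω, ⨅ m, runMin T n m ω = Rn n ω := fun n ω => by
    rw [hRn]
    refine le_antisymm (iInf_mono fun m => runMin_le T n m ω) (le_iInf fun m => runMin_ge fun k hk => ?_)
    obtain ⟨j, rfl⟩ := Nat.exists_eq_add_of_le hk
    exact iInf_le (fun m => T (n+m) ω) j
  have hle : ∀ n m ω, Rn n ω ≤ runMin T n m ω := fun n m ω => by
    rw [← hinf]; exact iInf_le (fun m => runMin T n m ω) m
  have mRn : ∀ n, Measurable (Rn n) := fun n => by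
    have : Rn n = fun ω => ⨅ m, runMin T n m ω := by ext ω; rw [hinf]
    rw [this]; exact .iInf fun m => hT n m
  have mR : Measurable R := by
    have : R = fun ω => ⨆ n, Rn n ω := by ext ω; rw [hR]
    rw [this]; exact .iSup mRn
  have mbad : ∀ m, MeasurableSet (badSet T Rn R n m) := fun m => by
    unfold badSet
    refine MeasurableSet.union ?_ (MeasurableSet.union ?_ ?_)
    · exact (measurableSet_lt (mRn n) mR).inter (measurableSet_le mR (hT n m))
    · refine MeasurableSet.inter ?_ (measurableSet_eq_fun (hT n m) (mRn n)).compl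
      have : {ω | ∃ k, runMin T n k ω = Rn n ω} = ⋃ k, {ω | runMin T n k ω = Rn n ω} := by
        ext ω; simp
      rw [show (fun ω => ∃ k, runMin T n k ω = Rn n ω) = {ω | ∃ k, runMin T n k ω = Rn n ω} from rfl, this]
      exact MeasurableSet.iUnion fun k => measurableSet_eq_fun (hT n k) (mRn n)
    · exact (measurableSet_lt (mRn n) measurable_const).inter
        (measurableSet_lt ((mRn n).add_const _) (hT n m))
  have anti : Antitone fun m => badSet T Rn R n m := by
    intro m m' hmm ω hω
    have hr : runMin T n m' ω ≤ runMin T n m ω := runMin_anti T n ω hmm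
    rcases hω with ⟨a, b⟩ | ⟨a, b⟩ | ⟨a, b⟩
    · exact Or.inl ⟨a, b.trans hr⟩
    · exact Or.inr (Or.inl ⟨a, fun e => b (le_antisymm (e ▸ hr) (hle _ _ _))⟩)
    · exact Or.inr (Or.inr ⟨a, b.trans_le hr⟩)
  have emp : ⋂ m, badSet T Rn R n m = ∅ := by
    refine eq_empty_of_forall_notMem fun ω hω => ?_
    have hω' : ∀ m, ω ∈ badSet T Rn R n m := fun m => mem_iInter.1 hω m
    have e1 : ∃ m, ¬ (Rn n ω < R ω ∧ R ω ≤ runMin T n m ω) := by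
      by_contra hcon
      push Not at hcon
      have := le_iInf fun m => (hcon m).2
      rw [hinf] at this
      exact absurd (hcon 0).1 (not_lt.2 this)
    have e2 : ∃ m, ¬ ((∃ k, runMin T n k ω = Rn n ω) ∧ runMin T n m ω ≠ Rn n ω) := by
      by_contra hcon
      push Not at hcon
      obtain ⟨k, hk⟩ := (hcon 0).1
      exact (hcon k).2 hk
    have e3 : ∃ m, ¬ (Rn n ω < ∞ ∧ Rn n ω + ((n:ℝ≥0∞)+1)⁻¹ < runMin T n m ω) := by
      by_contra hcon
      push Not at hcon
      have := le_iInf fun m => (hcon m).2.le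
      rw [hinf] at this
      refine absurd this (not_le.2 (ENNReal.lt_add_right (hcon 0).1.ne ?_))
      exact ENNReal.inv_ne_zero.2 (by finiteness)
    obtain ⟨m1, h1⟩ := e1
    obtain ⟨m2, h2⟩ := e2
    obtain ⟨m3, h3⟩ := e3
    have a1 : m1 ≤ max m1 (max m2 m3) := le_max_left _ _
    have a2 : m2 ≤ max m1 (max m2 m3) := (le_max_left _ _).trans (le_max_right _ _)
    have a3 : m3 ≤ max m1 (max m2 m3) := (le_max_right _ _).trans (le_max_right _ _)
    rcases hω' (max m1 (max m2 m3)) with ⟨a, b⟩ | ⟨a, b⟩ | ⟨a, b⟩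
    · exact h1 ⟨a, b.trans (runMin_anti T n ω a1)⟩
    · refine h2 ⟨a, fun e => b (le_antisymm ?_ (hle _ _ _))⟩
      exact e ▸ runMin_anti T n ω a2
    · exact h3 ⟨a, b.trans_le (runMin_anti T n ω a3)⟩
  have ht := tendsto_measure_iInter_atTop (μ := P) (fun m => (mbad m).nullMeasurableSet) anti
    ⟨0, measure_ne_top _ _⟩
  rw [emp, measure_empty] at ht
  have : (0:ℝ≥0∞) < (1/2)^n := pos_iff_ne_zero.2 (pow_ne_zero _ (by simp))
  obtain ⟨m, hm⟩ := (ht.eventually_lt_const this).exists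
  exact ⟨m, hm.le⟩

theorem limE_ge {Z : Ω × ℝ≥0∞ → ℝ} {T Rn : ℕ → Ω → ℝ≥0∞} {R : Ω → ℝ≥0∞} {N : ℕ → ℕ} {ω : Ω}
    (hRn : ∀ n ω, Rn n ω = ⨅ m, T (n+m) ω) (hR : ∀ ω, R ω = ⨆ n, Rn n ω)
    (hω : ∀ᶠ n in atTop, ω ∉ badSet T Rn R n (N n)) :
    limsup (fun n => ENNReal.ofReal (Z (ω, runMin T n (N n) ω))) atTop ≤
      limE Z R {ω | ∀ n, Rn n ω < R ω}
        {ω | (∃ n, R ω ≤ Rn n ω) ∧ ∀ n, ∃ k, n ≤ k ∧ T k ω = R ω} ω := by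
  have hRT : ∀ n k, n ≤ k → Rn n ω ≤ T k ω := fun n k hnk => by
    rw [hRn]
    obtain ⟨m, rfl⟩ := Nat.exists_eq_add_of_le hnk
    exact iInf_le (fun m => T (n+m) ω) m
  have hle : ∀ n m, Rn n ω ≤ runMin T n m ω := fun n m => runMin_ge fun k hk => hRT n k hk
  have hmono : ∀ n n', n ≤ n' → Rn n ω ≤ Rn n' ω := fun n n' hn => by
    rw [hRn n']
    exact le_iInf fun m => hRT n _ (by omega)
  have hRle : ∀ n, Rn n ω ≤ R ω := fun n => by rw [hR]; exact le_iSup (fun n => Rn n ω) n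
  unfold limE
  split_ifs with hm hw
  · simp only [mem_ofPred_eq] at hm
    have h1 : ∀ᶠ n in atTop, runMin T n (N n) ω < R ω := by
      filter_upwards [hω] with n hn
      by_contra hlt
      exact hn (Or.inl ⟨hm n, not_lt.1 hlt⟩)
    have h2 : ∀ a < R ω, ∀ᶠ n in atTop, a < runMin T n (N n) ω := by
      intro a ha
      rw [hR] at ha
      obtain ⟨n0, hn0⟩ := lt_iSup_iff.1 ha
      filter_upwards [eventually_ge_atTop n0] with n hn
      exact hn0.trans_le ((hmono _ _ hn).trans (hle _ _))
    refine le_trans (le_of_eq ?_) (limsup_comp_le (tendsto_leftF h1 h2)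
      fun s : ℝ≥0 => ENNReal.ofReal (Z (ω, s)))
    refine limsup_congr ?_
    filter_upwards [h1] with n hn
    rw [ENNReal.coe_toNNReal hn.ne_top]
  · obtain ⟨⟨n0, hn0⟩, hk⟩ := hw
    refine limsup_le_of_le (by isBoundedDefault) ?_
    filter_upwards [hω, eventually_ge_atTop n0] with n hn hnn
    have hRe : Rn n ω = R ω := le_antisymm (hRle n) (hn0.trans (hmono _ _ hnn))
    have : runMin T n (N n) ω = R ω := by
      by_contra hne
      refine hn (Or.inr (Or.inl ⟨?_, hRe ▸ hne⟩))
      obtain ⟨k, hk1, hk2⟩ := hk n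
      obtain ⟨m, rfl⟩ := Nat.exists_eq_add_of_le hk1
      refine ⟨m, le_antisymm ?_ (hle _ _)⟩
      rw [hRe, ← hk2]
      exact runMin_le T n m ω
    rw [this]
  · simp only [mem_ofPred_eq, not_forall, not_lt] at hm
    have hw' : ¬ ∀ n, ∃ k, n ≤ k ∧ T k ω = R ω := fun h' => hw ⟨hm, h'⟩
    push Not at hw'
    obtain ⟨n0, hn0⟩ := hm
    obtain ⟨n1, hn1⟩ := hw'
    have hgt : ∀ᶠ n in atTop, Rn n ω = R ω ∧ R ω < runMin T n (N n) ω := by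
      filter_upwards [eventually_ge_atTop n0, eventually_ge_atTop n1] with n hna hnb
      have hRe : Rn n ω = R ω := le_antisymm (hRle n) (hn0.trans (hmono _ _ hna))
      refine ⟨hRe, lt_of_le_of_ne (hRe ▸ hle n (N n)) fun e => ?_⟩
      obtain ⟨k, hk1, hk2⟩ := runMin_mem T n (N n) ω
      exact hn1 k (hnb.trans hk1) (by rw [e, hk2])
    have hfin : R ω ≠ ∞ := by
      obtain ⟨n, hn⟩ := hgt.exists
      exact hn.2.ne_top
    have hup : ∀ᶠ n : ℕ in atTop, runMin T n (N n) ω ≤ R ω + ((n:ℝ≥0∞)+1)⁻¹ := by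
      filter_upwards [hω, hgt] with n hn hg
      by_contra hlt
      refine hn (Or.inr (Or.inr ⟨hg.1 ▸ lt_top_iff_ne_top.2 hfin, hg.1 ▸ not_le.1 hlt⟩))
    have hlim : Tendsto (fun n : ℕ => R ω + ((n:ℝ≥0∞)+1)⁻¹) atTop (𝓝 (R ω)) := by
      have : Tendsto (fun n : ℕ => ((n:ℝ≥0∞)+1)⁻¹) atTop (𝓝 0) := by
        have := (tendsto_add_atTop_iff_nat 1).2 ENNReal.tendsto_inv_nat_nhds_zero
        simpa using this
      simpa using this.const_add (R ω)
    have hfinn : ∀ᶠ n in atTop, runMin T n (N n) ω ≠ ∞ := by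
      filter_upwards [hup] with n hn
      refine ne_top_of_le_ne_top ?_ hn
      exact ENNReal.add_ne_top.2 ⟨hfin, ENNReal.inv_ne_top.2 (by simp)⟩
    have hu : Tendsto (fun n => runMin T n (N n) ω) atTop (𝓝 (R ω)) :=
      tendsto_of_tendsto_of_tendsto_of_le_of_le' tendsto_const_nhds hlim
        (hgt.mono fun n hn => hn.2.le) hup
    have hu2 : Tendsto (fun n => (runMin T n (N n) ω).toNNReal) atTop (𝓝[>] (R ω).toNNReal) := by
      refine tendsto_nhdsWithin_iff.2 ⟨(ENNReal.tendsto_toNNReal hfin).comp hu, ?_⟩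
      filter_upwards [hgt, hfinn] with n hn hf
      exact ENNReal.toNNReal_strict_mono hf hn.2
    refine le_trans (le_of_eq ?_) (limsup_comp_le hu2 fun s : ℝ≥0 => ENNReal.ofReal (Z (ω, s)))
    refine limsup_congr ?_
    filter_upwards [hfinn] with n hn
    rw [ENNReal.coe_toNNReal hn]

theorem Good.attained (h : Good Λ) (P : Measure Ω) [IsProbabilityMeasure P] {Z : Ω × ℝ≥0∞ → ℝ}
    (hZm : MeasurableProcessE Λ Z) (hpos : ∀ p, 0 ≤ Z p) (hD : ClassD P Λ Z) {Zb : Ω × ℝ≥0∞ → ℝ}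
    (hZb : IsSnellProc P Λ Z Zb) {S : Ω → ℝ≥0∞} (hS : IsStoppingTimeM Λ S) :
    ∃ (T : Ω → ℝ≥0∞) (Wm W Wp : Set Ω),
      IsDividedST Λ T Wm W Wp ∧ (∀ ω, S ω ≤ T ω) ∧ (∀ ω ∈ Wm, S ω < T ω) ∧
      ∫ ω, divEval Z T Wm W Wp ω ∂P = ∫ ω, EvalAt Zb S ω ∂P := by
  obtain ⟨hv1, T, hT⟩ := h.snell_value P hpos hD hZb hS
  have hv : 0 ≤ ∫ ω, EvalAt Zb S ω ∂P :=
    (integral_nonneg fun ω => hpos _).trans (hv1 S hS le_rfl)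
  have hT1 := fun n => (hT n).1
  have hT2 := fun n => (hT n).2.1
  have hT3 := fun n => (hT n).2.2
  obtain ⟨Rn, hRn⟩ : ∃ Rn : ℕ → Ω → ℝ≥0∞, ∀ n ω, Rn n ω = ⨅ m, T (n+m) ω := ⟨_, fun _ _ => rfl⟩
  obtain ⟨R, hR⟩ : ∃ R : Ω → ℝ≥0∞, ∀ ω, R ω = ⨆ n, Rn n ω := ⟨_, fun _ => rfl⟩
  obtain ⟨hσ, hSR, hSm⟩ := h.divided hT1 (fun n ω => hT2 n ω) hRn hR
  refine ⟨R, _, _, _, hσ, hSR, hSm, ?_⟩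
  obtain ⟨g, g1, g2, g3⟩ := h.upper P hZm hpos hD hZb hS hσ hSR hSm
  choose N hN using fun n => bad_choose P (fun n m => h.ST_meas (runMin_ST hT1 n m)) hRn hR n
  have hsum : (∑' n, P (badSet T Rn R n (N n))) ≠ ∞ := by
    refine ne_top_of_le_ne_top ?_ (ENNReal.tsum_le_tsum hN)
    rw [ENNReal.tsum_geometric]
    simp
  have hf := reverse_fatou h P hZm hpos hD (fun n => runMin_ST hT1 n (N n))
    (v := ∫ ω, EvalAt Zb S ω ∂P) fun n => by
      have := runMin_value P hD hv1 hT1 hT2 hT3 n (N n)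
      have h0 : (0:ℝ) ≤ (1/2)^(n + N n) := by positivity
      linarith
  have hge : ∀ᵐ ω ∂P, limsup (fun n => ENNReal.ofReal (Z (ω, runMin T n (N n) ω))) atTop ≤
      limE Z R {ω | ∀ n, Rn n ω < R ω}
        {ω | (∃ n, R ω ≤ Rn n ω) ∧ ∀ n, ∃ k, n ≤ k ∧ T k ω = R ω} ω := by
    filter_upwards [ae_eventually_notMem hsum] with ω hω
    exact limE_ge hRn hR hω
  have hfin : ∫⁻ ω, g ω ∂P ≠ ∞ := ne_top_of_le_ne_top ENNReal.ofReal_ne_top g3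
  have hlt := ae_lt_top g1 hfin
  have hle : (fun ω => limsup (fun n => ENNReal.ofReal (Z (ω, runMin T n (N n) ω))) atTop) ≤ᵐ[P] g := by
    filter_upwards [hge, g2] with ω h1 h2 using h1.trans h2
  have heq := ae_eq_of_ae_le_of_lintegral_le hle
    (ne_top_of_le_ne_top hfin (lintegral_mono_ae hle)) g1.aemeasurable (g3.trans hf)
  have hgv : ∫⁻ ω, g ω ∂P = ENNReal.ofReal (∫ ω, EvalAt Zb S ω ∂P) :=
    le_antisymm g3 (hf.trans (lintegral_mono_ae hle))
  calc _ = ∫ ω, (g ω).toReal ∂P := by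
        refine integral_congr_ae ?_
        filter_upwards [hge, g2, heq, hlt] with ω h1 h2 h3 h4
        rw [divEval_eq hpos hσ (h2.trans_lt h4).ne, le_antisymm h2 (h3 ▸ h1)]
    _ = (∫⁻ ω, g ω ∂P).toReal := integral_toReal g1.aemeasurable hlt
    _ = _ := by rw [hgv, ENNReal.toReal_ofReal hv]

end Helpers

/-- For every `Λ`-stopping time `S`, `E[Z̄_S]` is the supremum of
`E[Z_σ]` over divided stopping times `σ ≥ S`, and the supremum is attained. -/
theorem statement11 (P : Measure Ω) [IsProbabilityMeasure P] [hPc : P.IsComplete]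
    (Λ : MeasurableSpace (Ω × ℝ≥0)) (hΛ : IsMeyer mΩ Λ) (hcomp : IsPCompleteM P Λ)
    (Z : Ω × ℝ≥0∞ → ℝ) (hZm : MeasurableProcessE Λ Z) (hpos : ∀ p, 0 ≤ Z p)
    (hD : ClassD P Λ Z)
    (Zb : Ω × ℝ≥0∞ → ℝ) (hZb : IsSnellProc P Λ Z Zb)
    (S : Ω → ℝ≥0∞) (hS : IsStoppingTimeM Λ S) :
    ∃ (T : Ω → ℝ≥0∞) (Wm W Wp : Set Ω),
      IsDividedST Λ T Wm W Wp ∧ (∀ ω, S ω ≤ T ω) ∧ (∀ ω ∈ Wm, S ω < T ω) ∧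
      ∫ ω, divEval Z T Wm W Wp ω ∂P = ∫ ω, EvalAt Zb S ω ∂P ∧
      ∀ (T' : Ω → ℝ≥0∞) (Wm' W' Wp' : Set Ω), IsDividedST Λ T' Wm' W' Wp' →
        (∀ ω, S ω ≤ T' ω) → (∀ ω ∈ Wm', S ω < T' ω) →
        ∫ ω, divEval Z T' Wm' W' Wp' ω ∂P ≤ ∫ ω, EvalAt Zb S ω ∂P := by
  have h : Good Λ := ⟨hΛ⟩
  obtain ⟨T, Wm, W, Wp, h1, h2, h3, h4⟩ := h.attained P hZm hpos hD hZb hS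
  exact ⟨T, Wm, W, Wp, h1, h2, h3, h4, fun T' Wm' W' Wp' h1' h2' h3' =>
    h.upper_int P hZm hpos hD hZb hS h1' h2' h3'⟩

end Meyer
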